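/- arXiv:math/0304051 — 3 statements merged into one kernel-verified Lean document; each statement's English description precedes it below -/
import Mathlib

section
/- Let (A, 𝔪) be an Artinian local ring with 𝔪 = xA, and let e be the smallest positive integer with x^e = 0. Let M be an A-module such that ann_M(x^{e-1}) = xM. Then ann_M(x^{e-i}) = x^i M for all integers i with 1 ≤ i ≤ e, where ann_M(y) = {μ ∈ M : yμ = 0}. -/
set_option synthInstance.maxHeartbeats 1000000
set_option maxHeartbeats 1000000
set_option linter.unusedVariables false

open CategoryTheory

/-- `Tor_n^R(M, N)`, the `n`-th Tor group of the `R`-modules `M` and `N`. -/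
noncomputable abbrev TorGrp (R : Type) [CommRing R] (n : ℕ)
    (M N : Type) [AddCommGroup M] [Module R M] [AddCommGroup N] [Module R N] : Type :=
  ((Tor (ModuleCat R) n).obj (ModuleCat.of R M)).obj (ModuleCat.of R N)

/-- The absolute integral closure `R⁺` of a domain `R`: the integral closure of `R`
in an algebraic closure of its fraction field. -/
noncomputable abbrev AbsIntClo (R : Type) [CommRing R] [IsDomain R] : Type :=
  integralClosure R (AlgebraicClosure (FractionRing R))

/-- A regular local ring: a Noetherian local ring whose maximal ideal can be generated
by Krull-dimension many elements. -/
def IsRegularLocalRingP (A : Type) [CommRing A] : Prop :=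
  IsNoetherianRing A ∧ ∃ h : IsLocalRing A, ∃ s : Finset A,
    Ideal.span (s : Set A) = @IsLocalRing.maximalIdeal A _ h ∧
      (s.card : WithBot ℕ∞) = ringKrullDim A

/-- A regular ring: a Noetherian ring all of whose localizations at primes are
regular local rings. -/
def IsRegularRingP (A : Type) [CommRing A] : Prop :=
  IsNoetherianRing A ∧
    ∀ (p : Ideal A) (hp : p.IsPrime),
      haveI := hp
      IsRegularLocalRingP (Localization.AtPrime p)

/-- A chain of primes is saturated if each step is a covering relation. -/
def IsSaturatedChain {α : Type} [Preorder α] (c : LTSeries α) : Prop :=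
  ∀ i : Fin c.length, c.toFun i.castSucc ⋖ c.toFun i.succ

/-- A ring is catenary if any two saturated chains of primes with the same endpoints
have the same length. -/
def IsCatenaryRing (A : Type) [CommRing A] : Prop :=
  ∀ c₁ c₂ : LTSeries (PrimeSpectrum A),
    c₁.head = c₂.head → c₁.last = c₂.last →
      IsSaturatedChain c₁ → IsSaturatedChain c₂ → c₁.length = c₂.length

/-- A ring is universally catenary if every finitely generated algebra over it
(i.e. every quotient of a polynomial ring over it) is catenary. -/
def IsUniversallyCatenary (A : Type) [CommRing A] : Prop :=
  ∀ (n : ℕ) (I : Ideal (MvPolynomial (Fin n) A)),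
    IsCatenaryRing (MvPolynomial (Fin n) A ⧸ I)

/-- A `κ`-algebra `B` is geometrically regular if `L ⊗_κ B` is a regular ring for
every finite field extension `L` of `κ`. -/
def IsGeometricallyRegularAlgebra (κ : Type) [Field κ] (B : Type) [CommRing B]
    [Algebra κ B] : Prop :=
  ∀ (L : Type) (_ : Field L) (_ : Algebra κ L) (_ : Module.Finite κ L),
    IsRegularRingP (TensorProduct κ L B)

/-- A ring `A` is a G-ring if for every prime `p` of `A`, all fibers of the completion
map `A_p → (A_p)^∧` are geometrically regular; the fiber at a prime `q` of `A_p` is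
`κ(q) ⊗_{A_p} (A_p)^∧`. -/
def IsGRing (A : Type) [CommRing A] : Prop :=
  ∀ (p : Ideal A) (hp : p.IsPrime),
    haveI := hp
    ∀ (q : Ideal (Localization.AtPrime p)) (hq : q.IsPrime),
      haveI := hq
      IsGeometricallyRegularAlgebra
        (IsLocalRing.ResidueField (Localization.AtPrime q))
        (TensorProduct (Localization.AtPrime p)
          (IsLocalRing.ResidueField (Localization.AtPrime q))
          (AdicCompletion (IsLocalRing.maximalIdeal (Localization.AtPrime p))
            (Localization.AtPrime p)))

/-- A ring `A` is J-2 if the regular locus of every finitely generated `A`-algebra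
is open in its prime spectrum. -/
def IsJ2 (A : Type) [CommRing A] : Prop :=
  ∀ (n : ℕ) (I : Ideal (MvPolynomial (Fin n) A)),
    IsOpen {p : PrimeSpectrum (MvPolynomial (Fin n) A ⧸ I) |
      IsRegularLocalRingP (Localization.AtPrime p.asIdeal)}

/-- A ring is excellent if it is Noetherian, universally catenary, a G-ring, and J-2. -/
def IsExcellentRing (A : Type) [CommRing A] : Prop :=
  IsNoetherianRing A ∧ IsUniversallyCatenary A ∧ IsGRing A ∧ IsJ2 A

/-- A list of elements of a local ring is a system of parameters if its elements lie in
the maximal ideal, its length is the Krull dimension, and the ideal it generates has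
radical the maximal ideal (i.e. is primary to the maximal ideal). -/
def IsSystemOfParameters (R : Type) [CommRing R] [IsLocalRing R] (rs : List R) : Prop :=
  (∀ x ∈ rs, x ∈ IsLocalRing.maximalIdeal R) ∧
    (rs.length : WithBot ℕ∞) = ringKrullDim R ∧
    (Ideal.ofList rs).radical = IsLocalRing.maximalIdeal R

/-- A local ring is Cohen-Macaulay if it is Noetherian and admits a regular sequence of
length equal to its Krull dimension consisting of elements of the maximal ideal. -/
def IsCohenMacaulayLocalRing (R : Type) [CommRing R] : Prop :=
  IsNoetherianRing R ∧ ∃ h : IsLocalRing R,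
    ∃ rs : List R, (∀ x ∈ rs, x ∈ @IsLocalRing.maximalIdeal R _ h) ∧
      RingTheory.Sequence.IsRegular R rs ∧ (rs.length : WithBot ℕ∞) = ringKrullDim R

/-- An `R`-algebra `S` is a big Cohen-Macaulay `R`-algebra if some system of parameters
of `R` is an `S`-regular sequence. -/
def IsBigCohenMacaulayAlgebra (R : Type) [CommRing R] [IsLocalRing R]
    (S : Type) [CommRing S] [Algebra R S] : Prop :=
  ∃ rs : List R, IsSystemOfParameters R rs ∧ RingTheory.Sequence.IsRegular S rs
/-- Let `(A, 𝔪)` be an Artinian local ring with `𝔪 = xA` and let `e` be the smallest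
positive integer with `x^e = 0`. If `M` is an `A`-module with `ann_M(x^{e-1}) = xM`,
then `ann_M(x^{e-i}) = xⁱM` for all `1 ≤ i ≤ e`. -/
theorem annihilator_pow_eq_pow_smul
    (A : Type) [CommRing A] [IsArtinianRing A] [IsLocalRing A]
    (x : A) (hx : IsLocalRing.maximalIdeal A = Ideal.span {x})
    (e : ℕ) (he : 0 < e) (hxe : x ^ e = 0)
    (hmin : ∀ j : ℕ, 0 < j → j < e → x ^ j ≠ 0)
    (M : Type) [AddCommGroup M] [Module A M]
    (hann : ∀ m : M, x ^ (e - 1) • m = 0 ↔ ∃ m' : M, m = x • m') :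
    ∀ i : ℕ, 1 ≤ i → i ≤ e →
      ∀ m : M, x ^ (e - i) • m = 0 ↔ ∃ m' : M, m = x ^ i • m' := by
  intro i hi
  induction i, hi using Nat.le_induction with
  | base => simpa using fun _ => hann
  | succ i hi ih =>
    intro hie m
    constructor
    · intro hm
      obtain ⟨m', rfl⟩ := (ih (by omega) m).1 (by
        rw [show e - i = 1 + (e - (i + 1)) by omega, pow_add, mul_smul, hm, smul_zero])
      rw [← mul_smul, ← pow_add, show e - (i + 1) + i = e - 1 by omega] at hm
      obtain ⟨m'', rfl⟩ := (hann m').1 hm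
      exact ⟨m'', by rw [← mul_smul, ← pow_succ]⟩
    · rintro ⟨m', rfl⟩
      rw [← mul_smul, ← pow_add, Nat.sub_add_cancel hie, hxe, zero_smul]
end

section
/- Let (R, 𝔪) be a d-dimensional excellent Noetherian local Cohen–Macaulay domain of prime characteristic p > 0. Suppose there exists an ideal I of R generated by an R-regular sequence such that 𝔪/I is a cyclic R-module, and suppose R has an isolated singularity (R_𝔭 regular for all primes 𝔭 ≠ 𝔪) or d ≤ 2. If for every finite extension domain R ⊆ S (S a domain, module-finite over R) there exists a finite extension S ⊆ T such that the colon ideal (IS :_S (I :_R 𝔪)S) is contained in 𝔪T, then R is a regular local ring. -/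
set_option synthInstance.maxHeartbeats 1000000
set_option maxHeartbeats 1000000
set_option linter.unusedVariables false

open CategoryTheory

/-- In a Noetherian domain, a minimal prime over a nonzero principal ideal `(z)` becomes
the only nonzero prime after localizing, so some power of `z` lies locally in `(a)`. -/
theorem Ideal.exists_mul_pow_mem_span_singleton_of_mem_minimalPrimes {D : Type*} [CommRing D]
    [IsDomain D] [IsNoetherianRing D] {z : D} {P : Ideal D}
    (hP : P ∈ (Ideal.span {z}).minimalPrimes) {a : D} (ha : a ≠ 0) :
    ∃ s ∉ P, ∃ N : ℕ, s * z ^ N ∈ Ideal.span {a} := by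
  have hPp : P.IsPrime := hP.1.1
  have hzP : z ∈ P := hP.1.2 (Ideal.mem_span_singleton_self z)
  by_contra! hcon
  obtain ⟨Q, hQ, haQ, hdis⟩ := Ideal.exists_le_prime_disjoint (Ideal.span {a})
    (P.primeCompl ⊔ Submonoid.powers z) (by
      rw [Set.disjoint_left]
      intro w hw hw'
      obtain ⟨s, hs, t, ⟨N, rfl⟩, rfl⟩ := Submonoid.mem_sup.1 hw'
      exact hcon s hs N hw)
  rw [Set.disjoint_left] at hdis
  have hQP : Q < P := by
    refine lt_of_le_of_ne (fun w hw => ?_) ?_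
    · by_contra hwP
      exact hdis hw (Submonoid.mem_sup_left hwP)
    · rintro rfl
      exact hdis hzP (Submonoid.mem_sup_right (Submonoid.mem_powers z))
  have h1 := Ideal.height_le_one_of_isPrincipal_of_mem_minimalPrimes _ P hP
  have h2 : Q.height < 1 := (Ideal.height_strict_mono_of_isPrime_of_isPrime hQP).trans_le h1
  have h3 : Q = ⊥ := Ideal.height_eq_zero_iff_eq_bot.1 (Order.lt_one_iff.1 h2)
  have : a ∈ Q := haQ (Ideal.mem_span_singleton_self a)
  rw [h3] at this
  exact ha (by simpa using this)

/-- A Noetherian local domain which is not a field is dominated by a valuation ring of any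
field extension, in such a way that the values of the nonzero elements of the local ring are
bounded by multiples of the least value of a generator of the maximal ideal. -/
theorem IsLocalRing.exists_valuationSubring_archimedean {R K : Type*} [CommRing R] [IsDomain R]
    [IsNoetherianRing R] [IsLocalRing R] [Field K] [Algebra R K] [FaithfulSMul R K]
    {ι : Type*} [Finite ι] (z : ι → R)
    (hz : Ideal.span (Set.range z) = IsLocalRing.maximalIdeal R)
    (hne : IsLocalRing.maximalIdeal R ≠ ⊥) :
    ∃ (V : ValuationSubring K) (i₀ : ι), (∀ r, algebraMap R K r ∈ V) ∧
      (∀ i, V.valuation (algebraMap R K (z i)) ≤ V.valuation (algebraMap R K (z i₀))) ∧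
      V.valuation (algebraMap R K (z i₀)) < 1 ∧
      ∀ a : R, a ≠ 0 → ∃ N : ℕ,
        V.valuation (algebraMap R K (z i₀)) ^ N ≤ V.valuation (algebraMap R K a) := by
  have hinj := FaithfulSMul.algebraMap_injective R K
  have hι : Nonempty ι := by
    by_contra h
    rw [not_nonempty_iff] at h
    exact hne (by rw [← hz, Set.range_eq_empty, Ideal.span_empty])
  obtain ⟨W, hW, hloc⟩ := IsLocalRing.exists_factor_valuationRing (algebraMap R K)
  obtain ⟨i₀, hi₀⟩ := Finite.exists_max fun i => W.valuation (algebraMap R K (z i))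
  have hz0 : z i₀ ≠ 0 := by
    intro h
    apply hne
    rw [← hz, Ideal.span_eq_bot]
    rintro _ ⟨i, rfl⟩
    have := hi₀ i
    simp only [h, map_zero, le_zero_iff, map_eq_zero] at this
    exact hinj (by simpa using this)
  have hz0' : algebraMap R K (z i₀) ≠ 0 := by simpa using hz0
  have hzm : z i₀ ∈ IsLocalRing.maximalIdeal R := hz ▸ Ideal.subset_span ⟨i₀, rfl⟩
  have hWz : W.valuation (algebraMap R K (z i₀)) < 1 := by
    rw [← W.valuation_lt_one_iff ⟨_, hW (z i₀)⟩]
    intro hu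
    exact hzm (hloc.map_nonunit (z i₀) hu)
  set D : Subalgebra R K :=
    Algebra.adjoin R (Set.range fun i => algebraMap R K (z i) / algebraMap R K (z i₀)) with hD
  have hDW : ∀ w ∈ D, w ∈ W := by
    intro w hw
    let W' : Subalgebra R K := { W.toSubring with algebraMap_mem' := hW }
    have : D ≤ W' := by
      rw [hD, Algebra.adjoin_le_iff]
      rintro _ ⟨i, rfl⟩
      change _ ∈ W
      rw [← W.valuation_le_one_iff, map_div₀]
      exact div_le_one_of_le₀ (hi₀ i) zero_le
    exact this hw
  have hDft : Algebra.FiniteType R D :=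
    (Subalgebra.fg_iff_finiteType _).1 (Subalgebra.fg_def.2 ⟨_, Set.finite_range _, rfl⟩)
  have hDn : IsNoetherianRing D := Algebra.FiniteType.isNoetherianRing R D
  set ζ : D := algebraMap R D (z i₀) with hζ
  have hζK : (ζ : K) = algebraMap R K (z i₀) := rfl
  have hζne : Ideal.span {ζ} ≠ ⊤ := by
    rw [Ne, Ideal.span_singleton_eq_top]
    intro hu
    obtain ⟨w, hw⟩ := hu.exists_right_inv
    have h1 : algebraMap R K (z i₀) * (w : K) = 1 := by
      simpa [hζK] using congrArg (Subtype.val : D → K) hw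
    have h2 : W.valuation (algebraMap R K (z i₀)) * W.valuation (w : K) = 1 := by
      rw [← map_mul, h1, map_one]
    have h3 := (W.valuation_le_one_iff _).2 (hDW _ w.2)
    exact absurd h2 (ne_of_lt (mul_lt_one_of_lt_of_le hWz h3))
  obtain ⟨P, hP⟩ := Ideal.nonempty_minimalPrimes hζne
  have hPp : P.IsPrime := hP.1.1
  have hζP : ζ ∈ P := hP.1.2 (Ideal.mem_span_singleton_self ζ)
  let P' : Ideal D.toSubring := P
  have hP' : P'.IsPrime := hPp
  obtain ⟨V, hle, hVloc⟩ := (LocalSubring.ofPrime D.toSubring P').exists_le_valuationSubring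
  have hDV : ∀ w : D, (w : K) ∈ V := fun w => hle (LocalSubring.le_ofPrime D.toSubring P' w.2)
  have hVlt : ∀ w : D, w ∈ P → V.valuation (w : K) < 1 := by
    intro w hw
    rw [← V.valuation_lt_one_iff ⟨_, hDV w⟩]
    intro hu
    have h1 := hVloc.map_nonunit (⟨(w : K), LocalSubring.le_ofPrime D.toSubring P' w.2⟩ :
      (LocalSubring.ofPrime D.toSubring P').toSubring) hu
    exact (IsLocalization.AtPrime.isUnit_to_map_iff
      (LocalSubring.ofPrime D.toSubring P').toSubring P' w).1 h1 hw
  have hVeq : ∀ w : D, w ∉ P → V.valuation (w : K) = 1 := by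
    intro w hw
    rw [← V.valuation_eq_one_iff ⟨_, hDV w⟩]
    have h1 := (IsLocalization.AtPrime.isUnit_to_map_iff
      (LocalSubring.ofPrime D.toSubring P').toSubring P' w).2 hw
    exact h1.map (Subring.inclusion hle)
  refine ⟨V, i₀, fun r => hDV (algebraMap R D r), fun i => ?_, hVlt _ hζP, fun a ha => ?_⟩
  · have h1 : algebraMap R K (z i) / algebraMap R K (z i₀) ∈ D :=
      Algebra.subset_adjoin ⟨i, rfl⟩
    have h2 := (V.valuation_le_one_iff _).2 (hDV ⟨_, h1⟩)
    have h3 : algebraMap R K (z i) =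
      (algebraMap R K (z i) / algebraMap R K (z i₀)) * algebraMap R K (z i₀) := by
      field_simp
    rw [h3, map_mul]
    exact mul_le_of_le_one_left zero_le h2
  · have ha' : algebraMap R D a ≠ 0 := by
      intro h
      exact ha (hinj (by simpa using congrArg (Subtype.val : D → K) h))
    obtain ⟨s, hs, N, hN⟩ :=
      Ideal.exists_mul_pow_mem_span_singleton_of_mem_minimalPrimes hP ha'
    obtain ⟨w, hw⟩ := Ideal.mem_span_singleton.1 hN
    refine ⟨N, ?_⟩
    have h1 : (s : K) * algebraMap R K (z i₀) ^ N = algebraMap R K a * (w : K) := by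
      simpa [hζK] using congrArg (Subtype.val : D → K) hw
    have h2 := congrArg V.valuation h1
    rw [map_mul, map_mul, hVeq s hs, one_mul, map_pow] at h2
    rw [h2]
    exact mul_le_of_le_one_right zero_le ((V.valuation_le_one_iff _).2 (hDV w))

/-- The dagger closure of an ideal `J` along a valuation `v` and a threshold `π < 1`: the
elements multiplied into `J` by elements whose `v`-value is arbitrarily close to `1` when
measured against `π`. -/
def Ideal.daggerClosure {B Γ₀ : Type*} [CommRing B] [LinearOrderedCommGroupWithZero Γ₀]
    (v : Valuation B Γ₀) {π : Γ₀} (hπ : π < 1) (J : Ideal B) : Ideal B where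
  carrier := {b | ∀ t : ℕ, ∃ δ : B, π < v δ ^ t ∧ δ * b ∈ J}
  zero_mem' := fun t => ⟨1, by simpa using hπ, by simp⟩
  add_mem' := by
    intro b c hb hc t
    obtain ⟨δ, hδ, hδb⟩ := hb (2 * t)
    obtain ⟨ε, hε, hεc⟩ := hc (2 * t)
    refine ⟨δ * ε, ?_, ?_⟩
    · rw [map_mul, mul_pow]
      rw [two_mul, pow_add] at hδ hε
      rcases le_total (v δ) (v ε) with h | h
      · exact hδ.trans_le (mul_le_mul_right (pow_le_pow_left₀ zero_le h t) _)
      · exact hε.trans_le (mul_le_mul_left (pow_le_pow_left₀ zero_le h t) _)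
    · have : δ * ε * (b + c) = ε * (δ * b) + δ * (ε * c) := by ring
      rw [this]
      exact J.add_mem (J.mul_mem_left _ hδb) (J.mul_mem_left _ hεc)
  smul_mem' := by
    intro a b hb t
    obtain ⟨δ, hδ, hδb⟩ := hb t
    refine ⟨δ, hδ, ?_⟩
    rw [smul_eq_mul, mul_left_comm]
    exact J.mul_mem_left _ hδb

namespace Ideal

variable {B Γ₀ : Type*} [CommRing B] [LinearOrderedCommGroupWithZero Γ₀]
  {v : Valuation B Γ₀} {π : Γ₀} (hπ : π < 1)

theorem mem_daggerClosure {J : Ideal B} {b : B} :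
    b ∈ J.daggerClosure v hπ ↔ ∀ t : ℕ, ∃ δ : B, π < v δ ^ t ∧ δ * b ∈ J :=
  Iff.rfl

theorem le_daggerClosure (J : Ideal B) : J ≤ J.daggerClosure v hπ :=
  fun b hb t => ⟨1, by simpa using hπ, by simpa using hb⟩

theorem daggerClosure_mono {J L : Ideal B} (h : J ≤ L) :
    J.daggerClosure v hπ ≤ L.daggerClosure v hπ := fun b hb t => by
  obtain ⟨δ, hδ, hδb⟩ := hb t
  exact ⟨δ, hδ, h hδb⟩

/-- If every multiple of `b` lying in `J` lies, after multiplication by `c`, in the dagger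
closure of `L`, this persists for the dagger closure of `J`. -/
theorem mul_mem_daggerClosure_of_forall {J L : Ideal B} {b c : B}
    (h : ∀ δ, δ * b ∈ J → δ * c ∈ L.daggerClosure v hπ) (hb : b ∈ J.daggerClosure v hπ) :
    c ∈ L.daggerClosure v hπ := by
  intro t
  obtain ⟨δ, hδ, hδb⟩ := hb (2 * t)
  obtain ⟨ε, hε, hεc⟩ := h δ hδb (2 * t)
  refine ⟨ε * δ, ?_, by rwa [mul_assoc]⟩
  rw [map_mul, mul_pow]
  rw [two_mul, pow_add] at hδ hε
  rcases le_total (v δ) (v ε) with h | h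
  · exact hδ.trans_le (mul_le_mul_left (pow_le_pow_left₀ zero_le h t) _)
  · exact hε.trans_le (mul_le_mul_right (pow_le_pow_left₀ zero_le h t) _)

/-- A family is independent, in the sense of Lech, up to dagger closure if the coefficients of
any linear relation among its members lie in the dagger closure of the ideal they generate. -/
def DaggerIndependent (v : Valuation B Γ₀) {π : Γ₀} (hπ : π < 1) {ι : Type*} [Fintype ι]
    (w : ι → B) : Prop :=
  ∀ b : ι → B, ∑ i, b i * w i = 0 → ∀ i, b i ∈ (span (Set.range w)).daggerClosure v hπ

theorem span_range_le_span_range_update_of_mul {ι : Type*} [DecidableEq ι]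
    {w : ι → B} {i : ι} {s u : B} (h : w i = s * u) :
    span (Set.range w) ≤ span (Set.range (Function.update w i u)) := by
  rw [span_le]
  rintro _ ⟨j, rfl⟩
  by_cases hj : j = i
  · subst hj
    rw [h]
    exact Ideal.mul_mem_left _ _ (subset_span ⟨j, by simp⟩)
  · exact subset_span ⟨j, by simp [hj]⟩

variable {ι : Type*} [Fintype ι] [DecidableEq ι]

theorem DaggerIndependent.cancel {w : ι → B} (hw : DaggerIndependent v hπ w) {i : ι} {s u c : B}
    (h : w i = s * u) (hc : s * c ∈ (span (Set.range w)).daggerClosure v hπ) :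
    c ∈ (span (Set.range (Function.update w i u))).daggerClosure v hπ := by
  refine mul_mem_daggerClosure_of_forall hπ (fun δ hδ => ?_) hc
  obtain ⟨b, hb⟩ := Ideal.mem_span_range_iff_exists_fun.1 hδ
  have hle := span_range_le_span_range_update_of_mul h
  have hrel : ∑ j, (Function.update (fun j => u * b j) i (u * b i - δ * c)) j * w j = 0 := by
    have h1 : ∀ j, (Function.update (fun j => u * b j) i (u * b i - δ * c)) j * w j =
        u * (b j * w j) - if j = i then δ * c * w i else 0 := by
      intro j
      by_cases hj : j = i
      · subst hj
        simp
        ring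
      · simp [hj]
        ring
    rw [Finset.sum_congr rfl fun j _ => h1 j, Finset.sum_sub_distrib, ← Finset.mul_sum, hb,
      Finset.sum_ite_eq' Finset.univ i, if_pos (Finset.mem_univ i), h]
    ring
  have h2 := daggerClosure_mono hπ hle (hw _ hrel i)
  rw [Function.update_self] at h2
  have h3 : u * b i ∈ (span (Set.range (Function.update w i u))).daggerClosure v hπ :=
    Ideal.mul_mem_right _ _ (le_daggerClosure hπ _ (subset_span ⟨i, by simp⟩))
  simpa using sub_mem h3 h2

/-- Lech's lemma: a factor of a member may replace it in an independent family. -/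
theorem DaggerIndependent.update {w : ι → B} (hw : DaggerIndependent v hπ w) {i : ι} {s u : B}
    (h : w i = s * u) : DaggerIndependent v hπ (Function.update w i u) := by
  intro b hb
  have hle := span_range_le_span_range_update_of_mul h
  have hrel : ∑ j, (Function.update (fun j => s * b j) i (b i)) j * w j = 0 := by
    have h1 : ∀ j, (Function.update (fun j => s * b j) i (b i)) j * w j =
        s * (b j * Function.update w i u j) := by
      intro j
      by_cases hj : j = i
      · subst hj
        simp [h]
        ring
      · simp [hj]
        ring
    rw [Finset.sum_congr rfl fun j _ => h1 j, ← Finset.mul_sum, hb, mul_zero]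
  have h2 := hw _ hrel
  intro j
  by_cases hj : j = i
  · subst hj
    simpa using daggerClosure_mono hπ hle (h2 j)
  · refine hw.cancel hπ h ?_
    simpa [hj] using h2 j

/-- If the `q`-th powers of a family are independent up to dagger closure and the product of
the `(q - 1)`-st powers lies in the ideal they generate, then the dagger closure of the ideal
generated by the family is the unit ideal. -/
theorem DaggerIndependent.one_mem {Z : ι → B} {q : ℕ}
    (hw : DaggerIndependent v hπ fun i => Z i ^ (q + 1))
    (hprod : ∏ i, Z i ^ q ∈ span (Set.range fun i => Z i ^ (q + 1))) :
    (1 : B) ∈ (span (Set.range Z)).daggerClosure v hπ := by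
  have key : ∀ s : Finset ι,
      DaggerIndependent v hπ (fun i => if i ∈ s then Z i else Z i ^ (q + 1)) ∧
      ∏ i ∈ sᶜ, Z i ^ q ∈
        (span (Set.range fun i => if i ∈ s then Z i else Z i ^ (q + 1))).daggerClosure v hπ := by
    intro s
    induction s using Finset.induction_on with
    | empty => simpa using ⟨hw, le_daggerClosure hπ _ hprod⟩
    | insert a s ha ih =>
      have hup : (fun i => if i ∈ insert a s then Z i else Z i ^ (q + 1)) =
          Function.update (fun i => if i ∈ s then Z i else Z i ^ (q + 1)) a (Z a) := by
        funext i
        by_cases hi : i = a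
        · subst hi
          simp
        · simp [hi]
      have hfac : (fun i => if i ∈ s then Z i else Z i ^ (q + 1)) a = Z a ^ q * Z a := by
        simp [ha, pow_succ]
      rw [hup]
      refine ⟨ih.1.update hπ hfac, ih.1.cancel hπ hfac ?_⟩
      rw [Finset.compl_insert, Finset.mul_prod_erase _ (fun i => Z i ^ q) (by simpa using ha)]
      exact ih.2
  simpa using (key Finset.univ).2

end Ideal
open RingTheory.Sequence in
theorem IsLocalRing.isWeaklyRegular_map_pow_append {R : Type*} [CommRing R] [IsNoetherianRing R]
    [IsLocalRing R] (N : ℕ) (hN : N ≠ 0) (rs ss : List R) (h : IsWeaklyRegular R (rs ++ ss))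
    (hm : ∀ r ∈ rs ++ ss, r ∈ IsLocalRing.maximalIdeal R) :
    IsWeaklyRegular R (rs.map (· ^ N) ++ ss) := by
  induction rs generalizing ss with
  | nil => simpa using h
  | cons r rs ih =>
    have h1 : IsWeaklyRegular R ((rs ++ ss) ++ [r]) :=
      IsLocalRing.isWeaklyRegular_of_perm_of_subset_maximalIdeal h
        (List.perm_append_singleton r (rs ++ ss)).symm hm
    rw [isWeaklyRegular_append_iff, isWeaklyRegular_singleton_iff] at h1
    have h2 : IsWeaklyRegular R ((rs ++ ss) ++ [r ^ N]) := by
      rw [isWeaklyRegular_append_iff, isWeaklyRegular_singleton_iff]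
      exact ⟨h1.1, h1.2.pow N⟩
    have hmN : ∀ r' ∈ r ^ N :: (rs ++ ss), r' ∈ IsLocalRing.maximalIdeal R := by
      intro r' hr'
      rcases List.mem_cons.1 hr' with rfl | hr'
      · exact Ideal.pow_mem_of_mem _ (hm r (by simp)) N (Nat.pos_of_ne_zero hN)
      · exact hm r' (List.mem_cons_of_mem _ hr')
    have h3 : IsWeaklyRegular R (rs ++ (r ^ N :: ss)) :=
      IsLocalRing.isWeaklyRegular_of_perm_of_subset_maximalIdeal h2
        ((List.perm_append_singleton (r ^ N) (rs ++ ss)).trans List.perm_middle.symm)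
        (fun r' hr' => hmN r' ((List.perm_append_singleton (r ^ N) (rs ++ ss)).mem_iff.1 hr'))
    have h4 := ih (r ^ N :: ss) h3 (fun r' hr' => hmN r' (List.perm_middle.mem_iff.1 hr'))
    refine IsLocalRing.isWeaklyRegular_of_perm_of_subset_maximalIdeal h4 ?_ ?_
    · simp
    · intro r' hr'
      rw [List.perm_middle.mem_iff, List.mem_cons, List.mem_append, List.mem_map] at hr'
      rcases hr' with rfl | ⟨s, hs, rfl⟩ | hr'
      · exact hmN _ (by simp)
      · exact Ideal.pow_mem_of_mem _ (hm s (by simp [hs])) N (Nat.pos_of_ne_zero hN)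
      · exact hm _ (by simp [hr'])

open RingTheory.Sequence in
/-- The coefficients of a linear relation among the members of a regular sequence of a Noetherian
local ring lie in the ideal generated by the sequence. -/
theorem IsLocalRing.mem_ofList_of_sum_mul_eq_zero {R : Type*} [CommRing R] [IsNoetherianRing R]
    [IsLocalRing R] {rs : List R} (h : IsWeaklyRegular R rs)
    (hm : ∀ r ∈ rs, r ∈ IsLocalRing.maximalIdeal R) (b : Fin rs.length → R)
    (hb : ∑ i, b i * rs.get i = 0) (i : Fin rs.length) : b i ∈ Ideal.ofList rs := by
  have h1 : IsWeaklyRegular R (rs.eraseIdx i ++ [rs.get i]) :=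
    IsLocalRing.isWeaklyRegular_of_perm_of_subset_maximalIdeal h
      ((List.perm_append_singleton _ _).trans (List.getElem_cons_eraseIdx_perm i.2)).symm hm
  rw [isWeaklyRegular_append_iff, isWeaklyRegular_singleton_iff] at h1
  have h2 : b i * rs.get i ∈ Ideal.ofList (rs.eraseIdx i) := by
    rw [← Finset.add_sum_erase _ _ (Finset.mem_univ i), add_eq_zero_iff_eq_neg] at hb
    rw [hb]
    refine neg_mem (sum_mem fun j hj => Ideal.mul_mem_left _ _ (Ideal.subset_span ?_))
    exact List.mem_eraseIdx_iff_getElem.2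
      ⟨j, j.2, fun hji => (Finset.mem_erase.1 hj).1 (Fin.ext hji), rfl⟩
  have h3 : Ideal.ofList (rs.eraseIdx i) ≤ Ideal.ofList rs :=
    Ideal.span_mono fun r hr => (List.eraseIdx_sublist rs i).subset hr
  apply h3
  have h4 : rs.get i • (Submodule.Quotient.mk (b i) :
      R ⧸ (Ideal.ofList (rs.eraseIdx i) • ⊤ : Submodule R R)) = 0 := by
    rw [← Submodule.Quotient.mk_smul, Submodule.Quotient.mk_eq_zero, smul_eq_mul]
    simpa [mul_comm] using h2
  have h5 := h1.2.right_eq_zero_of_smul h4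
  rw [Submodule.Quotient.mk_eq_zero] at h5
  simpa using h5

open RingTheory.Sequence in
theorem IsLocalRing.mem_span_of_sum_mul_pow_eq_zero {R : Type*} [CommRing R] [IsNoetherianRing R]
    [IsLocalRing R] {rs : List R} (h : IsWeaklyRegular R rs)
    (hm : ∀ r ∈ rs, r ∈ IsLocalRing.maximalIdeal R) {N : ℕ} (hN : N ≠ 0) (b : Fin rs.length → R)
    (hb : ∑ i, b i * rs.get i ^ N = 0) (i : Fin rs.length) :
    b i ∈ Ideal.span (Set.range fun i => rs.get i ^ N) := by
  have h1 : IsWeaklyRegular R (rs.map (· ^ N)) := by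
    simpa using IsLocalRing.isWeaklyRegular_map_pow_append N hN rs [] (by simpa using h)
      (by simpa using hm)
  have h2 : ∀ r ∈ rs.map (· ^ N), r ∈ IsLocalRing.maximalIdeal R := by
    intro r hr
    obtain ⟨s, hs, rfl⟩ := List.mem_map.1 hr
    exact Ideal.pow_mem_of_mem _ (hm s hs) N (Nat.pos_of_ne_zero hN)
  have hlen : (rs.map (· ^ N)).length = rs.length := by simp
  have h3 := IsLocalRing.mem_ofList_of_sum_mul_eq_zero h1 h2 (fun j => b (j.cast hlen)) (by
    rw [← hb]
    exact Fintype.sum_equiv (finCongr hlen) _ _ fun j => by simp) (i.cast hlen.symm)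
  refine Ideal.span_mono ?_ (by simpa using h3)
  intro r hr
  obtain ⟨s, hs, rfl⟩ := List.mem_map.1 hr
  obtain ⟨j, rfl⟩ := List.mem_iff_get.1 hs
  exact ⟨j, rfl⟩

/-- A finite torsion-free module over a domain embeds in a finite free module, with cokernel
killed by a nonzero element. -/
theorem Module.Finite.exists_smul_eq_sum {R M : Type*} [CommRing R] [IsDomain R] [AddCommGroup M]
    [Module R M] [Module.Finite R M] [Module.IsTorsionFree R M] :
    ∃ (a : R) (s : Finset M) (φ : M →ₗ[R] s → R), a ≠ 0 ∧ ∀ m, a • m = ∑ k, φ m k • (k : M) := by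
  classical
  obtain ⟨s, hs, hli⟩ := exists_set_linearIndependent R M
  have hfin : s.Finite := by
    have := Cardinal.lt_aleph0_iff_set_finite.1 (hs ▸ Module.rank_lt_aleph0 R M)
    exact this
  have hli' : LinearIndependent R ((↑) : s → M) := hli
  have htors : ∀ m : M, ∃ a : R, a ≠ 0 ∧ a • m ∈ Submodule.span R s := by
    have h0 : Module.rank R (M ⧸ Submodule.span R s) = 0 := by
      have h1 := Submodule.rank_quotient_add_rank (Submodule.span R s)
      rw [rank_span_set hli', hs] at h1
      have h2 := Module.rank_lt_aleph0 R M
      exact (Cardinal.add_eq_right_iff.1 h1).resolve_left (by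
        intro h
        exact absurd (le_trans (le_max_left _ _) h) (not_le.2 h2))
    intro m
    obtain ⟨a, ha, ham⟩ := rank_eq_zero_iff.1 h0 (Submodule.Quotient.mk m)
    refine ⟨a, ha, ?_⟩
    rwa [← Submodule.Quotient.mk_smul, Submodule.Quotient.mk_eq_zero] at ham
  choose d hd hdm using htors
  obtain ⟨G, hG⟩ := Module.Finite.fg_top (R := R) (M := M)
  have hall : ∀ m, (∏ g ∈ G, d g) • m ∈ Submodule.span R s := by
    intro m
    have hm : m ∈ Submodule.span R (G : Set M) := hG ▸ Submodule.mem_top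
    induction hm using Submodule.span_induction with
    | mem g hg =>
      rw [← Finset.prod_erase_mul G d hg, mul_smul]
      exact Submodule.smul_mem _ _ (hdm g)
    | zero => simp
    | add _ _ _ _ h1 h2 => rw [smul_add]; exact add_mem h1 h2
    | smul r _ _ h => rw [smul_comm]; exact Submodule.smul_mem _ _ h
  lift s to Finset M using hfin
  let b := Module.Basis.span hli'
  have hall' : ∀ m, (LinearMap.lsmul R M (∏ g ∈ G, d g)) m ∈
      Submodule.span R (Set.range ((↑) : s → M)) := by
    intro m
    rw [Subtype.range_coe_subtype]
    exact hall m
  refine ⟨∏ g ∈ G, d g, s,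
    b.equivFun.toLinearMap ∘ₗ (LinearMap.lsmul R M (∏ g ∈ G, d g)).codRestrict _ hall',
    Finset.prod_ne_zero_iff.2 fun g _ => hd g, fun m => ?_⟩
  have h := congrArg Subtype.val
    (b.sum_equivFun ((LinearMap.lsmul R M (∏ g ∈ G, d g)).codRestrict _ hall' m))
  simp only [LinearMap.codRestrict_apply, LinearMap.lsmul_apply, Submodule.coe_sum,
    Submodule.coe_smul] at h
  rw [← h]
  refine Finset.sum_congr rfl fun k _ => ?_
  have hk : ((b k : Submodule.span R (Set.range ((↑) : s → M))) : M) = k :=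
    congrArg Subtype.val (Module.Basis.span_apply hli' k)
  rw [hk]
  rfl

/-- A form of almost Cohen-Macaulayness of perfect integral extensions in positive
characteristic. -/
theorem Ideal.daggerIndependent_algebraMap {R B Γ₀ : Type*} [CommRing R] [IsDomain R] [CommRing B]
    [IsDomain B] [Algebra R B] [FaithfulSMul R B] [Algebra.IsIntegral R B]
    [LinearOrderedCommGroupWithZero Γ₀] {p : ℕ} (hp : p.Prime) [ExpChar B p] [PerfectRing B p]
    {v : Valuation B Γ₀} {π : Γ₀} (hπ : π < 1) (hπ₀ : 0 < π)
    (harch : ∀ a : R, a ≠ 0 → ∃ N : ℕ, π ^ N ≤ v (algebraMap R B a))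
    {ι : Type*} [Fintype ι] (x : ι → R)
    (hx : ∀ N : ℕ, N ≠ 0 → ∀ b : ι → R, ∑ i, b i * x i ^ N = 0 →
      ∀ i, b i ∈ Ideal.span (Set.range fun i => x i ^ N)) :
    Ideal.DaggerIndependent v hπ fun i => algebraMap R B (x i) := by
  intro b hb i t
  have : Module.Finite R (Algebra.adjoin R (Set.range b)) :=
    Algebra.finite_adjoin_of_finite_of_isIntegral (Set.finite_range b)
      fun y _ => Algebra.IsIntegral.isIntegral y
  have : FaithfulSMul R (Algebra.adjoin R (Set.range b)) := inferInstance
  have : Module.IsTorsionFree R (Algebra.adjoin R (Set.range b)) := inferInstance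
  obtain ⟨a, s, φ, ha, hφ⟩ :=
    Module.Finite.exists_smul_eq_sum (R := R) (M := Algebra.adjoin R (Set.range b))
  obtain ⟨N, hN⟩ := harch a ha
  obtain ⟨f, hf⟩ : ∃ f, N * t < p ^ f := ⟨N * t, Nat.lt_pow_self hp.one_lt⟩
  have hQ : p ^ f ≠ 0 := (pow_pos hp.pos f).ne'
  let r : B → B := (iterateFrobeniusEquiv B p f).symm
  have hr : ∀ z, r z ^ p ^ f = z := fun z => by
    rw [← iterateFrobeniusEquiv_def, RingEquiv.apply_symm_apply]
  refine ⟨r (algebraMap R B a), ?_, ?_⟩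
  · by_contra! h
    have h1 : π ^ (N * t) ≤ π ^ p ^ f := by
      calc π ^ (N * t) = (π ^ N) ^ t := pow_mul _ _ _
        _ ≤ v (algebraMap R B a) ^ t := pow_le_pow_left₀ zero_le hN t
        _ = (v (r (algebraMap R B a)) ^ t) ^ p ^ f := by
          rw [← pow_mul, mul_comm, pow_mul, ← map_pow v (r _), hr]
        _ ≤ π ^ p ^ f := pow_le_pow_left₀ zero_le h _
    exact absurd h1 (not_le.2 (pow_lt_pow_right_of_lt_one₀ hπ₀ hπ hf))
  · let b' : ι → Algebra.adjoin R (Set.range b) :=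
      fun j => ⟨b j, Algebra.subset_adjoin ⟨j, rfl⟩⟩
    have hb' : ∑ j, x j ^ p ^ f • b' j ^ p ^ f = 0 := by
      apply Subtype.ext
      have h1 := congrArg (iterateFrobenius B p f) hb
      rw [map_sum, map_zero] at h1
      simp only [iterateFrobenius_def, mul_pow] at h1
      simpa [b', Algebra.smul_def, mul_comm] using h1
    have hcoord : ∀ k, φ (b' i ^ p ^ f) k ∈ Ideal.span (Set.range fun j => x j ^ p ^ f) := by
      intro k
      refine hx _ hQ (fun j => φ (b' j ^ p ^ f) k) ?_ i
      have h1 := congrFun (congrArg φ hb') k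
      simpa [mul_comm] using h1
    choose c hc using fun k => Ideal.mem_span_range_iff_exists_fun.1 (hcoord k)
    refine Ideal.mem_span_range_iff_exists_fun.2
      ⟨fun j => r (∑ k, algebraMap R B (c k j) * (k : Algebra.adjoin R (Set.range b))), ?_⟩
    apply (iterateFrobeniusEquiv B p f).injective
    rw [map_sum]
    simp only [iterateFrobeniusEquiv_def, mul_pow, hr]
    have h2 := congrArg Subtype.val (hφ (b' i ^ p ^ f))
    simp only [← hc] at h2
    have h3 : algebraMap R B a * b i ^ p ^ f =
        ∑ k, (∑ j, algebraMap R B (c k j) * algebraMap R B (x j) ^ p ^ f) *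
          ((k : Algebra.adjoin R (Set.range b)) : B) := by
      simpa [b', Algebra.smul_def] using h2
    rw [h3]
    simp only [Finset.sum_mul]
    rw [Finset.sum_comm]
    refine Finset.sum_congr rfl fun k _ => Finset.sum_congr rfl fun j _ => ?_
    ring

section

variable {R B Γ₀ : Type*} [CommRing R] [IsDomain R] [CommRing B] [IsDomain B] [Algebra R B]
  [FaithfulSMul R B] [Algebra.IsIntegral R B] [LinearOrderedCommGroupWithZero Γ₀] {p : ℕ}
  [ExpChar B p] [PerfectRing B p] {v : Valuation B Γ₀} {π : Γ₀} {ι : Type*} [Fintype ι]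
  {x a : ι → R} {y : R} {n : ℕ}

/-- If `x` is a regular sequence, `y ^ n ∈ (x)` and every element multiplying `y ^ (n - 1)` into
`(x)` lies in `(y, x)`, then `(y, x)` is independent up to dagger closure. -/
theorem Ideal.daggerIndependent_option (hp : p.Prime) (hπ : π < 1) (hπ₀ : 0 < π)
    (harch : ∀ a : R, a ≠ 0 → ∃ N : ℕ, π ^ N ≤ v (algebraMap R B a))
    (hx : ∀ N : ℕ, N ≠ 0 → ∀ b : ι → R, ∑ i, b i * x i ^ N = 0 →
      ∀ i, b i ∈ Ideal.span (Set.range fun i => x i ^ N))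
    (hn : 2 ≤ n) (hy : y ^ n = ∑ i, a i * x i)
    (ha : ∀ i, a i ∈ Ideal.span (Set.range fun o : Option ι => o.elim y x))
    (hcolon : ∀ c : B, c * algebraMap R B y ^ (n - 1) ∈
      Ideal.span (Set.range fun i => algebraMap R B (x i)) →
      c ∈ Ideal.span (Set.range fun o : Option ι => algebraMap R B (o.elim y x))) :
    Ideal.DaggerIndependent v hπ fun o : Option ι => algebraMap R B (o.elim y x) := by
  intro b hb
  set I := Ideal.span (Set.range fun i => algebraMap R B (x i)) with hI
  set m := Ideal.span (Set.range fun o : Option ι => algebraMap R B (o.elim y x)) with hm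
  have hxI : ∀ i, algebraMap R B (x i) ∈ I := fun i => Ideal.subset_span ⟨i, rfl⟩
  have hym : algebraMap R B y ∈ m := Ideal.subset_span ⟨none, rfl⟩
  have hIm : I ≤ m := Ideal.span_le.2 (by
    rintro _ ⟨i, rfl⟩
    exact Ideal.subset_span ⟨some i, rfl⟩)
  have ham : ∀ i, algebraMap R B (a i) ∈ m := fun i => by
    have h1 := Ideal.mem_map_of_mem (algebraMap R B) (ha i)
    rwa [Ideal.map_span, ← Set.range_comp] at h1
  simp only [Fintype.sum_option, Option.elim_none, Option.elim_some] at hb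
  have hbI : b none * algebraMap R B y ∈ I := by
    rw [eq_neg_of_add_eq_zero_left hb]
    exact neg_mem (Ideal.sum_mem _ fun i _ => I.mul_mem_left _ (hxI i))
  have hstep : ∀ j, j ≤ n - 1 → ∃ e, b none - algebraMap R B y ^ j * e ∈ I := by
    intro j
    induction j with
    | zero => exact fun _ => ⟨b none, by simp⟩
    | succ j ih =>
      intro hj
      obtain ⟨e, he⟩ := ih (by omega)
      have h1 : e * algebraMap R B y ^ (n - 1) ∈ I := by
        obtain ⟨l, hl⟩ : ∃ l, n - 1 = j + 1 + l := ⟨n - 1 - (j + 1), by omega⟩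
        have h2 := I.mul_mem_left (algebraMap R B y ^ l)
          (sub_mem hbI (I.mul_mem_left (algebraMap R B y) he))
        have h3 : e * algebraMap R B y ^ (n - 1) = algebraMap R B y ^ l *
            (b none * algebraMap R B y -
              algebraMap R B y * (b none - algebraMap R B y ^ j * e)) := by
          rw [hl]
          ring
        rwa [h3]
      obtain ⟨c, hc⟩ := Ideal.mem_span_range_iff_exists_fun.1 (hcolon e h1)
      simp only [Fintype.sum_option, Option.elim_none, Option.elim_some] at hc
      refine ⟨c none, ?_⟩
      have h4 : b none - algebraMap R B y ^ (j + 1) * c none =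
          (b none - algebraMap R B y ^ j * e) +
            algebraMap R B y ^ j * ∑ i, c (some i) * algebraMap R B (x i) := by
        rw [← hc]
        ring
      rw [h4]
      exact add_mem he (I.mul_mem_left _ (Ideal.sum_mem _ fun i _ => I.mul_mem_left _ (hxI i)))
  obtain ⟨e, he⟩ := hstep (n - 1) le_rfl
  obtain ⟨c, hc⟩ := Ideal.mem_span_range_iff_exists_fun.1 he
  have hrel : ∑ i, (b (some i) + algebraMap R B y * c i + algebraMap R B (a i) * e) *
      algebraMap R B (x i) = 0 := by
    have h1 : algebraMap R B y ^ n = ∑ i, algebraMap R B (a i) * algebraMap R B (x i) := by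
      rw [← map_pow, hy, map_sum]
      simp only [map_mul]
    have h2 : algebraMap R B y ^ n = algebraMap R B y * algebraMap R B y ^ (n - 1) := by
      rw [← pow_succ', Nat.sub_add_cancel (by omega)]
    have h3 : ∀ i, (b (some i) + algebraMap R B y * c i + algebraMap R B (a i) * e) *
      algebraMap R B (x i) = b (some i) * algebraMap R B (x i) +
        algebraMap R B y * (c i * algebraMap R B (x i)) +
        e * (algebraMap R B (a i) * algebraMap R B (x i)) := fun i => by ring
    simp only [h3, Finset.sum_add_distrib, ← Finset.mul_sum]
    rw [hc, ← h1, h2, ← hb]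
    ring
  have hac := Ideal.daggerIndependent_algebraMap hp hπ hπ₀ harch x hx _ hrel
  rintro (_ | i)
  · refine Ideal.le_daggerClosure hπ _ ?_
    have h1 := add_mem (hIm he) (m.mul_mem_right e (Ideal.pow_mem_of_mem m hym (n - 1) (by omega)))
    simpa using h1
  · have h1 := Ideal.daggerClosure_mono hπ hIm (hac i)
    have h2 := Ideal.le_daggerClosure (v := v) hπ m
      (add_mem (m.mul_mem_right (c i) hym) (m.mul_mem_right e (ham i)))
    have h3 := sub_mem h1 h2
    rwa [add_assoc, add_sub_cancel_right] at h3

theorem Ideal.false_of_colon_le_of_valuation (hp : p.Prime) (hπ : π < 1) (hπ₀ : 0 < π)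
    (hv : ∀ b, v b ≤ 1) (hvπ : ∀ o : Option ι, v (algebraMap R B (o.elim y x)) ≤ π)
    (harch : ∀ a : R, a ≠ 0 → ∃ N : ℕ, π ^ N ≤ v (algebraMap R B a))
    (hx : ∀ N : ℕ, N ≠ 0 → ∀ b : ι → R, ∑ i, b i * x i ^ N = 0 →
      ∀ i, b i ∈ Ideal.span (Set.range fun i => x i ^ N))
    (hn : 2 ≤ n) (hy : y ^ n = ∑ i, a i * x i)
    (ha : ∀ i, a i ∈ Ideal.span (Set.range fun o : Option ι => o.elim y x))
    (hcolon : ∀ c : B, c * algebraMap R B y ^ (n - 1) ∈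
      Ideal.span (Set.range fun i => algebraMap R B (x i)) →
      c ∈ Ideal.span (Set.range fun o : Option ι => algebraMap R B (o.elim y x))) : False := by
  classical
  have hind := Ideal.daggerIndependent_option hp hπ hπ₀ harch hx hn hy ha hcolon
  obtain ⟨f, hf⟩ : ∃ f, n + 1 < p ^ f := ⟨n + 1, Nat.lt_pow_self hp.one_lt⟩
  let r : B ≃+* B := (iterateFrobeniusEquiv B p f).symm
  have hr : ∀ z, r z ^ p ^ f = z := fun z => by
    rw [← iterateFrobeniusEquiv_def, RingEquiv.apply_symm_apply]
  obtain ⟨q, hq⟩ : ∃ q, p ^ f = q + 1 := ⟨p ^ f - 1, by omega⟩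
  let Z : Option ι → B := fun o => r (algebraMap R B (o.elim y x))
  have hZ : (fun o => Z o ^ (q + 1)) = fun o : Option ι => algebraMap R B (o.elim y x) := by
    funext o
    rw [← hq, hr]
  have hprod : ∏ o, Z o ^ q ∈ Ideal.span (Set.range fun o => Z o ^ (q + 1)) := by
    have h1 : Z none ^ n = ∑ i, r (algebraMap R B (a i)) * Z (some i) := by
      change r (algebraMap R B y) ^ n = ∑ i, r (algebraMap R B (a i)) * r (algebraMap R B (x i))
      rw [← map_pow, ← map_pow, hy, map_sum, map_sum]
      simp only [map_mul]
    have h2 : Z none ^ q = Z none ^ (q - n) * Z none ^ n := by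
      rw [← pow_add, Nat.sub_add_cancel (by omega)]
    rw [Fintype.prod_option, h2, h1, mul_assoc, Finset.sum_mul]
    refine Ideal.mul_mem_left _ _ (Ideal.sum_mem _ fun i _ => ?_)
    rw [← Finset.mul_prod_erase _ _ (Finset.mem_univ i)]
    have h3 : Z (some i) ^ (q + 1) ∈ Ideal.span (Set.range fun o => Z o ^ (q + 1)) :=
      Ideal.subset_span ⟨some i, rfl⟩
    convert Ideal.mul_mem_left _ (r (algebraMap R B (a i)) *
      ∏ j ∈ Finset.univ.erase i, Z (some j) ^ q) h3 using 1
    ring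
  obtain ⟨δ, hδ, hδZ⟩ := Ideal.DaggerIndependent.one_mem hπ (hZ ▸ hind) hprod (q + 1)
  rw [mul_one] at hδZ
  obtain ⟨d, hd⟩ := Ideal.mem_span_range_iff_exists_fun.1 hδZ
  refine absurd hδ (not_lt.2 ?_)
  rw [← map_pow, ← hd, ← hq, ← iterateFrobenius_def, map_sum]
  refine v.map_sum_le fun o _ => ?_
  rw [iterateFrobenius_def, mul_pow, hr, map_mul]
  exact mul_le_of_le_one_left' (hv _) |>.trans (hvπ o)

end

/-- The integral closure of a domain in an algebraically closed field of characteristic `p` is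
perfect. -/
theorem integralClosure.perfectRing {R K : Type*} [CommRing R] [Field K] [Algebra R K]
    [IsAlgClosed K] {p : ℕ} (hp : p.Prime) [ExpChar (integralClosure R K) p] :
    PerfectRing (integralClosure R K) p := by
  refine PerfectRing.ofSurjective _ p fun z => ?_
  obtain ⟨y, hy⟩ := IsAlgClosed.exists_pow_nat_eq (z : K) hp.pos
  have hint : IsIntegral R y := IsIntegral.of_pow hp.pos (hy ▸ z.2)
  exact ⟨⟨y, hint⟩, Subtype.ext hy⟩

/-- Every integral extension of an integral subalgebra of an algebraically closed field maps to the
integral closure of the base. -/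
theorem Subalgebra.exists_ringHom_integralClosure {R K T : Type*} [CommRing R] [Field K]
    [Algebra R K] [IsAlgClosed K] (S : Subalgebra R K) [Algebra.IsIntegral R S] [CommRing T]
    [Algebra S T] (hinj : Function.Injective (algebraMap S T)) [Algebra.IsIntegral S T] :
    ∃ g : T →+* integralClosure R K, ∀ s : S, (g (algebraMap S T s) : K) = s := by
  obtain ⟨P, -, hP, hcomap⟩ := Ideal.exists_ideal_over_prime_of_isIntegral (⊥ : Ideal S)
    (⊥ : Ideal T) (by rw [← RingHom.ker_eq_comap_bot, (RingHom.injective_iff_ker_eq_bot _).1 hinj])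
  have hfaith : FaithfulSMul S (T ⧸ P) := by
    rw [faithfulSMul_iff_algebraMap_injective]
    rw [RingHom.injective_iff_ker_eq_bot, ← hcomap]
    ext s
    rw [RingHom.mem_ker, Ideal.mem_comap, IsScalarTower.algebraMap_apply S T (T ⧸ P),
      Ideal.Quotient.algebraMap_eq, Ideal.Quotient.eq_zero_iff_mem]
  have : IsDomain (T ⧸ P) := Ideal.Quotient.isDomain P
  have : Module.IsTorsionFree S (T ⧸ P) := FaithfulSMul.to_isTorsionFree S (T ⧸ P)
  have : FaithfulSMul S K := by
    rw [faithfulSMul_iff_algebraMap_injective]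
    exact Subtype.val_injective
  have : Module.IsTorsionFree S K := FaithfulSMul.to_isTorsionFree S K
  have : Algebra.IsIntegral S (T ⧸ P) :=
    Algebra.IsIntegral.of_surjective (Ideal.Quotient.mkₐ S P) (Ideal.Quotient.mkₐ_surjective S P)
  have : Algebra.IsAlgebraic S (T ⧸ P) := inferInstance
  let f : T →ₐ[S] K := (IsAlgClosed.lift : (T ⧸ P) →ₐ[S] K).comp (Ideal.Quotient.mkₐ S P)
  refine ⟨f.toRingHom.codRestrict (integralClosure R K) fun t => ?_, fun s => f.commutes s⟩
  exact isIntegral_trans (A := S) _ ((Algebra.IsIntegral.isIntegral t).map f)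

/-- If every finite extension domain of `R` is contained in a finite extension in which the
extended colon ideal lies in the extension of `M`, the same holds in the integral closure of `R` in
an algebraically closed field. -/
theorem integralClosure.mem_map_of_mul_mem_map {R K : Type} [CommRing R] [IsDomain R] [Field K]
    [IsAlgClosed K] [Algebra R K] [FaithfulSMul R K] {I J M : Ideal R} {w : R}
    (hJ : J ≤ I ⊔ Ideal.span {w})
    (hext : ∀ (S : Type) (_ : CommRing S) (_ : IsDomain S) (_ : Algebra R S),
      Function.Injective (algebraMap R S) → Module.Finite R S →
        ∃ (T : Type) (_ : CommRing T) (_ : Algebra S T),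
          Function.Injective (algebraMap S T) ∧ Module.Finite S T ∧
            Ideal.map (algebraMap S T) (Submodule.colon (Ideal.map (algebraMap R S) I)
              (Ideal.map (algebraMap R S) J)) ≤
            Ideal.map (algebraMap S T) (Ideal.map (algebraMap R S) M))
    {ι : Type*} [Fintype ι] {x : ι → R} (hx : ∀ i, x i ∈ I) (c : integralClosure R K)
    (hc : c * algebraMap R (integralClosure R K) w ∈
      Ideal.span (Set.range fun i => algebraMap R (integralClosure R K) (x i))) :
    c ∈ M.map (algebraMap R (integralClosure R K)) := by
  obtain ⟨b, hb⟩ := Ideal.mem_span_range_iff_exists_fun.1 hc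
  let s : Set K := insert (c : K) (Set.range fun i => (b i : K))
  have hs : ∀ z ∈ s, IsIntegral R z := by
    rintro z (rfl | ⟨i, rfl⟩)
    exacts [c.2, (b i).2]
  have hfin : Module.Finite R (Algebra.adjoin R s) :=
    Algebra.finite_adjoin_of_finite_of_isIntegral ((Set.finite_range _).insert _) hs
  have hint : Algebra.IsIntegral R (Algebra.adjoin R s) := inferInstance
  obtain ⟨T, _, _, hT, hTfin, hle⟩ := hext (Algebra.adjoin R s) inferInstance inferInstance
    inferInstance (FaithfulSMul.algebraMap_injective R _) hfin
  obtain ⟨g, hg⟩ := Subalgebra.exists_ringHom_integralClosure (Algebra.adjoin R s) hT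
  let c' : Algebra.adjoin R s := ⟨c, Algebra.subset_adjoin (Set.mem_insert _ _)⟩
  let b' : ι → Algebra.adjoin R s :=
    fun i => ⟨b i, Algebra.subset_adjoin (Set.mem_insert_of_mem _ ⟨i, rfl⟩)⟩
  have hw : c' * algebraMap R _ w ∈ I.map (algebraMap R (Algebra.adjoin R s)) := by
    have h1 : c' * algebraMap R _ w = ∑ i, b' i * algebraMap R _ (x i) := by
      apply Subtype.ext
      have h2 := congrArg Subtype.val hb
      simpa [c', b'] using h2.symm
    rw [h1]
    exact sum_mem fun i _ => Ideal.mul_mem_left _ _ (Ideal.mem_map_of_mem _ (hx i))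
  have hcolon : c' ∈ Submodule.colon (I.map (algebraMap R (Algebra.adjoin R s)))
      (J.map (algebraMap R (Algebra.adjoin R s))) := by
    rw [Submodule.mem_colon]
    have h1 : J.map (algebraMap R (Algebra.adjoin R s)) ≤
        I.map (algebraMap R (Algebra.adjoin R s)) ⊔ Ideal.span {algebraMap R _ w} := by
      refine (Ideal.map_mono hJ).trans ?_
      rw [Ideal.map_sup, Ideal.map_span, Set.image_singleton]
    intro z hz
    obtain ⟨u, hu, t, ht, rfl⟩ := Submodule.mem_sup.1 (h1 hz)
    obtain ⟨t, rfl⟩ := Ideal.mem_span_singleton'.1 ht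
    rw [smul_add, smul_eq_mul, smul_eq_mul, mul_left_comm]
    exact add_mem (Ideal.mul_mem_left _ _ hu) (Ideal.mul_mem_left _ _ hw)
  have h1 := Ideal.mem_map_of_mem g (hle (Ideal.mem_map_of_mem _ hcolon))
  rw [Ideal.map_map, Ideal.map_map] at h1
  have h2 : g (algebraMap _ T c') = c := Subtype.ext (hg c')
  have h3 : (g.comp (algebraMap (Algebra.adjoin R s) T)).comp
      (algebraMap R (Algebra.adjoin R s)) = algebraMap R (integralClosure R K) := by
    ext r
    exact hg (algebraMap R _ r)
  rwa [h2, h3] at h1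

/-- If the maximal ideal is `I + (y)` and `y ^ j ∉ I` for `j < n`, then
`(I : 𝔪) ⊆ I + (y ^ (n - 1))`. -/
theorem IsLocalRing.colon_maximalIdeal_le {R : Type*} [CommRing R] [IsLocalRing R] {I : Ideal R}
    {y : R} (hm : IsLocalRing.maximalIdeal R = I ⊔ Ideal.span {y}) {n : ℕ}
    (hy : ∀ j < n, y ^ j ∉ I) :
    Submodule.colon I (IsLocalRing.maximalIdeal R) ≤ I ⊔ Ideal.span {y ^ (n - 1)} := by
  intro z hz
  have hym : y ∈ IsLocalRing.maximalIdeal R :=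
    hm ▸ Ideal.mem_sup_right (Ideal.mem_span_singleton_self y)
  have hzy : z * y ∈ I := Submodule.mem_colon.1 hz y hym
  have hstep : ∀ j, j ≤ n - 1 → ∃ u, z - y ^ j * u ∈ I := by
    intro j
    induction j with
    | zero => exact fun _ => ⟨z, by simp⟩
    | succ j ih =>
      intro hj
      obtain ⟨u, hu⟩ := ih (by omega)
      have hyu : y ^ (j + 1) * u ∈ I := by
        have h1 := sub_mem hzy (I.mul_mem_left y hu)
        have h2 : z * y - y * (z - y ^ j * u) = y ^ (j + 1) * u := by ring
        rwa [h2] at h1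
      have hum : u ∈ IsLocalRing.maximalIdeal R := by
        rw [IsLocalRing.mem_maximalIdeal, mem_nonunits_iff]
        intro h
        obtain ⟨w, hw⟩ := h.exists_right_inv
        refine hy (j + 1) (by omega) ?_
        simpa [mul_assoc, hw] using I.mul_mem_right w hyu
      rw [hm] at hum
      obtain ⟨i, hi, t, ht, rfl⟩ := Submodule.mem_sup.1 hum
      obtain ⟨t, rfl⟩ := Ideal.mem_span_singleton'.1 ht
      refine ⟨t, ?_⟩
      have h1 := add_mem hu (I.mul_mem_left (y ^ j) hi)
      have h2 : z - y ^ j * (i + t * y) + y ^ j * i = z - y ^ (j + 1) * t := by ring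
      rwa [h2] at h1
  obtain ⟨u, hu⟩ := hstep (n - 1) le_rfl
  exact Submodule.mem_sup.2 ⟨_, hu, y ^ (n - 1) * u,
    Ideal.mul_mem_right _ _ (Ideal.mem_span_singleton_self _), sub_add_cancel _ _⟩

theorem IsRegularLocalRingP.of_span_range {R : Type} [CommRing R] [IsNoetherianRing R]
    [IsLocalRing R] {ι : Type*} [Fintype ι] {z : ι → R}
    (hz : Ideal.span (Set.range z) = IsLocalRing.maximalIdeal R)
    (hcard : (Fintype.card ι : WithBot ℕ∞) ≤ ringKrullDim R) : IsRegularLocalRingP R := by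
  classical
  have hspan : Ideal.span ((Finset.univ.image z : Finset R) : Set R) =
      IsLocalRing.maximalIdeal R := by
    rw [Finset.coe_image, Finset.coe_univ, Set.image_univ, hz]
  refine ⟨inferInstance, inferInstance, Finset.univ.image z, hspan, le_antisymm ?_ ?_⟩
  · refine le_trans ?_ hcard
    exact_mod_cast Finset.card_image_le
  · refine (ringKrullDim_le_spanFinrank_maximalIdeal R).trans ?_
    have h1 := Submodule.spanFinrank_span_le_ncard_of_finite (R := R)
      (Finset.univ.image z).finite_toSet
    rw [Set.ncard_coe_finset] at h1
    change (Ideal.span _).spanFinrank ≤ _ at h1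
    rw [hspan] at h1
    exact_mod_cast h1

theorem FractionRing.faithfulSMul_algebraicClosure (R : Type*) [CommRing R] [IsDomain R] :
    FaithfulSMul R (AlgebraicClosure (FractionRing R)) := by
  rw [faithfulSMul_iff_algebraMap_injective, IsScalarTower.algebraMap_eq R (FractionRing R)]
  exact (algebraMap (FractionRing R) (AlgebraicClosure (FractionRing R))).injective.comp
    (IsFractionRing.injective R _)

/-- If every element multiplying `y ^ (n - 1)` into `(x)` in the absolute integral closure lies in
the extended maximal ideal `(y, x)`, then the coefficients of `y ^ n` as a combination of the regular
sequence `x` are not all in the maximal ideal. -/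
theorem AbsIntClo.false_of_colon_le {R : Type} [CommRing R] [IsDomain R] [IsNoetherianRing R]
    [IsLocalRing R] {p : ℕ} (hp : p.Prime) [CharP R p] {ι : Type} [Fintype ι] {x a : ι → R} {y : R}
    {n : ℕ}
    (hm : Ideal.span (Set.range fun o : Option ι => o.elim y x) = IsLocalRing.maximalIdeal R)
    (hne : IsLocalRing.maximalIdeal R ≠ ⊥)
    (hx : ∀ N : ℕ, N ≠ 0 → ∀ b : ι → R, ∑ i, b i * x i ^ N = 0 →
      ∀ i, b i ∈ Ideal.span (Set.range fun i => x i ^ N))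
    (hn : 2 ≤ n) (hy : y ^ n = ∑ i, a i * x i) (ha : ∀ i, a i ∈ IsLocalRing.maximalIdeal R)
    (hcolon : ∀ c : AbsIntClo R, c * algebraMap R (AbsIntClo R) (y ^ (n - 1)) ∈
      Ideal.span (Set.range fun i => algebraMap R (AbsIntClo R) (x i)) →
      c ∈ (IsLocalRing.maximalIdeal R).map (algebraMap R (AbsIntClo R))) : False := by
  have : Fact p.Prime := ⟨hp⟩
  have := FractionRing.faithfulSMul_algebraicClosure R
  have hinj := FaithfulSMul.algebraMap_injective R (AlgebraicClosure (FractionRing R))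
  have : FaithfulSMul R (AbsIntClo R) := inferInstance
  have : CharP (AbsIntClo R) p :=
    charP_of_injective_algebraMap (FaithfulSMul.algebraMap_injective R (AbsIntClo R)) p
  have : ExpChar (AbsIntClo R) p := .prime hp
  have : PerfectRing (AbsIntClo R) p := integralClosure.perfectRing hp
  obtain ⟨V, i₀, hRV, hmax, hlt, harch⟩ := IsLocalRing.exists_valuationSubring_archimedean
    (K := AlgebraicClosure (FractionRing R)) (fun o : Option ι => o.elim y x) hm hne
  let v := V.valuation.comap (algebraMap (AbsIntClo R) (AlgebraicClosure (FractionRing R)))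
  have hv : ∀ r, v (algebraMap R (AbsIntClo R) r) =
      V.valuation (algebraMap R (AlgebraicClosure (FractionRing R)) r) := fun r => rfl
  have hv1 : ∀ b, v b ≤ 1 := by
    intro b
    refine (V.valuation_le_one_iff _).2 ?_
    have hb : ((algebraMap V (AlgebraicClosure (FractionRing R))).comp
        ((algebraMap R (AlgebraicClosure (FractionRing R))).codRestrict V hRV)).IsIntegralElem
        (b : AlgebraicClosure (FractionRing R)) := b.2
    obtain ⟨c, hc⟩ := IsIntegrallyClosed.isIntegral_iff.1 hb.of_comp
    have hcb : algebraMap (AbsIntClo R) (AlgebraicClosure (FractionRing R)) b = c := hc.symm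
    exact hcb ▸ c.2
  have hpos : 0 < V.valuation (algebraMap R (AlgebraicClosure (FractionRing R))
      ((fun o : Option ι => o.elim y x) i₀)) := by
    rw [zero_lt_iff]
    intro h0
    refine hne ?_
    rw [← hm, Ideal.span_eq_bot]
    rintro _ ⟨o, rfl⟩
    have h1 := hmax o
    rw [h0, le_zero_iff, map_eq_zero] at h1
    exact hinj (by rw [h1, map_zero])
  refine Ideal.false_of_colon_le_of_valuation (v := v) (x := x) (a := a) (y := y) (n := n) hp hlt
    hpos hv1 hmax harch hx hn hy (fun i => hm ▸ ha i) fun c hc => ?_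
  have h1 := hcolon c (by rwa [map_pow])
  rwa [← hm, Ideal.map_span, ← Set.range_comp] at h1

/-- A Noetherian local ring in which the maximal ideal is generated by an ideal `I` generated by a
regular sequence together with an element `y` no power of which lies in `I` is regular. -/
theorem IsRegularLocalRingP.of_forall_pow_notMem {R : Type} [CommRing R] [IsNoetherianRing R]
    [IsLocalRing R] {rs : List R} (hreg : RingTheory.Sequence.IsRegular R rs) {y : R}
    (hm : Ideal.span (Set.range fun o : Option (Fin rs.length) => o.elim y rs.get) =
      IsLocalRing.maximalIdeal R) (hy : ∀ n, y ^ n ∉ Ideal.ofList rs) :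
    IsRegularLocalRingP R := by
  refine .of_span_range hm ?_
  rw [← ringKrullDim_add_length_eq_ringKrullDim_of_isRegular rs hreg, Fintype.card_option,
    Fintype.card_fin, add_comm, Nat.cast_add, Nat.cast_one]
  have hne : Ideal.ofList rs ≠ ⊤ := fun h => hy 0 (h ▸ Submodule.mem_top)
  have hnt : Nontrivial (R ⧸ Ideal.ofList rs) := Ideal.Quotient.nontrivial_iff.2 hne
  have hloc : IsLocalRing (R ⧸ Ideal.ofList rs) :=
    .of_surjective' _ Ideal.Quotient.mk_surjective
  gcongr
  by_contra! h
  have hdim : Ring.KrullDimLE 0 (R ⧸ Ideal.ofList rs) := by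
    rw [Ring.krullDimLE_iff]
    generalize ringKrullDim (R ⧸ Ideal.ofList rs) = D at h ⊢
    cases D with
    | bot => exact bot_le
    | coe D =>
      norm_cast at h ⊢
      exact (Order.lt_one_iff.1 h).le
  have hym : Ideal.Quotient.mk (Ideal.ofList rs) y ∈
      IsLocalRing.maximalIdeal (R ⧸ Ideal.ofList rs) := by
    have h1 : y ∈ IsLocalRing.maximalIdeal R := hm ▸ Ideal.subset_span ⟨none, rfl⟩
    rw [IsLocalRing.mem_maximalIdeal, mem_nonunits_iff]
    intro hu
    obtain ⟨w, hw⟩ := hu.exists_right_inv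
    obtain ⟨w, rfl⟩ := Ideal.Quotient.mk_surjective w
    rw [← map_mul, ← map_one (Ideal.Quotient.mk (Ideal.ofList rs)), Ideal.Quotient.eq] at hw
    have h2 := IsLocalRing.le_maximalIdeal hne hw
    exact (Ideal.ne_top_iff_one _).1 (IsLocalRing.maximalIdeal.isMaximal R).ne_top
      (by simpa using sub_mem (Ideal.mul_mem_right w _ h1) h2)
  obtain ⟨n, hn⟩ := Ring.KrullDimLE.isNilpotent_iff_mem_maximalIdeal.2 hym
  rw [← map_pow, Ideal.Quotient.eq_zero_iff_mem] at hn
  exact hy n hn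

theorem RingTheory.Sequence.IsRegular.length_le_ringKrullDim {R : Type*} [CommRing R]
    [IsNoetherianRing R] [IsLocalRing R] {rs : List R} (hreg : RingTheory.Sequence.IsRegular R rs)
    (hne : Ideal.ofList rs ≠ ⊤) : (rs.length : WithBot ℕ∞) ≤ ringKrullDim R := by
  have hnt : Nontrivial (R ⧸ Ideal.ofList rs) := Ideal.Quotient.nontrivial_iff.2 hne
  rw [← ringKrullDim_add_length_eq_ringKrullDim_of_isRegular rs hreg]
  exact le_add_of_nonneg_left ringKrullDim_nonneg_of_nontrivial

/-- Let `(R, 𝔪)` be a `d`-dimensional excellent local Cohen-Macaulay domain of prime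
characteristic `p` admitting an ideal `I` generated by a regular sequence with `𝔪/I`
cyclic, and suppose `R` has an isolated singularity or `d ≤ 2`. If every finite
extension domain `R ⊆ S` admits a finite extension `S ⊆ T` such that
`(IS :_S (I :_R 𝔪)S) ⊆ 𝔪T`, then `R` is regular. -/
theorem regular_of_colon_capture
    (R : Type) [CommRing R] [IsDomain R] [IsNoetherianRing R] [IsLocalRing R]
    (hExc : IsExcellentRing R) (hCM : IsCohenMacaulayLocalRing R)
    (p : ℕ) (hp : p.Prime) [CharP R p]
    (d : ℕ) (hd : (d : WithBot ℕ∞) = ringKrullDim R)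
    (rs : List R) (hreg : RingTheory.Sequence.IsRegular R rs)
    (I : Ideal R) (hI : I = Ideal.ofList rs)
    (hcyc : ∃ y : R, IsLocalRing.maximalIdeal R = I ⊔ Ideal.span {y})
    (hsing : (∀ (q : Ideal R) (hq : q.IsPrime), q ≠ IsLocalRing.maximalIdeal R →
        haveI := hq
        IsRegularLocalRingP (Localization.AtPrime q)) ∨ d ≤ 2)
    (hext : ∀ (S : Type) (_ : CommRing S) (_ : IsDomain S) (_ : Algebra R S),
      Function.Injective (algebraMap R S) → Module.Finite R S →
        ∃ (T : Type) (_ : CommRing T) (_ : Algebra S T),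
          Function.Injective (algebraMap S T) ∧ Module.Finite S T ∧
            Ideal.map (algebraMap S T)
                (Submodule.colon (Ideal.map (algebraMap R S) I)
                  (Ideal.map (algebraMap R S)
                    (Submodule.colon I (IsLocalRing.maximalIdeal R)))) ≤
              Ideal.map (algebraMap S T)
                (Ideal.map (algebraMap R S) (IsLocalRing.maximalIdeal R))) :
    IsRegularLocalRingP R := by
  classical
  subst hI
  obtain ⟨y, hy⟩ := hcyc
  have hne : Ideal.ofList rs ≠ ⊤ := by
    simpa [eq_comm] using hreg.2
  have hrsm : ∀ r ∈ rs, r ∈ IsLocalRing.maximalIdeal R := fun r hr =>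
    IsLocalRing.le_maximalIdeal hne (Ideal.subset_span hr)
  have hspan : Ideal.ofList rs = Ideal.span (Set.range rs.get) := by
    rw [Set.range_list_get, Ideal.ofList]
  have hm : Ideal.span (Set.range fun o : Option (Fin rs.length) => o.elim y rs.get) =
      IsLocalRing.maximalIdeal R := by
    rw [hy, hspan, Option.range_eq, Ideal.span_insert, sup_comm]
    rfl
  by_cases hpow : ∃ n, y ^ n ∈ Ideal.ofList rs
  swap
  · exact .of_forall_pow_notMem hreg hm (not_exists.1 hpow)
  have hlen := hreg.length_le_ringKrullDim hne
  obtain ⟨n, hn, hmin⟩ : ∃ n, y ^ n ∈ Ideal.ofList rs ∧ ∀ j < n, y ^ j ∉ Ideal.ofList rs :=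
    ⟨Nat.find hpow, Nat.find_spec hpow, fun j hj => Nat.find_min hpow hj⟩
  have hn0 : n ≠ 0 := by
    rintro rfl
    exact hne ((Ideal.eq_top_iff_one _).2 (by simpa using hn))
  by_cases hn1 : n = 1
  · subst hn1
    refine .of_span_range (z := rs.get) ?_ (by simpa using hlen)
    rw [hy, ← hspan, sup_eq_left.2]
    rw [Ideal.span_singleton_le_iff_mem]
    simpa using hn
  obtain ⟨a, ha⟩ := Ideal.mem_span_range_iff_exists_fun.1 (hspan ▸ hn)
  by_cases hunit : ∃ i, IsUnit (a i)
  · obtain ⟨i, hi⟩ := hunit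
    refine .of_span_range (z := Function.update rs.get i y) ?_ (by simpa using hlen)
    have hle : ∀ j, j ≠ i → rs.get j ∈ Ideal.span (Set.range (Function.update rs.get i y)) :=
      fun j hj => Ideal.subset_span ⟨j, by simp [hj]⟩
    have hyS : y ∈ Ideal.span (Set.range (Function.update rs.get i y)) :=
      Ideal.subset_span ⟨i, by simp⟩
    have hiS : rs.get i ∈ Ideal.span (Set.range (Function.update rs.get i y)) := by
      rw [← Ideal.unit_mul_mem_iff_mem _ hi]
      rw [← Finset.add_sum_erase _ _ (Finset.mem_univ i), ← eq_sub_iff_add_eq] at ha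
      rw [ha]
      exact sub_mem (Ideal.pow_mem_of_mem _ hyS n (Nat.pos_of_ne_zero hn0))
        (sum_mem fun j hj => Ideal.mul_mem_left _ _ (hle j (Finset.mem_erase.1 hj).1))
    refine le_antisymm (Ideal.span_le.2 ?_) ?_
    · rintro _ ⟨j, rfl⟩
      by_cases hj : j = i
      · subst hj
        rw [Function.update_self, ← hm]
        exact Ideal.subset_span ⟨none, rfl⟩
      · rw [Function.update_of_ne hj]
        exact hrsm _ (List.get_mem _ _)
    · rw [← hm, Ideal.span_le]
      rintro _ ⟨_ | j, rfl⟩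
      · exact hyS
      · by_cases hj : j = i
        · exact hj ▸ hiS
        · exact hle j hj
  · have hym : y ∈ IsLocalRing.maximalIdeal R := hm ▸ Ideal.subset_span ⟨none, rfl⟩
    have hbot : IsLocalRing.maximalIdeal R ≠ ⊥ := by
      intro h
      rw [h, Ideal.mem_bot] at hym
      refine hmin 1 (by omega) ?_
      rw [hym, pow_one]
      exact zero_mem _
    have := FractionRing.faithfulSMul_algebraicClosure R
    exact (AbsIntClo.false_of_colon_le hp hm hbot
      (fun N hN b hb => IsLocalRing.mem_span_of_sum_mul_pow_eq_zero hreg.1 hrsm hN b hb)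
      (by omega) ha.symm
      (fun i => (IsLocalRing.mem_maximalIdeal _).2 fun h => hunit ⟨i, h⟩)
      fun c hc => integralClosure.mem_map_of_mul_mem_map
        (IsLocalRing.colon_maximalIdeal_le hy hmin) hext
        (fun i => Ideal.subset_span (List.get_mem _ _)) c hc).elim
end

section
/- Let (R, 𝔪) be an excellent Noetherian local domain of prime characteristic p > 0. Then R is a regular local ring if and only if the inclusion R → R^+ is flat (i.e. R^+ is a flat R-module). -/
set_option synthInstance.maxHeartbeats 1000000
set_option maxHeartbeats 1000000
set_option linter.unusedVariables false

open CategoryTheory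

/-- The ideal generated by the powers `x b ^ e b`, for `b ∈ B`. -/
def powIdeal {A ι : Type*} [CommRing A] (x : ι → A) (B : Finset ι) (e : ι → ℕ) : Ideal A :=
  Ideal.span ((fun b => x b ^ e b) '' (B : Set ι))

/-- A family of elements that is, modulo `I`, a regular sequence on `U` in every order and for
all exponents. -/
def IsRegularFamily {A ι : Type*} [CommRing A] (x : ι → A) (U : Type*) [AddCommGroup U]
    [Module A U] (I : Ideal A) (S : Finset ι) : Prop :=
  ∀ B ⊆ S, ∀ j ∈ S, j ∉ B → ∀ (e : ι → ℕ) (u : U),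
    x j • u ∈ (I ⊔ powIdeal x B e) • (⊤ : Submodule A U) →
      u ∈ (I ⊔ powIdeal x B e) • (⊤ : Submodule A U)

section RegularFamily

variable {A ι : Type*} [CommRing A] {x : ι → A} {U : Type*} [AddCommGroup U] [Module A U]

theorem powIdeal_insert [DecidableEq ι] (x : ι → A) (B : Finset ι) (e : ι → ℕ) (j : ι) :
    powIdeal x (insert j B) e = Ideal.span {x j ^ e j} ⊔ powIdeal x B e := by
  simp [powIdeal, Set.image_insert_eq, Ideal.span_insert]

theorem powIdeal_congr (x : ι → A) {B : Finset ι} {e e' : ι → ℕ} (h : ∀ b ∈ B, e b = e' b) :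
    powIdeal x B e = powIdeal x B e' := by
  unfold powIdeal
  congr 1
  exact Set.image_congr fun b hb => by rw [h b hb]

theorem pow_mem_powIdeal (x : ι → A) {B : Finset ι} (e : ι → ℕ) {b : ι} (hb : b ∈ B) :
    x b ^ e b ∈ powIdeal x B e :=
  Ideal.subset_span ⟨b, hb, rfl⟩

theorem mem_span_singleton_sup_smul_top_iff {f : A} {I : Ideal A} {u : U} :
    u ∈ (Ideal.span {f} ⊔ I) • (⊤ : Submodule A U) ↔
      ∃ v : U, u - f • v ∈ I • (⊤ : Submodule A U) := by
  rw [Submodule.sup_smul, Submodule.mem_sup]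
  constructor
  · rintro ⟨y, hy, w, hw, rfl⟩
    obtain ⟨v, -, rfl⟩ := (Submodule.ideal_span_singleton_smul f (⊤ : Submodule A U)) ▸ hy
    exact ⟨v, by simpa using! hw⟩
  · rintro ⟨v, hv⟩
    exact ⟨f • v, Submodule.smul_mem_smul (Ideal.mem_span_singleton_self f) trivial, _, hv,
      by simp⟩

theorem ideal_smul_top_self (I : Ideal A) : I • (⊤ : Submodule A A) = I := by
  simp

theorem IsRegularFamily.pow_smul {I : Ideal A} {S : Finset ι} (h : IsRegularFamily x U I S)
    {B : Finset ι} (hB : B ⊆ S) {j : ι} (hj : j ∈ S) (hjB : j ∉ B) (e : ι → ℕ) (n : ℕ) {u : U}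
    (hu : x j ^ n • u ∈ (I ⊔ powIdeal x B e) • (⊤ : Submodule A U)) :
    u ∈ (I ⊔ powIdeal x B e) • (⊤ : Submodule A U) := by
  induction n with
  | zero => simpa using hu
  | succ n ih => exact ih (h B hB j hj hjB e _ (by rwa [smul_smul, ← pow_succ']))

theorem IsRegularFamily.mono {I : Ideal A} {S S' : Finset ι} (h : IsRegularFamily x U I S)
    (hS : S' ⊆ S) : IsRegularFamily x U I S' :=
  fun B hB j hj => h B (hB.trans hS) j (hS hj)

theorem IsRegularFamily.sup_span [DecidableEq ι] {I : Ideal A} {S : Finset ι} {j : ι}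
    (h : IsRegularFamily x U I (insert j S)) (hj : j ∉ S) (N : ℕ) :
    IsRegularFamily x U (I ⊔ Ideal.span {x j ^ N}) S := by
  intro B hB i hi hiB e u hu
  have key : I ⊔ Ideal.span {x j ^ N} ⊔ powIdeal x B e =
      I ⊔ powIdeal x (insert j B) (Function.update e j N) := by
    rw [powIdeal_insert, Function.update_self, sup_assoc]
    congr 2
    exact powIdeal_congr x fun b hb => by
      rw [Function.update_of_ne]
      rintro rfl
      exact hj (hB hb)
  rw [key] at hu ⊢
  refine h _ (Finset.insert_subset_insert j hB) i (Finset.mem_insert_of_mem hi) ?_ _ u hu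
  rw [Finset.mem_insert, not_or]
  exact ⟨fun hij => hj (hij ▸ hi), hiB⟩

/-- A permutable regular sequence stays one after raising its members to powers. -/
theorem isRegularFamily_bot_of_forall [DecidableEq ι] {S : Finset ι}
    (h : ∀ B ⊆ S, ∀ j ∈ S, j ∉ B → ∀ u : U,
      x j • u ∈ powIdeal x B (fun _ => 1) • (⊤ : Submodule A U) →
        u ∈ powIdeal x B (fun _ => 1) • (⊤ : Submodule A U)) :
    IsRegularFamily x U ⊥ S := by
  intro B hB j hj hjB e
  simp only [bot_sup_eq]
  induction hn : ∑ b ∈ B, e b using Nat.strong_induction_on generalizing B j e with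
  | _ n ih =>
  intro u hu
  by_cases h0 : ∃ b ∈ B, e b = 0
  · obtain ⟨b, hb, hb0⟩ := h0
    have : powIdeal x B e = ⊤ :=
      (Ideal.eq_top_iff_one _).2 (by simpa [hb0] using pow_mem_powIdeal x e hb)
    simp [this]
  by_cases h1 : ∀ b ∈ B, e b = 1
  · rw [powIdeal_congr x h1] at hu ⊢
    exact h B hB j hj hjB u hu
  push Not at h0 h1
  obtain ⟨b, hb, hb1⟩ := h1
  have hb0 := h0 b hb
  obtain ⟨C, hbC, rfl⟩ : ∃ C, b ∉ C ∧ insert b C = B :=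
    ⟨B.erase b, Finset.notMem_erase b B, Finset.insert_erase hb⟩
  have hCS : C ⊆ S := (Finset.subset_insert b C).trans hB
  have hjC : j ∉ C := fun hc => hjB (Finset.mem_insert_of_mem hc)
  rw [Finset.sum_insert hbC] at hn
  have upd : ∀ m, powIdeal x (insert b C) (Function.update e b m) =
      Ideal.span {x b ^ m} ⊔ powIdeal x C e := by
    intro m
    rw [powIdeal_insert, Function.update_self]
    congr 1
    exact powIdeal_congr x fun c hc => by
      rw [Function.update_of_ne]
      rintro rfl
      exact hbC hc
  have usum : ∀ m, ∑ c ∈ insert b C, Function.update e b m c = m + ∑ c ∈ C, e c := by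
    intro m
    rw [Finset.sum_insert hbC, Function.update_self]
    congr 1
    exact Finset.sum_congr rfl fun c hc => by
      rw [Function.update_of_ne]
      rintro rfl
      exact hbC hc
  have step := fun m (hm : m < e b) => ih (m + ∑ c ∈ C, e c) (by omega) (insert b C) hB j hj hjB
    (Function.update e b m) (usum m)
  simp only [upd] at step
  rw [powIdeal_insert] at hu ⊢
  have hle : Ideal.span {x b ^ e b} ⊔ powIdeal x C e ≤
      Ideal.span {x b ^ 1} ⊔ powIdeal x C e := by
    refine sup_le_sup_right ?_ _
    rw [Ideal.span_singleton_le_span_singleton]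
    exact pow_dvd_pow _ (by omega)
  obtain ⟨v, hv⟩ := mem_span_singleton_sup_smul_top_iff.1
    (step 1 (by omega) u (Submodule.smul_mono_left hle hu))
  obtain ⟨w, hw⟩ := mem_span_singleton_sup_smul_top_iff.1 hu
  have hjv : x j • v - x b ^ (e b - 1) • w ∈ powIdeal x C e • (⊤ : Submodule A U) := by
    refine ih (∑ c ∈ C, e c) (by omega) C hCS b (hB (Finset.mem_insert_self b C)) hbC e rfl _ ?_
    have : x b • (x j • v - x b ^ (e b - 1) • w) =
        (x j • u - x b ^ e b • w) - x j • (u - x b ^ 1 • v) := by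
      have he : x b ^ e b = x b * x b ^ (e b - 1) := by rw [← pow_succ']; congr 1; omega
      rw [he]
      module
    rw [this]
    exact sub_mem hw (Submodule.smul_mem _ _ hv)
  obtain ⟨v', hv'⟩ := mem_span_singleton_sup_smul_top_iff.1
    (step (e b - 1) (by omega) v (mem_span_singleton_sup_smul_top_iff.2 ⟨w, hjv⟩))
  refine mem_span_singleton_sup_smul_top_iff.2 ⟨v', ?_⟩
  have : u - x b ^ e b • v' = (u - x b ^ 1 • v) + x b • (v - x b ^ (e b - 1) • v') := by
    have he : x b ^ e b = x b * x b ^ (e b - 1) := by rw [← pow_succ']; congr 1; omega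
    rw [he]
    module
  rw [this]
  exact add_mem hv (Submodule.smul_mem _ _ hv')

end RegularFamily

/-- The span, inside the `κ`-indexed families of elements of `U`, of the products of an
element of `Z` with an element of `U`. -/
def relSpan {A κ : Type*} [CommRing A] (Z : Submodule A (κ → A)) (U : Type*) [AddCommGroup U]
    [Module A U] : Submodule A (κ → U) :=
  Submodule.span A {w | ∃ z ∈ Z, ∃ v : U, w = fun i => z i • v}

/-- The vectors `z` with `∑ i, a i * z i ∈ I`. -/
def relKer {A κ : Type*} [CommRing A] [Fintype κ] (a : κ → A) (I : Ideal A) :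
    Submodule A (κ → A) where
  carrier := {z | ∑ i, a i * z i ∈ I}
  add_mem' {z w} hz hw := by
    simpa [mul_add, Finset.sum_add_distrib] using add_mem hz hw
  zero_mem' := by simp
  smul_mem' c z hz := by
    have : ∑ i, a i * (c • z) i = c * ∑ i, a i * z i := by
      simp only [Finset.mul_sum, Pi.smul_apply, smul_eq_mul]
      exact Finset.sum_congr rfl fun i _ => by ring
    simp only [Set.mem_ofPred_eq, this]
    exact I.mul_mem_left c hz

/-- The vectors satisfying, modulo `I`, every linear relation that `t` satisfies modulo `I`. -/
def relHull {A κ U : Type*} [CommRing A] [Fintype κ] [AddCommGroup U] [Module A U]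
    (t : κ → U) (I : Ideal A) : Submodule A (κ → A) :=
  ⨅ (c : κ → A) (_ : ∑ i, c i • t i ∈ I • (⊤ : Submodule A U)), relKer c I

/-- The equational criterion of flatness of `U / I U` over `A / I`, up to powers of `y`. -/
def FlatUpTo {A : Type*} [CommRing A] (U : Type*) [AddCommGroup U] [Module A U] (y : A)
    (I : Ideal A) : Prop :=
  ∀ (κ : Type) [Fintype κ] (a : κ → A) (t : κ → U),
    ∑ i, a i • t i ∈ I • (⊤ : Submodule A U) → ∃ N : ℕ, y ^ N • t ∈ relSpan (relKer a I) U

section Relations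

variable {A U : Type*} [CommRing A] [AddCommGroup U] [Module A U]

theorem mem_relKer {κ : Type*} [Fintype κ] {a z : κ → A} {I : Ideal A} :
    z ∈ relKer a I ↔ ∑ i, a i * z i ∈ I :=
  Iff.rfl

theorem mem_relHull {κ : Type*} [Fintype κ] {t : κ → U} {z : κ → A} {I : Ideal A} :
    z ∈ relHull t I ↔
      ∀ c : κ → A, ∑ i, c i • t i ∈ I • (⊤ : Submodule A U) → ∑ i, c i * z i ∈ I := by
  simp [relHull, Submodule.mem_iInf, mem_relKer]

theorem smul_mem_relSpan {κ : Type*} {Z : Submodule A (κ → A)} {z : κ → A} (hz : z ∈ Z) (v : U) :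
    (fun i => z i • v) ∈ relSpan Z U :=
  Submodule.subset_span ⟨z, hz, v, rfl⟩

theorem mem_relSpan_iff {κ : Type*} {Z : Submodule A (κ → A)} {t : κ → U} :
    t ∈ relSpan Z U ↔ ∃ (m : ℕ) (z : Fin m → κ → A) (v : Fin m → U),
      (∀ j, z j ∈ Z) ∧ t = fun i => ∑ j, z j i • v j := by
  constructor
  · intro ht
    refine Submodule.span_induction ?_ ?_ ?_ ?_ ht
    · rintro _ ⟨z, hz, v, rfl⟩
      exact ⟨1, fun _ => z, fun _ => v, fun _ => hz, by simp⟩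
    · exact ⟨0, Fin.elim0, Fin.elim0, fun j => j.elim0, by ext; simp⟩
    · rintro _ _ - - ⟨m, z, v, hz, rfl⟩ ⟨m', z', v', hz', rfl⟩
      refine ⟨m + m', Fin.append z z', Fin.append v v', fun j => ?_, ?_⟩
      · refine Fin.addCases (fun j => ?_) (fun j => ?_) j
        · simpa using hz j
        · simpa using hz' j
      · ext i
        simp [Fin.sum_univ_add]
    · rintro c _ - ⟨m, z, v, hz, rfl⟩
      refine ⟨m, z, fun j => c • v j, hz, ?_⟩
      ext i
      simp only [Pi.smul_apply, Finset.smul_sum]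
      exact Finset.sum_congr rfl fun j _ => smul_comm _ _ _
  · rintro ⟨m, z, v, hz, rfl⟩
    have : (fun i => ∑ j, z j i • v j) = ∑ j, fun i => z j i • v j := by
      ext i; simp
    rw [this]
    exact sum_mem fun j _ => smul_mem_relSpan (hz j) (v j)

theorem sum_smul_mem_relSpan {κ σ : Type*} [Fintype σ] {Z : Submodule A (κ → A)}
    (z : σ → κ → A) (hz : ∀ j, z j ∈ Z) (v : σ → U) :
    (fun i => ∑ j, z j i • v j) ∈ relSpan Z U := by
  have : (fun i => ∑ j, z j i • v j) = ∑ j, fun i => z j i • v j := by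
    ext i; simp
  rw [this]
  exact sum_mem fun j _ => smul_mem_relSpan (hz j) (v j)

theorem relSpan_mono {κ : Type*} {Z Z' : Submodule A (κ → A)} (h : Z ≤ Z') :
    relSpan Z U ≤ relSpan Z' U :=
  Submodule.span_mono fun _ ⟨z, hz, v, hv⟩ => ⟨z, h hz, v, hv⟩

theorem relSpan_top {κ : Type*} [Fintype κ] [DecidableEq κ] (t : κ → U) :
    t ∈ relSpan (⊤ : Submodule A (κ → A)) U := by
  have : t = fun i => ∑ j, (Pi.single j (1 : A) : κ → A) i • t j := by
    ext i
    simp [Pi.single_apply]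
  rw [this]
  exact sum_smul_mem_relSpan (fun j => Pi.single j (1 : A)) (fun _ => Submodule.mem_top) t

theorem FlatUpTo.span_sup {y : A} {I : Ideal A} (h : FlatUpTo U y I) (f : A) :
    FlatUpTo U y (Ideal.span {f} ⊔ I) := by
  intro κ _ a t hat
  obtain ⟨v, hv⟩ := mem_span_singleton_sup_smul_top_iff.1 hat
  obtain ⟨N, hN⟩ := h (Option κ) (fun o => o.elim (-f) a) (fun o => o.elim v t) (by
    simpa [Fintype.sum_option, sub_eq_neg_add] using hv)
  obtain ⟨m, z, w, hz, hzw⟩ := mem_relSpan_iff.1 hN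
  refine ⟨N, mem_relSpan_iff.2 ⟨m, fun j i => z j (some i), w, fun j => ?_, ?_⟩⟩
  · have := hz j
    rw [mem_relKer, Fintype.sum_option] at this
    simp only [Option.elim_none, Option.elim_some] at this
    rw [mem_relKer]
    have hf : f * z j none ∈ Ideal.span {f} ⊔ I :=
      Ideal.mem_sup_left (Ideal.mul_mem_right _ _ (Ideal.mem_span_singleton_self f))
    simpa using add_mem hf (Ideal.mem_sup_right this)
  · ext i
    simpa using congrFun hzw (some i)

theorem FlatUpTo.sup_of_fg {y : A} {I : Ideal A} (h : FlatUpTo U y I) {J : Ideal A}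
    (hJ : J.FG) : FlatUpTo U y (J ⊔ I) := by
  classical
  obtain ⟨s, rfl⟩ := hJ
  induction s using Finset.induction_on with
  | empty => simpa using h
  | insert f s _ ih =>
    have := ih.span_sup f
    rwa [← sup_assoc, ← Submodule.span_union, ← Set.insert_eq, ← Finset.coe_insert] at this

theorem FlatUpTo.of_bot [IsNoetherianRing A] {y : A} (h : FlatUpTo U y ⊥) (I : Ideal A) :
    FlatUpTo U y I := by
  simpa using h.sup_of_fg (J := I) (IsNoetherian.noetherian I)

theorem FlatUpTo.exists_of_forall_fin {y : A} {I : Ideal A} (h : FlatUpTo U y I) {κ : Type}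
    [Fintype κ] (t : κ → U) (m : ℕ) (c : Fin m → κ → A)
    (hc : ∀ r, ∑ i, c r i • t i ∈ I • (⊤ : Submodule A U)) :
    ∃ N : ℕ, y ^ N • t ∈ relSpan (⨅ r, relKer (c r) I) U := by
  classical
  induction m with
  | zero => exact ⟨0, by
      rw [iInf_of_empty, pow_zero, one_smul]
      exact relSpan_top t⟩
  | succ m ih =>
    obtain ⟨N, hN⟩ := ih (fun r => c r.castSucc) fun r => hc r.castSucc
    obtain ⟨l, z, v, hz, hzv⟩ := mem_relSpan_iff.1 hN
    have hv : ∑ j, (∑ i, c (Fin.last m) i * z j i) • v j = y ^ N • ∑ i, c (Fin.last m) i • t i := by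
      simp only [Finset.sum_smul, Finset.smul_sum]
      rw [Finset.sum_comm]
      refine Finset.sum_congr rfl fun i _ => ?_
      rw [smul_comm, show y ^ N • t i = _ from congrFun hzv i, Finset.smul_sum]
      simp only [mul_smul]
    obtain ⟨M, hM⟩ := h (Fin l) _ v (by rw [hv]; exact Submodule.smul_mem _ _ (hc (Fin.last m)))
    obtain ⟨l', w, u, hw, hwu⟩ := mem_relSpan_iff.1 hM
    refine ⟨M + N, mem_relSpan_iff.2 ⟨l', fun k => ∑ j, w k j • z j, u, fun k => ?_, ?_⟩⟩
    · rw [Submodule.mem_iInf]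
      intro r
      refine Fin.lastCases ?_ (fun r => ?_) r
      · have := hw k
        rw [mem_relKer] at this ⊢
        convert this using 1
        simp only [Finset.sum_apply, Pi.smul_apply, smul_eq_mul, Finset.mul_sum, Finset.sum_mul]
        rw [Finset.sum_comm]
        exact Finset.sum_congr rfl fun j _ => Finset.sum_congr rfl fun i _ => by ring
      · refine sum_mem fun j _ => Submodule.smul_mem _ _ ?_
        have := hz j
        rw [Submodule.mem_iInf] at this
        exact this r
    · ext i
      rw [pow_add, mul_smul, hzv]
      simp only [Pi.smul_apply, Finset.sum_apply, smul_eq_mul, Finset.smul_sum, Finset.sum_smul]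
      rw [Finset.sum_comm]
      refine Finset.sum_congr rfl fun j _ => ?_
      rw [smul_comm, show y ^ M • v j = _ from congrFun hwu j, Finset.smul_sum]
      exact Finset.sum_congr rfl fun k _ => by rw [smul_smul, mul_comm]

theorem FlatUpTo.exists_mem_relHull [IsNoetherianRing A] {y : A} {I : Ideal A}
    (h : FlatUpTo U y I) {κ : Type} [Fintype κ] (t : κ → U) :
    ∃ N : ℕ, y ^ N • t ∈ relSpan (relHull t I) U := by
  classical
  let φ : (κ → A) →ₗ[A] U := Fintype.linearCombination A t
  obtain ⟨m, c, hc⟩ := Submodule.fg_iff_exists_fin_generating_family.1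
    (IsNoetherian.noetherian ((I • (⊤ : Submodule A U)).comap φ))
  have hc' : ∀ d : κ → A, d ∈ Submodule.span A (Set.range c) ↔
      ∑ i, d i • t i ∈ I • (⊤ : Submodule A U) := by
    intro d
    rw [hc, Submodule.mem_comap, Fintype.linearCombination_apply]
  obtain ⟨N, hN⟩ := h.exists_of_forall_fin t m c fun r =>
    (hc' _).1 (Submodule.subset_span ⟨r, rfl⟩)
  refine ⟨N, relSpan_mono ?_ hN⟩
  intro z hz
  rw [mem_relHull]
  intro d hd
  refine Submodule.span_induction ?_ ?_ ?_ ?_ ((hc' d).2 hd)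
  · rintro _ ⟨r, rfl⟩
    rw [Submodule.mem_iInf] at hz
    exact hz r
  · simp
  · intro a b _ _ ha hb
    simpa [add_mul, Finset.sum_add_distrib] using add_mem ha hb
  · intro a b _ hb
    simpa [mul_assoc, Finset.mul_sum] using I.mul_mem_left a hb

end Relations

section Finiteness

variable {A ι U : Type*} [CommRing A] [AddCommGroup U] [Module A U]

theorem sum_smul_mem_smul_top {κ : Type*} [Fintype κ] {I : Ideal A} {a : κ → A}
    (ha : ∀ i, a i ∈ I) (u : κ → U) : ∑ i, a i • u i ∈ I • (⊤ : Submodule A U) :=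
  sum_mem fun i _ => Submodule.smul_mem_smul (ha i) Submodule.mem_top

/-- The elements of a finitely generated submodule that are annihilated modulo Frobenius-like
powers `(x b ^ q)` by a power of a further parameter `x j` are, uniformly in `q`, divisible by
`∏ x b ^ (q - N)` modulo `(x b ^ q)`, with quotients in a fixed finitely generated submodule. -/
theorem exists_fg_submodule_of_pow_smul_sub_mem [IsNoetherianRing A] [DecidableEq ι] (x : ι → A)
    (j : ι) (B : Finset ι) (hj : j ∉ B) (hflat : ∀ b ∈ B, FlatUpTo U (x b) ⊥) (I : Ideal A)
    (hA : IsRegularFamily x A I (insert j B)) (hU : IsRegularFamily x U I B)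
    {κ : Type} [Fintype κ] (τ : κ → U) :
    ∃ (N : ℕ) (G : Submodule A U), G.FG ∧ ∀ q ≥ N, ∀ (k : ℕ) (c s : κ → A),
      (∀ i, s i ∈ powIdeal x B fun _ => q) →
      x j ^ k • ∑ i, c i • τ i - ∑ i, s i • τ i ∈ I • (⊤ : Submodule A U) →
      ∃ g ∈ G, ∑ i, c i • τ i - (∏ b ∈ B, x b) ^ (q - N) • g ∈
        (I ⊔ powIdeal x B fun _ => q) • (⊤ : Submodule A U) := by
  classical
  induction B using Finset.induction_on generalizing I κ τ with
  | empty =>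
    refine ⟨0, Submodule.span A (Set.range τ), Submodule.fg_span (Set.finite_range τ), ?_⟩
    intro q _ k c s _ _
    refine ⟨∑ i, c i • τ i, sum_mem fun i _ => Submodule.smul_mem _ _
      (Submodule.subset_span ⟨i, rfl⟩), by simp⟩
  | insert b B hb ih =>
    rw [Finset.mem_insert, not_or] at hj
    obtain ⟨hjb, hjB⟩ := hj
    have hbj : b ∉ insert j B := by
      rw [Finset.mem_insert, not_or]
      exact ⟨fun h => hjb h.symm, hb⟩
    obtain ⟨N, hN⟩ := ((hflat b (Finset.mem_insert_self b B)).of_bot I).exists_mem_relHull τ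
    obtain ⟨m, β, v, hβ, hv⟩ := mem_relSpan_iff.1 hN
    have hβv : ∀ c : κ → A, x b ^ N • ∑ i, c i • τ i = ∑ l, (∑ i, c i * β l i) • v l := by
      intro c
      simp only [Finset.sum_smul, Finset.smul_sum]
      rw [Finset.sum_comm]
      refine Finset.sum_congr rfl fun i _ => ?_
      rw [smul_comm, show x b ^ N • τ i = _ from congrFun hv i, Finset.smul_sum]
      simp only [mul_smul]
    obtain ⟨N', G', hG', ih⟩ := ih hjB (fun k hk => hflat k (Finset.mem_insert_of_mem hk))
      (I ⊔ Ideal.span {x b ^ N})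
      (IsRegularFamily.sup_span (by rwa [Finset.insert_comm]) hbj N) (hU.sup_span hb N) v
    refine ⟨max N N', G'.map (LinearMap.lsmul A U
      (x b ^ (max N N' - N) * (∏ k ∈ B, x k) ^ (max N N' - N'))), hG'.map _, ?_⟩
    intro q hq k c s hs hcs
    have hqN : N ≤ q := (le_max_left _ _).trans hq
    have hqN' : N' ≤ q := (le_max_right _ _).trans hq
    set J : Ideal A := powIdeal x B fun _ => q with hJ
    have hIns : powIdeal x (insert b B) (fun _ => q) = Ideal.span {x b ^ q} ⊔ J :=
      powIdeal_insert x B _ b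
    have hrel : ∀ l, x j ^ k * (∑ i, c i * β l i) - ∑ i, s i * β l i ∈ I := by
      intro l
      have h1 := mem_relHull.1 (hβ l) (fun i => x j ^ k * c i - s i) (by
        convert hcs using 1
        simp only [sub_smul, Finset.sum_sub_distrib, mul_smul, Finset.smul_sum])
      convert h1 using 1
      simp only [sub_mul, Finset.sum_sub_distrib, mul_assoc, Finset.mul_sum]
    have hβc : ∀ l, ∑ i, c i * β l i ∈ I ⊔ powIdeal x (insert b B) fun _ => q := by
      intro l
      have h1 : x j ^ k * (∑ i, c i * β l i) ∈ I ⊔ powIdeal x (insert b B) fun _ => q := by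
        have h2 := add_mem (Ideal.mem_sup_left (hrel l))
          (Ideal.mem_sup_right (sum_mem fun i (_ : i ∈ Finset.univ) =>
            Ideal.mul_mem_right (β l i) _ (hs i)))
        simpa using h2
      have := hA.pow_smul (Finset.subset_insert j _) (Finset.mem_insert_self j _)
        (by simp [hjb, hjB]) (fun _ => q) k (u := ∑ i, c i * β l i) (by simpa using h1)
      simpa using this
    have hr : ∀ l, ∃ r : A, ∑ i, c i * β l i - x b ^ q * r ∈ I ⊔ J := by
      intro l
      have := hβc l
      rw [hIns, sup_left_comm, ← ideal_smul_top_self (Ideal.span {x b ^ q} ⊔ (I ⊔ J)),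
        mem_span_singleton_sup_smul_top_iff] at this
      simpa using this
    choose r hr using hr
    have hs1 : ∀ i, ∃ s1 : A, s i - x b ^ q * s1 ∈ J := by
      intro i
      have := hs i
      rw [hIns, ← ideal_smul_top_self (Ideal.span {x b ^ q} ⊔ J),
        mem_span_singleton_sup_smul_top_iff] at this
      simpa using this
    choose s1 hs1 using hs1
    have hw : ∀ l, ∃ w ∈ J, x j ^ k * r l - ∑ i, s1 i * β l i - w ∈ I := by
      intro l
      have h1 : x b ^ q * (x j ^ k * r l - ∑ i, s1 i * β l i) ∈ I ⊔ J := by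
        have h2 : x b ^ q * (x j ^ k * r l - ∑ i, s1 i * β l i) =
            (x j ^ k * (∑ i, c i * β l i) - ∑ i, s i * β l i)
            - x j ^ k * (∑ i, c i * β l i - x b ^ q * r l)
            + ∑ i, (s i - x b ^ q * s1 i) * β l i := by
          simp only [sub_mul, Finset.sum_sub_distrib, mul_assoc, ← Finset.mul_sum]
          ring
        rw [h2]
        exact add_mem (sub_mem (Ideal.mem_sup_left (hrel l)) (Ideal.mul_mem_left _ _ (hr l)))
          (Ideal.mem_sup_right (sum_mem fun i _ => Ideal.mul_mem_right _ _ (hs1 i)))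
      have h3 := hA.pow_smul (B := B) ((Finset.subset_insert b B).trans (Finset.subset_insert j _))
        (Finset.mem_insert_of_mem (Finset.mem_insert_self b B)) hb (fun _ => q) q
        (u := x j ^ k * r l - ∑ i, s1 i * β l i) (by simpa using h1)
      rw [ideal_smul_top_self, Submodule.mem_sup] at h3
      obtain ⟨y, hy, w, hw, hyw⟩ := h3
      exact ⟨w, hw, by rw [← hyw]; simpa using hy⟩
    choose w hwJ hw using hw
    obtain ⟨g, hg, hgr⟩ := ih q hqN' k r w hwJ (by
      have h1 : x j ^ k • ∑ l, r l • v l - ∑ l, w l • v l =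
          ∑ l, (x j ^ k * r l - ∑ i, s1 i * β l i - w l) • v l +
            x b ^ N • ∑ i, s1 i • τ i := by
        rw [hβv]
        simp only [sub_smul, Finset.sum_sub_distrib, mul_smul, Finset.smul_sum]
        abel
      rw [h1]
      refine add_mem (Submodule.smul_mono_left le_sup_left (sum_smul_mem_smul_top hw v)) ?_
      exact Submodule.smul_mem_smul
        (Ideal.mem_sup_right (Ideal.mem_span_singleton_self _)) Submodule.mem_top)
    refine ⟨_, Submodule.mem_map_of_mem hg, ?_⟩
    have h1 : ∑ i, c i • τ i - x b ^ (q - N) • ∑ l, r l • v l ∈ (I ⊔ J) • (⊤ : Submodule A U) := by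
      refine hU.pow_smul (Finset.subset_insert b B) (Finset.mem_insert_self b B) hb _ N ?_
      have h2 : x b ^ N • (∑ i, c i • τ i - x b ^ (q - N) • ∑ l, r l • v l) =
          ∑ l, (∑ i, c i * β l i - x b ^ q * r l) • v l := by
        rw [smul_sub, hβv, smul_smul, ← pow_add, Nat.add_sub_of_le hqN]
        simp only [sub_smul, Finset.sum_sub_distrib, mul_smul, Finset.smul_sum]
      rw [h2]
      exact sum_smul_mem_smul_top hr v
    have h2 : x b ^ (q - N) • (∑ l, r l • v l - (∏ k ∈ B, x k) ^ (q - N') • g) ∈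
        (I ⊔ powIdeal x (insert b B) fun _ => q) • (⊤ : Submodule A U) := by
      rw [hIns]
      rw [sup_right_comm, sup_comm _ (Ideal.span _), mem_span_singleton_sup_smul_top_iff] at hgr
      obtain ⟨v', hv'⟩ := hgr
      rw [sup_left_comm, mem_span_singleton_sup_smul_top_iff]
      refine ⟨v', ?_⟩
      have h3 := Submodule.smul_mem _ (x b ^ (q - N)) hv'
      rwa [smul_sub, smul_smul (x b ^ (q - N)) (x b ^ N), ← pow_add, Nat.sub_add_cancel hqN] at h3
    have h3 := add_mem (Submodule.smul_mono_left (sup_le_sup_left (by rw [hIns]; exact le_sup_right)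
      I) h1) h2
    convert h3 using 1
    rw [Finset.prod_insert hb, LinearMap.lsmul_apply, smul_sub, smul_smul, smul_smul,
      sub_add_sub_cancel]
    congr 2
    have e1 : x b ^ (q - N) = x b ^ (q - max N N') * x b ^ (max N N' - N) := by
      rw [← pow_add]; congr 1; omega
    have e2 : (∏ k ∈ B, x k) ^ (q - N') =
        (∏ k ∈ B, x k) ^ (q - max N N') * (∏ k ∈ B, x k) ^ (max N N' - N') := by
      rw [← pow_add]; congr 1; omega
    rw [e1, e2, mul_pow]
    ring

end Finiteness

section Flatness

variable {A U : Type*} [CommRing A] [AddCommGroup U] [Module A U]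

theorem mem_relSpan_of_forall_mem_smul_top {κ : Type*} [Fintype κ] {I : Ideal A}
    {Z : Submodule A (κ → A)} (hZ : ∀ z : κ → A, (∀ i, z i ∈ I) → z ∈ Z) {t : κ → U}
    (ht : ∀ i, t i ∈ I • (⊤ : Submodule A U)) : t ∈ relSpan Z U := by
  classical
  have hsum : t = ∑ i, Pi.single i (t i) := (Finset.univ_sum_single t).symm
  rw [hsum]
  refine sum_mem fun i _ => ?_
  refine Submodule.smul_induction_on (p := fun u => (Pi.single i u : κ → U) ∈ relSpan Z U)
    (ht i) ?_ ?_
  · intro c hc u _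
    have : (Pi.single i (c • u) : κ → U) = fun k => (Pi.single i c : κ → A) k • u := by
      ext k
      by_cases hk : k = i
      · subst hk; simp
      · simp [hk]
    rw [this]
    refine smul_mem_relSpan (hZ _ fun k => ?_) u
    by_cases hk : k = i
    · subst hk; simpa using hc
    · simp [hk]
  · intro u v hu hv
    rw [Pi.single_add]
    exact add_mem hu hv

theorem FlatUpTo.one_of_span_sup [IsNoetherianRing A] {f : A} {I : Ideal A}
    (h : FlatUpTo U 1 (Ideal.span {f} ⊔ I)) (hf : FlatUpTo U f I)
    (hA : ∀ a : A, f * a ∈ I → a ∈ I)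
    (hU : ∀ u : U, f • u ∈ I • (⊤ : Submodule A U) → u ∈ I • (⊤ : Submodule A U)) :
    FlatUpTo U 1 I := by
  intro κ _ a t hat
  obtain ⟨N, hN⟩ := hf κ a t hat
  refine ⟨0, ?_⟩
  rw [pow_zero, one_smul]
  have cancel : ∀ t : κ → U, f • t ∈ relSpan (relKer a I) U → t ∈ relSpan (relKer a I) U := by
    intro t ht
    obtain ⟨m, z, u, hz, hzu⟩ := mem_relSpan_iff.1 ht
    obtain ⟨M, hM⟩ := h.exists_mem_relHull u
    rw [one_pow, one_smul] at hM
    obtain ⟨m', y, w, hy, hyw⟩ := mem_relSpan_iff.1 hM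
    have hg : ∀ l i, ∃ g, ∑ j, z j i * y l j - f * g ∈ I := by
      intro l i
      have h1 := mem_relHull.1 (hy l) (fun j => z j i) (by
        rw [← show f • t i = _ from congrFun hzu i]
        exact Submodule.smul_mem_smul (Ideal.mem_sup_left (Ideal.mem_span_singleton_self f))
          Submodule.mem_top)
      rw [← ideal_smul_top_self (Ideal.span {f} ⊔ I), mem_span_singleton_sup_smul_top_iff] at h1
      simpa using h1
    choose g hg using hg
    have hgker : ∀ l, g l ∈ relKer a I := by
      intro l
      refine hA _ ?_
      have h1 : f * ∑ i, a i * g l i = ∑ j, (∑ i, a i * z j i) * y l j -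
          ∑ i, a i * (∑ j, z j i * y l j - f * g l i) := by
        simp only [mul_sub, Finset.sum_sub_distrib, Finset.mul_sum, Finset.sum_mul]
        rw [Finset.sum_comm, sub_eq_add_neg, ← sub_eq_add_neg]
        simp only [mul_assoc, mul_left_comm f, sub_sub_cancel]
      rw [h1]
      exact sub_mem (sum_mem fun j _ => Ideal.mul_mem_right _ _ (hz j))
        (sum_mem fun i _ => Ideal.mul_mem_left _ _ (hg l i))
    have hrem : ∀ i, t i - ∑ l, g l i • w l ∈ I • (⊤ : Submodule A U) := by
      intro i
      refine hU _ ?_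
      have h1 : f • (t i - ∑ l, g l i • w l) =
          ∑ l, (∑ j, z j i * y l j - f * g l i) • w l := by
        rw [smul_sub, show f • t i = _ from congrFun hzu i]
        simp only [sub_smul, Finset.sum_sub_distrib, mul_smul, Finset.smul_sum, Finset.sum_smul]
        congr 1
        rw [Finset.sum_comm]
        refine Finset.sum_congr rfl fun j _ => ?_
        rw [show u j = _ from congrFun hyw j, Finset.smul_sum]
      rw [h1]
      exact sum_smul_mem_smul_top (hg · i) w
    have h2 := add_mem (sum_smul_mem_relSpan g hgker w)
      (mem_relSpan_of_forall_mem_smul_top (Z := relKer a I)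
        (fun z hz => sum_mem fun i _ => Ideal.mul_mem_left _ _ (hz i)) hrem)
    convert h2 using 1
    ext i
    simp
  induction N with
  | zero => simpa using hN
  | succ N ih => exact ih (cancel _ (by rwa [smul_smul, ← pow_succ']))

theorem flatUpTo_one_maximalIdeal [IsLocalRing A] :
    FlatUpTo U 1 (IsLocalRing.maximalIdeal A) := by
  classical
  intro κ _ a t hat
  refine ⟨0, ?_⟩
  rw [pow_zero, one_smul]
  by_cases ha : ∀ i, a i ∈ IsLocalRing.maximalIdeal A
  · refine relSpan_mono ?_ (relSpan_top (A := A) t)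
    intro z _
    exact sum_mem fun i _ => Ideal.mul_mem_right _ _ (ha i)
  push Not at ha
  obtain ⟨k, hk⟩ := ha
  obtain ⟨c, hc⟩ := (IsLocalRing.notMem_maximalIdeal.1 hk).exists_right_inv
  have h1 : (fun i => ∑ l, ((Pi.single l 1 - (c * a l) • Pi.single k 1 : κ → A)) i • t l) ∈
      relSpan (relKer a (IsLocalRing.maximalIdeal A)) U := by
    refine sum_smul_mem_relSpan (fun l => Pi.single l 1 - (c * a l) • Pi.single k 1) ?_ t
    intro l
    rw [mem_relKer]
    have : ∑ i, a i * ((Pi.single l 1 - (c * a l) • Pi.single k 1 : κ → A)) i = 0 := by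
      simp only [Pi.sub_apply, Pi.smul_apply, mul_sub, Finset.sum_sub_distrib, smul_eq_mul,
        Pi.single_apply, mul_ite, mul_one, mul_zero, Finset.sum_ite_eq', Finset.mem_univ, if_true]
      rw [← mul_assoc, hc, one_mul, sub_self]
    rw [this]
    exact zero_mem _
  have h2 : (Pi.single k (c • ∑ l, a l • t l) : κ → U) ∈
      relSpan (relKer a (IsLocalRing.maximalIdeal A)) U := by
    refine mem_relSpan_of_forall_mem_smul_top (I := IsLocalRing.maximalIdeal A)
      (fun z hz => sum_mem fun i _ => Ideal.mul_mem_left _ _ (hz i)) fun i => ?_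
    by_cases hik : i = k
    · subst hik
      simpa using Submodule.smul_mem _ c hat
    · simp [hik]
  convert add_mem h1 h2 using 1
  ext i
  simp only [Pi.add_apply, Pi.sub_apply, Pi.smul_apply, sub_smul, Finset.sum_sub_distrib,
    Pi.single_apply, smul_eq_mul, mul_ite, mul_one, mul_zero, ite_smul, one_smul, zero_smul,
    Finset.sum_ite_eq, Finset.mem_univ, if_true]
  by_cases hik : i = k
  · simp [hik, Finset.smul_sum, mul_smul]
  · simp [hik]

theorem FlatUpTo.flat (h : FlatUpTo U (1 : A) ⊥) : Module.Flat A U := by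
  refine Module.Flat.of_forall_isTrivialRelation fun {l f x} hfx => ?_
  obtain ⟨N, hN⟩ := h (Fin l) f x (by simp [hfx])
  rw [one_pow, one_smul] at hN
  obtain ⟨m, z, v, hz, hzv⟩ := mem_relSpan_iff.1 hN
  exact ⟨m, fun i j => z j i, v, fun i => congrFun hzv i, fun j => by simpa [mem_relKer] using hz j⟩

/-- Flatness criterion for a module on which the generators of the maximal ideal form a regular
sequence in any order. -/
theorem flat_of_isRegularFamily [IsNoetherianRing A] [IsLocalRing A] {ι : Type*} [DecidableEq ι]
    (x : ι → A) (S : Finset ι) (hS : powIdeal x S (fun _ => 1) = IsLocalRing.maximalIdeal A)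
    (hflat : ∀ b ∈ S, FlatUpTo U (x b) ⊥)
    (hA : IsRegularFamily x A ⊥ S) (hU : IsRegularFamily x U ⊥ S) : Module.Flat A U := by
  have key : ∀ B ⊆ S, FlatUpTo U 1 (powIdeal x B fun _ => 1) → FlatUpTo U (1 : A) ⊥ := by
    intro B
    induction B using Finset.induction_on with
    | empty => intro _ h; simpa [powIdeal] using h
    | insert b B hb ih =>
      intro hB h
      have hbS := hB (Finset.mem_insert_self b B)
      have hBS := (Finset.subset_insert b B).trans hB
      rw [powIdeal_insert, pow_one] at h
      refine ih hBS (h.one_of_span_sup ((hflat b hbS).of_bot _) (fun a ha => ?_) fun u hu => ?_)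
      · simpa using hA B hBS b hbS hb (fun _ => 1) a (by simpa using ha)
      · simpa using hU B hBS b hbS hb (fun _ => 1) u (by simpa using hu)
  refine (key S subset_rfl ?_).flat
  rw [hS]
  exact flatUpTo_one_maximalIdeal

end Flatness

/-- Every monic polynomial of positive degree over `T` has a root in `T`. -/
def HasMonicRoots (T : Type*) [CommRing T] : Prop :=
  ∀ f : Polynomial T, f.Monic → f.natDegree ≠ 0 → ∃ z, f.IsRoot z

section PurelyAdditive

open Polynomial

variable {T : Type*} [CommRing T]

theorem HasMonicRoots.exists_eq_prod [IsDomain T] (hT : HasMonicRoots T) (f : T[X])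
    (hf : f.Monic) : ∃ s : Multiset T, f = (s.map fun c => X - C c).prod := by
  induction hn : f.natDegree generalizing f with
  | zero => exact ⟨0, by simpa using hf.natDegree_eq_zero.1 hn⟩
  | succ n ih =>
    obtain ⟨z, hz⟩ := hT f hf (by omega)
    have hmul := mul_divByMonic_eq_iff_isRoot.2 hz
    have hg : (f /ₘ (X - C z)).Monic := by
      refine (monic_X_sub_C z).of_mul_monic_left ?_
      rwa [hmul]
    obtain ⟨s, hs⟩ := ih _ hg (by rw [natDegree_divByMonic f (monic_X_sub_C z)]; simp [hn])
    exact ⟨z ::ₘ s, by rw [Multiset.map_cons, Multiset.prod_cons, ← hs, hmul]⟩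

/-- A domain with roots of monic polynomials is integrally closed, in homogenized form. -/
theorem HasMonicRoots.dvd_of_isRoot [IsDomain T] (hT : HasMonicRoots T) {K : Type*} [Field K]
    [Algebra T K] [IsFractionRing T K] {f : T[X]} (hf : f.Monic) {t x : T} (hx : x ≠ 0)
    (h : (f.map (algebraMap T K)).eval (algebraMap T K t / algebraMap T K x) = 0) : x ∣ t := by
  obtain ⟨s, rfl⟩ := hT.exists_eq_prod f hf
  rw [Polynomial.map_multiset_prod, eval_multiset_prod, Multiset.prod_eq_zero_iff] at h
  simp only [Multiset.mem_map] at h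
  obtain ⟨-, ⟨-, ⟨c, hc, rfl⟩, rfl⟩, h⟩ := h
  have hx' : algebraMap T K x ≠ 0 := by simpa using hx
  simp only [Polynomial.map_sub, map_X, map_C, eval_sub, eval_X, eval_C, sub_eq_zero] at h
  rw [div_eq_iff hx', ← map_mul] at h
  exact ⟨c, by rw [mul_comm]; exact IsFractionRing.injective T K h⟩

variable (p : ℕ) [Fact p.Prime]

theorem HasMonicRoots.exists_pow_sub_sum_eq [Nontrivial T] (hT : HasMonicRoots T) (e₀ n : ℕ)
    (a : ℕ → T) (b : T) :
    ∃ z : T, z ^ p ^ (e₀ + n) - ∑ i ∈ Finset.range n, a i * z ^ p ^ (e₀ + i) = b := by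
  have hp := (Fact.out : p.Prime)
  let g : T[X] := ∑ i ∈ Finset.range n, C (a i) * X ^ p ^ (e₀ + i) + C b
  have hg : g.degree < (p ^ (e₀ + n) : ℕ) := by
    refine lt_of_le_of_lt (degree_add_le _ _) (max_lt ?_ ?_)
    · refine lt_of_le_of_lt (degree_sum_le _ _) ?_
      rw [Finset.sup_lt_iff (WithBot.bot_lt_coe _)]
      intro i hi
      refine lt_of_le_of_lt (degree_C_mul_X_pow_le _ _) ?_
      have := Nat.pow_lt_pow_right hp.one_lt
        (Nat.add_lt_add_left (Finset.mem_range.1 hi) e₀)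
      exact_mod_cast this
    · refine lt_of_le_of_lt degree_C_le ?_
      exact_mod_cast pow_pos hp.pos _
  have hmon : (X ^ p ^ (e₀ + n) - g).Monic := monic_X_pow_sub hg
  have hdeg : (X ^ p ^ (e₀ + n) - g).natDegree = p ^ (e₀ + n) := by
    refine natDegree_eq_of_degree_eq_some ?_
    rw [degree_sub_eq_left_of_degree_lt (by rwa [degree_X_pow]), degree_X_pow]
  obtain ⟨z, hz⟩ := hT _ hmon (by rw [hdeg]; exact (pow_pos hp.pos _).ne')
  refine ⟨z, ?_⟩
  simp only [g, IsRoot.def, eval_sub, eval_add, eval_finsetSum, eval_mul, eval_C, eval_pow,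
    eval_X] at hz
  linear_combination hz

theorem HasMonicRoots.dvd_of_pow_eq_sum [IsDomain T] (hT : HasMonicRoots T) (e₀ n : ℕ)
    (a : ℕ → T) {t x : T} (hx : x ≠ 0)
    (h : t ^ p ^ (e₀ + n) = ∑ i ∈ Finset.range n,
      a i * x ^ (p ^ (e₀ + n) - p ^ (e₀ + i)) * t ^ p ^ (e₀ + i)) : x ∣ t := by
  have hp := (Fact.out : p.Prime)
  let g : T[X] := ∑ i ∈ Finset.range n, C (a i) * X ^ p ^ (e₀ + i)
  have hg : g.degree < (p ^ (e₀ + n) : ℕ) := by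
    refine lt_of_le_of_lt (degree_sum_le _ _) ?_
    rw [Finset.sup_lt_iff (WithBot.bot_lt_coe _)]
    intro i hi
    refine lt_of_le_of_lt (degree_C_mul_X_pow_le _ _) ?_
    have := Nat.pow_lt_pow_right hp.one_lt (Nat.add_lt_add_left (Finset.mem_range.1 hi) e₀)
    exact_mod_cast this
  refine hT.dvd_of_isRoot (K := FractionRing T) (monic_X_pow_sub hg) hx ?_
  have hx' : algebraMap T (FractionRing T) x ≠ 0 := by simpa using hx
  have h' := congrArg (algebraMap T (FractionRing T)) h
  simp only [map_pow, map_sum, map_mul] at h'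
  simp only [g, Polynomial.map_sub, Polynomial.map_pow, map_X, Polynomial.map_sum,
    Polynomial.map_mul, map_C, eval_sub, eval_pow, eval_X, eval_finsetSum, eval_mul, eval_C,
    div_pow]
  rw [h', Finset.sum_div, ← Finset.sum_sub_distrib]
  refine Finset.sum_eq_zero fun i hi => ?_
  have hle : p ^ (e₀ + i) ≤ p ^ (e₀ + n) :=
    Nat.pow_le_pow_right hp.pos (Nat.add_le_add_left (Finset.mem_range.1 hi).le e₀)
  have : algebraMap T (FractionRing T) x ^ p ^ (e₀ + n) =
      algebraMap T (FractionRing T) x ^ (p ^ (e₀ + n) - p ^ (e₀ + i)) *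
        algebraMap T (FractionRing T) x ^ p ^ (e₀ + i) := by
    rw [← pow_add, Nat.sub_add_cancel hle]
  rw [this]
  field_simp
  ring

theorem HasMonicRoots.mem_powIdeal_one [IsDomain T] [CharP T p] (hT : HasMonicRoots T) {ι : Type*}
    [DecidableEq ι] (x : ι → T) (B : Finset ι) (hB : B.Nonempty) (hx : ∏ b ∈ B, x b ≠ 0)
    (e₀ n : ℕ) (a : ℕ → T) (t : T)
    (h : t ^ p ^ (e₀ + n) - ∑ i ∈ Finset.range n,
      a i * (∏ b ∈ B, x b) ^ (p ^ (e₀ + n) - p ^ (e₀ + i)) * t ^ p ^ (e₀ + i) ∈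
        powIdeal x B fun _ => p ^ (e₀ + n)) :
    t ∈ powIdeal x B fun _ => 1 := by
  have hp := (Fact.out : p.Prime)
  set P := ∏ b ∈ B, x b with hP
  obtain ⟨b, hb⟩ := (Submodule.mem_span_image_finset_iff_exists_fun' T).1 h
  have hz : ∀ k, ∃ z : T, z ^ p ^ (e₀ + n) - ∑ i ∈ Finset.range n,
      (a i * (∏ l ∈ B.erase k, x l) ^ (p ^ (e₀ + n) - p ^ (e₀ + i))) * z ^ p ^ (e₀ + i) = b k :=
    fun k => hT.exists_pow_sub_sum_eq p e₀ n _ _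
  choose z hz using hz
  have hxz : ∀ k ∈ B, (x k * z k) ^ p ^ (e₀ + n) - ∑ i ∈ Finset.range n,
      a i * P ^ (p ^ (e₀ + n) - p ^ (e₀ + i)) * (x k * z k) ^ p ^ (e₀ + i) =
        b k * x k ^ p ^ (e₀ + n) := by
    intro k hk
    rw [← hz k, sub_mul, Finset.sum_mul, mul_pow, mul_comm]
    congr 1
    refine Finset.sum_congr rfl fun i hi => ?_
    have hle : p ^ (e₀ + i) ≤ p ^ (e₀ + n) :=
      Nat.pow_le_pow_right hp.pos (Nat.add_le_add_left (Finset.mem_range.1 hi).le e₀)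
    have : x k ^ p ^ (e₀ + n) =
        x k ^ (p ^ (e₀ + n) - p ^ (e₀ + i)) * x k ^ p ^ (e₀ + i) := by
      rw [← pow_add, Nat.sub_add_cancel hle]
    rw [hP, ← Finset.mul_prod_erase B x hk, this, mul_pow, mul_pow]
    ring
  have hmem : ∑ k ∈ B, x k * z k ∈ powIdeal x B fun _ => 1 :=
    sum_mem fun k hk => Ideal.mul_mem_right _ _ (by
      simpa using pow_mem_powIdeal x (fun _ => 1) hk)
  have hdvd : P ∣ t - ∑ k ∈ B, x k * z k := by
    refine hT.dvd_of_pow_eq_sum p e₀ n a hx ?_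
    simp only [sub_pow_char_pow, sum_pow_char_pow, mul_sub, Finset.sum_sub_distrib,
      Finset.mul_sum]
    rw [Finset.sum_comm (s := Finset.range n)]
    have h1 := Finset.sum_congr rfl hxz
    rw [Finset.sum_sub_distrib] at h1
    simp only [smul_eq_mul] at hb
    linear_combination -hb - h1
  obtain ⟨k, hk⟩ := hB
  have hPmem : P ∈ powIdeal x B fun _ => 1 := by
    rw [hP, ← Finset.mul_prod_erase B x hk]
    exact Ideal.mul_mem_right _ _ (by simpa using pow_mem_powIdeal x (fun _ => 1) hk)
  simpa using add_mem (Ideal.mem_of_dvd _ hdvd hPmem) hmem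

end PurelyAdditive

section Integral

variable {A ι U : Type*} [CommRing A] [CommRing U] [Algebra A U]

theorem mem_powIdeal_smul_top_iff {x : ι → A} {B : Finset ι} {e : ι → ℕ} {u : U} :
    u ∈ powIdeal x B e • (⊤ : Submodule A U) ↔
      u ∈ powIdeal (fun b => algebraMap A U (x b)) B e := by
  rw [Ideal.smul_top_eq_map, Submodule.restrictScalars_mem, powIdeal, Ideal.map_span, powIdeal,
    Set.image_image]
  simp only [map_pow]

theorem exists_finset_sum_of_mem_powIdeal_smul_top {x : ι → A} {B : Finset ι} {u : U}
    (hu : u ∈ powIdeal x B (fun _ => 1) • (⊤ : Submodule A U)) :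
    ∃ s : ι → U, u = ∑ b ∈ B, x b • s b := by
  rw [mem_powIdeal_smul_top_iff] at hu
  obtain ⟨s, hs⟩ := (Submodule.mem_span_image_finset_iff_exists_fun' U).1 hu
  refine ⟨s, hs.symm.trans (Finset.sum_congr rfl fun b _ => ?_)⟩
  rw [Algebra.smul_def (x b), pow_one, smul_eq_mul, mul_comm]

theorem exists_mem_span_image_range_of_fg {M : Type*} [AddCommGroup M] [Module A M]
    [IsNoetherianRing A] {G : Submodule A M} (hG : G.FG) (γ : ℕ → M) (hγ : ∀ i, γ i ∈ G) :
    ∃ (n : ℕ) (a : ℕ → A), γ n = ∑ i ∈ Finset.range n, a i • γ i := by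
  have : IsNoetherian A G := isNoetherian_of_fg_of_noetherian G hG
  let δ : ℕ → G := fun i => ⟨γ i, hγ i⟩
  let F : ℕ →o Submodule A G :=
    ⟨fun n => Submodule.span A (δ '' (Finset.range n : Set ℕ)), fun m n hmn =>
      Submodule.span_mono (Set.image_mono (by simpa using hmn))⟩
  obtain ⟨n, hn⟩ := monotone_stabilizes_iff_noetherian.2 this F
  have hmem : δ n ∈ F n := by
    rw [hn (n + 1) n.le_succ]
    exact Submodule.subset_span ⟨n, by simp, rfl⟩
  obtain ⟨a, ha⟩ := (Submodule.mem_span_image_finset_iff_exists_fun' A).1 hmem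
  refine ⟨n, a, ?_⟩
  have := congrArg Subtype.val ha
  simpa [δ] using this.symm

variable [IsNoetherianRing A] [IsDomain U] [Algebra.IsIntegral A U]

theorem mem_powIdeal_of_smul_mem (p : ℕ) [Fact p.Prime] [CharP U p] (hU : HasMonicRoots U)
    [DecidableEq ι] (x : ι → A) (hx : ∀ b, algebraMap A U (x b) ≠ 0) (B : Finset ι) (j : ι)
    (hj : j ∉ B) (hflat : ∀ b ∈ B, FlatUpTo U (x b) ⊥)
    (hA : IsRegularFamily x A ⊥ (insert j B)) (hB : IsRegularFamily x U ⊥ B) (u : U)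
    (hu : x j • u ∈ powIdeal x B (fun _ => 1) • (⊤ : Submodule A U)) :
    u ∈ powIdeal x B (fun _ => 1) • (⊤ : Submodule A U) := by
  have hp := (Fact.out : p.Prime)
  rcases B.eq_empty_or_nonempty with rfl | hne
  · rw [mem_powIdeal_smul_top_iff] at hu ⊢
    rw [Algebra.smul_def] at hu
    simp only [powIdeal, Finset.coe_empty, Set.image_empty, Ideal.span_empty,
      Ideal.mem_bot] at hu ⊢
    exact (mul_eq_zero.1 hu).resolve_left (hx j)
  obtain ⟨s, hs⟩ := exists_finset_sum_of_mem_powIdeal_smul_top hu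
  let M : Subalgebra A U := Algebra.adjoin A (insert u (s '' (B : Set ι)))
  have hMfg : (Subalgebra.toSubmodule M).FG :=
    fg_adjoin_of_finite ((B.finite_toSet.image s).insert u) fun y _ => Algebra.IsIntegral.isIntegral y
  have huM : u ∈ M := Algebra.subset_adjoin (by simp)
  have hsM : ∀ b ∈ B, s b ∈ M := fun b hb => Algebra.subset_adjoin (Or.inr ⟨b, hb, rfl⟩)
  obtain ⟨r, τ, hτ⟩ := Submodule.fg_iff_exists_fin_generating_family.1 hMfg
  have hrep : ∀ y ∈ M, ∃ c : Fin r → A, ∑ i, c i • τ i = y := by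
    intro y hy
    rw [← Subalgebra.mem_toSubmodule, ← hτ] at hy
    exact (Submodule.mem_span_range_iff_exists_fun A).1 hy
  obtain ⟨N, G, hG, hmain⟩ :=
    exists_fg_submodule_of_pow_smul_sub_mem x j B hj hflat ⊥ hA hB τ
  have hg : ∀ i, ∃ g ∈ G, u ^ p ^ (N + i) - (∏ b ∈ B, x b) ^ (p ^ (N + i) - N) • g ∈
      (powIdeal x B fun _ => p ^ (N + i)) • (⊤ : Submodule A U) := by
    intro i
    obtain ⟨c, hc⟩ := hrep _ (pow_mem huM (p ^ (N + i)))
    have hd : ∀ b, ∃ d : Fin r → A, b ∈ B → ∑ i, d i • τ i = s b ^ p ^ (N + i) := by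
      intro b
      by_cases hb : b ∈ B
      · obtain ⟨d, hd⟩ := hrep _ (pow_mem (hsM b hb) (p ^ (N + i)))
        exact ⟨d, fun _ => hd⟩
      · exact ⟨0, fun h => (hb h).elim⟩
    choose d hd using hd
    obtain ⟨g, hg, hgu⟩ := hmain (p ^ (N + i))
      ((Nat.le_add_right N i).trans (Nat.lt_pow_self hp.one_lt).le) (p ^ (N + i)) c
      (fun l => ∑ b ∈ B, x b ^ p ^ (N + i) * d b l)
      (fun l => sum_mem fun b hb => Ideal.mul_mem_right _ _
        (pow_mem_powIdeal x (fun _ => p ^ (N + i)) hb)) (by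
        have h1 : ∑ l, (∑ b ∈ B, x b ^ p ^ (N + i) * d b l) • τ l =
            ∑ b ∈ B, x b ^ p ^ (N + i) • s b ^ p ^ (N + i) := by
          simp only [Finset.sum_smul]
          rw [Finset.sum_comm]
          refine Finset.sum_congr rfl fun b hb => ?_
          rw [← hd b hb, Finset.smul_sum]
          simp only [mul_smul]
        have h2 : x j ^ p ^ (N + i) • u ^ p ^ (N + i) =
            ∑ b ∈ B, x b ^ p ^ (N + i) • s b ^ p ^ (N + i) := by
          rw [← smul_pow, hs, sum_pow_char_pow]
          exact Finset.sum_congr rfl fun b _ => smul_pow _ _ _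
        rw [h1, hc, h2, sub_self]
        exact zero_mem _)
    exact ⟨g, hg, by rwa [hc, bot_sup_eq] at hgu⟩
  choose γ hγ hγu using hg
  obtain ⟨n, a, ha⟩ := exists_mem_span_image_range_of_fg hG γ hγ
  rw [mem_powIdeal_smul_top_iff]
  refine hU.mem_powIdeal_one p _ B hne (Finset.prod_ne_zero_iff.2 fun b _ => hx b) N n
    (fun i => algebraMap A U (a i)) u ?_
  rw [← map_prod]
  set P := ∏ b ∈ B, x b with hP
  rw [← mem_powIdeal_smul_top_iff (A := A) (U := U)]
  have hpow : ∀ i ∈ Finset.range n, p ^ (N + i) ≤ p ^ (N + n) := fun i hi =>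
    Nat.pow_le_pow_right hp.pos (Nat.add_le_add_left (Finset.mem_range.1 hi).le N)
  have hN : ∀ i, N ≤ p ^ (N + i) := fun i =>
    (Nat.le_add_right N i).trans (Nat.lt_pow_self hp.one_lt).le
  have hscale : ∀ i ∈ Finset.range n, ∀ v ∈ (powIdeal x B fun _ => p ^ (N + i)) •
      (⊤ : Submodule A U), P ^ (p ^ (N + n) - p ^ (N + i)) • v ∈
        (powIdeal x B fun _ => p ^ (N + n)) • (⊤ : Submodule A U) := by
    intro i hi v hv
    refine Submodule.smul_induction_on hv (fun c hc w _ => ?_) fun v w hv hw => ?_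
    · rw [smul_smul]
      refine Submodule.smul_mem_smul ?_ Submodule.mem_top
      refine Submodule.span_induction ?_ ?_ ?_ ?_ hc
      · rintro _ ⟨b, hb, rfl⟩
        rw [hP, ← Finset.mul_prod_erase B x hb, mul_pow, mul_right_comm, ← pow_add,
          Nat.sub_add_cancel (hpow i hi)]
        exact Ideal.mul_mem_right _ _ (pow_mem_powIdeal x (fun _ => p ^ (N + n)) hb)
      · simp
      · intro y z _ _ hy hz
        rw [mul_add]
        exact add_mem hy hz
      · intro y z _ hz
        rw [smul_eq_mul, mul_left_comm]
        exact Ideal.mul_mem_left _ _ hz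
    · rw [smul_add]
      exact add_mem hv hw
  have key : u ^ p ^ (N + n) - ∑ i ∈ Finset.range n, algebraMap A U (a i) *
        algebraMap A U P ^ (p ^ (N + n) - p ^ (N + i)) * u ^ p ^ (N + i) =
      (u ^ p ^ (N + n) - P ^ (p ^ (N + n) - N) • γ n) - ∑ i ∈ Finset.range n,
        a i • P ^ (p ^ (N + n) - p ^ (N + i)) •
          (u ^ p ^ (N + i) - P ^ (p ^ (N + i) - N) • γ i) := by
    simp only [smul_sub, Finset.sum_sub_distrib]
    rw [ha, Finset.smul_sum]
    have h1 : ∀ i ∈ Finset.range n, P ^ (p ^ (N + n) - N) • a i • γ i =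
        a i • P ^ (p ^ (N + n) - p ^ (N + i)) • P ^ (p ^ (N + i) - N) • γ i := by
      intro i hi
      rw [smul_comm, smul_smul (P ^ _) (P ^ _), ← pow_add]
      congr 3
      have := hpow i hi
      have := hN i
      omega
    rw [Finset.sum_congr rfl h1]
    simp only [Algebra.smul_def, map_pow, mul_assoc]
    ring
  rw [key]
  exact sub_mem (hγu n) (sum_mem fun i hi => Submodule.smul_mem _ _ (hscale i hi _ (hγu i)))

/-- A permutable regular sequence of `A` stays regular on an integral extension domain that has
roots of monic polynomials and is flat up to powers of the members of the sequence. -/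
theorem IsRegularFamily.of_isIntegral (p : ℕ) [Fact p.Prime] [CharP U p] (hU : HasMonicRoots U)
    [DecidableEq ι] (x : ι → A) (hx : ∀ b, algebraMap A U (x b) ≠ 0) (S : Finset ι)
    (hflat : ∀ b ∈ S, FlatUpTo U (x b) ⊥)
    (hA : IsRegularFamily x A ⊥ S) : IsRegularFamily x U ⊥ S := by
  have key : ∀ B ⊆ S, IsRegularFamily x U ⊥ B → ∀ j ∈ S, j ∉ B → ∀ u : U,
      x j • u ∈ powIdeal x B (fun _ => 1) • (⊤ : Submodule A U) →
        u ∈ powIdeal x B (fun _ => 1) • (⊤ : Submodule A U) := fun B hB h j hj hjB =>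
    mem_powIdeal_of_smul_mem p hU x hx B j hjB (fun b hb => hflat b (hB hb))
      (hA.mono (Finset.insert_subset hj hB)) h
  have main : ∀ B ⊆ S, IsRegularFamily x U ⊥ B := by
    intro B
    induction B using Finset.strongInduction with
    | H B ih =>
      intro hB
      refine isRegularFamily_bot_of_forall fun C hC j hj hjC => ?_
      exact key C (hC.trans hB) (ih C (Finset.ssubset_iff_subset_ne.2 ⟨hC, fun h => hjC (h ▸ hj)⟩)
        (hC.trans hB)) j (hB hj) hjC
  exact main S subset_rfl

end Integral

section RegularLocal

open IsLocalRing

/-- The maximal ideal of `A` is generated by at most `n` elements, and `n` is at most the Krull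
dimension. -/
def HasRegularParameters (A : Type*) [CommRing A] [IsLocalRing A] (n : ℕ) : Prop :=
  (n : WithBot ℕ∞) ≤ ringKrullDim A ∧
    ∃ s : Finset A, s.card ≤ n ∧ Ideal.span (s : Set A) = maximalIdeal A

theorem natCast_le_of_add_le_add {n k : ℕ} {d : WithBot ℕ∞}
    (h : ((n + k : ℕ) : WithBot ℕ∞) ≤ d + k) : (n : WithBot ℕ∞) ≤ d := by
  induction d with
  | bot =>
    rw [WithBot.bot_add] at h
    exact absurd (le_bot_iff.1 h) (by exact WithBot.natCast_ne_bot _)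
  | coe d =>
    have h' : ((n + k : ℕ) : ℕ∞) ≤ d + k := by exact_mod_cast h
    rw [Nat.cast_add] at h'
    exact_mod_cast (WithTop.add_le_add_iff_right (WithTop.natCast_ne_top k)).1 h'

variable {A : Type*} [CommRing A] [IsLocalRing A]

theorem isLocalRing_quotient_of_ne_top {I : Ideal A} (hI : I ≠ ⊤) : IsLocalRing (A ⧸ I) :=
  have := Ideal.Quotient.nontrivial_iff.2 hI
  .of_surjective' (Ideal.Quotient.mk I) Ideal.Quotient.mk_surjective

variable [IsNoetherianRing A]

theorem natCast_le_ringKrullDim_quotient {n k : ℕ}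
    (h : ((n + k : ℕ) : WithBot ℕ∞) ≤ ringKrullDim A) (t : Finset A) (htk : t.card ≤ k)
    (ht : (t : Set A) ⊆ maximalIdeal A) :
    (n : WithBot ℕ∞) ≤ ringKrullDim (A ⧸ Ideal.span (t : Set A)) := by
  refine natCast_le_of_add_le_add (k := k) (h.trans
    ((ringKrullDim_le_ringKrullDim_quotient_add_card t ?_).trans ?_))
  · rwa [ringJacobson_eq_maximalIdeal]
  · gcongr

theorem natCast_le_card_of_span_eq {n : ℕ} (h : (n : WithBot ℕ∞) ≤ ringKrullDim A) (t : Finset A)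
    (ht : Ideal.span (t : Set A) = maximalIdeal A) : n ≤ t.card := by
  have h1 := h.trans (ringKrullDim_le_ringKrullDim_quotient_add_card t (by
    rw [ringJacobson_eq_maximalIdeal, ← ht]; exact Ideal.subset_span))
  rw [ht] at h1
  rw [ringKrullDim_eq_zero_of_isField (Ideal.Quotient.maximal_ideal_iff_isField_quotient _ |>.1
    (maximalIdeal.isMaximal A)), zero_add] at h1
  exact_mod_cast h1

theorem HasRegularParameters.quotient_span [DecidableEq A] {n : ℕ} {t s : Finset A}
    (hdim : ((n + t.card : ℕ) : WithBot ℕ∞) ≤ ringKrullDim A) (hs : s.card ≤ n)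
    (hst : Ideal.span ((s ∪ t : Finset A) : Set A) = maximalIdeal A)
    [IsLocalRing (A ⧸ Ideal.span (t : Set A))] :
    HasRegularParameters (A ⧸ Ideal.span (t : Set A)) n := by
  classical
  have ht : (t : Set A) ⊆ maximalIdeal A := by
    rw [← hst]
    exact fun y hy => Ideal.subset_span (by simpa using Or.inr hy)
  refine ⟨natCast_le_ringKrullDim_quotient hdim t le_rfl ht,
    s.image (Ideal.Quotient.mk _), Finset.card_image_le.trans hs, ?_⟩
  rw [← map_maximalIdeal_of_surjective (Ideal.Quotient.mk (Ideal.span (t : Set A)))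
    Ideal.Quotient.mk_surjective, ← hst, Finset.coe_union, Ideal.span_union, Ideal.map_sup,
    Ideal.map_quotient_self, sup_bot_eq, Ideal.map_span, Finset.coe_image]

theorem exists_mem_maximalIdeal_notMem_sq (h : (1 : WithBot ℕ∞) ≤ ringKrullDim A) :
    ∃ x ∈ maximalIdeal A, x ∉ maximalIdeal A ^ 2 ∧ ∀ P ∈ minimalPrimes A, x ∉ P := by
  classical
  by_contra! hcon
  have hnot : ∀ P ∈ minimalPrimes A, ¬ maximalIdeal A ≤ P := by
    intro P hP hle
    have hPm : P = maximalIdeal A := le_antisymm (le_maximalIdeal hP.1.1.ne_top) hle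
    have := (Ideal.height_eq_zero_iff (I := maximalIdeal A)).2 (hPm ▸ hP)
    rw [← maximalIdeal_height_eq_ringKrullDim, this] at h
    exact absurd h (by decide)
  have hfin := minimalPrimes.finite_of_isNoetherianRing A
  obtain ⟨I, hI, hle⟩ := (Ideal.subset_union_prime (s := insert (maximalIdeal A ^ 2) hfin.toFinset)
    (f := fun I : Ideal A => I) (maximalIdeal A ^ 2) (maximalIdeal A ^ 2)
    (fun i hi h _ => by
      rw [Finset.mem_insert, Set.Finite.mem_toFinset] at hi
      exact (hi.resolve_left h).1.1) (I := maximalIdeal A)).1 (by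
    intro x hx
    simp only [Set.mem_iUnion]
    by_cases h2 : x ∈ maximalIdeal A ^ 2
    · exact ⟨_, by simp, h2⟩
    · obtain ⟨P, hP, hxP⟩ := hcon x hx h2
      exact ⟨P, by simp [hP], hxP⟩)
  rw [Finset.mem_insert, Set.Finite.mem_toFinset] at hI
  rcases hI with rfl | hI
  · have hbot : maximalIdeal A = ⊥ :=
      Submodule.eq_bot_of_le_smul_of_le_jacobson_bot (maximalIdeal A) _ (IsNoetherian.noetherian _)
        (by rwa [smul_eq_mul, ← pow_two]) (by rw [jacobson_eq_maximalIdeal _ bot_ne_top])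
    obtain ⟨P, hP, -⟩ := Ideal.exists_minimalPrimes_le (bot_le : ⊥ ≤ maximalIdeal A)
    exact hnot P hP (hbot ▸ bot_le)
  · exact hnot I hI hle

theorem HasRegularParameters.exists_quotient {n : ℕ} (h : HasRegularParameters A (n + 1)) :
    ∃ x ∈ maximalIdeal A, (∀ P ∈ minimalPrimes A, x ∉ P) ∧
      ∀ [IsLocalRing (A ⧸ Ideal.span (({x} : Finset A) : Set A))],
        HasRegularParameters (A ⧸ Ideal.span (({x} : Finset A) : Set A)) n := by
  classical
  obtain ⟨hdim, s, hs, hspan⟩ := h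
  obtain ⟨x, hx, hx2, hxP⟩ := exists_mem_maximalIdeal_notMem_sq
    (le_trans (by exact_mod_cast Nat.le_add_left 1 n) hdim)
  refine ⟨x, hx, hxP, fun {_} => ?_⟩
  obtain ⟨a, ha⟩ := (Submodule.mem_span_finset' (R := A)).1
    (show x ∈ Ideal.span (s : Set A) by rwa [hspan])
  obtain ⟨b, hb⟩ : ∃ b, a b ∉ maximalIdeal A := by
    by_contra! hcon
    refine hx2 ?_
    rw [← ha, pow_two]
    exact sum_mem fun b _ => Ideal.mul_mem_mul (hcon b) (hspan ▸ Ideal.subset_span b.2)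
  refine HasRegularParameters.quotient_span (s := s.erase b) (by simpa using hdim) ?_ ?_
  · rw [Finset.card_erase_of_mem b.2]
    omega
  · refine le_antisymm (Ideal.span_le.2 ?_) ?_
    · intro y hy
      simp only [Finset.coe_union, Finset.coe_erase, Finset.coe_singleton, Set.mem_union,
        Set.mem_sdiff, Set.mem_singleton_iff] at hy
      rcases hy with hy | rfl
      · exact hspan ▸ Ideal.subset_span hy.1
      · exact hx
    · rw [← hspan, Ideal.span_le]
      intro y hy
      by_cases hyb : y = b
      · obtain ⟨c, hc⟩ := (notMem_maximalIdeal.1 hb).exists_left_inv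
        have h1 : (b : A) = c * (x - ∑ i ∈ Finset.univ.erase b, a i * i) := by
          rw [← ha, ← Finset.add_sum_erase _ _ (Finset.mem_univ b)]
          simp only [smul_eq_mul, add_sub_cancel_right]
          rw [← mul_assoc, hc, one_mul]
        rw [hyb, SetLike.mem_coe]
        refine Eq.mpr (congrArg (· ∈ _) h1) ?_
        refine Ideal.mul_mem_left _ _ (sub_mem (Ideal.subset_span (by simp))
          (sum_mem fun i hi => Ideal.mul_mem_left _ _ (Ideal.subset_span ?_)))
        have : (i : A) ≠ b := fun h => (Finset.mem_erase.1 hi).1 (Subtype.ext h)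
        simp [this]
      · exact Ideal.subset_span (by simp [hyb, Finset.mem_coe.1 hy])

end RegularLocal

/-- A regular local ring is a domain. -/
theorem HasRegularParameters.isDomain (n : ℕ) : ∀ {A : Type*} [CommRing A] [IsLocalRing A]
    [IsNoetherianRing A], HasRegularParameters A n → IsDomain A := by
  induction n with
  | zero =>
    intro A _ _ _ ⟨_, s, hs, hspan⟩
    have : s = ∅ := by simpa using hs
    subst this
    have : IsField A := IsLocalRing.isField_iff_maximalIdeal_eq.2 (by simpa using hspan.symm)
    exact this.isDomain
  | succ n ih =>
    intro A _ _ _ h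
    obtain ⟨x, hx, hxP, hq⟩ := h.exists_quotient
    have hlocal : IsLocalRing (A ⧸ Ideal.span (({x} : Finset A) : Set A)) :=
      isLocalRing_quotient_of_ne_top fun htop => by
        have : Ideal.span (({x} : Finset A) : Set A) ≤ IsLocalRing.maximalIdeal A := by
          simpa [Ideal.span_le] using hx
        exact (IsLocalRing.maximalIdeal.isMaximal A).ne_top (top_le_iff.1 (htop ▸ this))
    have hdom := ih hq
    have hprime := (Ideal.Quotient.isDomain_iff_prime _).1 hdom
    obtain ⟨P, hP, hle⟩ := Ideal.exists_minimalPrimes_le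
      (bot_le : ⊥ ≤ Ideal.span (({x} : Finset A) : Set A))
    have hPprime : P.IsPrime := hP.1.1
    have hbot : P = ⊥ := by
      refine Submodule.eq_bot_of_le_smul_of_le_jacobson_bot (IsLocalRing.maximalIdeal A) _
        (IsNoetherian.noetherian _) (fun y hy => ?_)
        (by rw [IsLocalRing.jacobson_eq_maximalIdeal _ bot_ne_top])
      have hyx := hle hy
      rw [Finset.coe_singleton, Ideal.mem_span_singleton] at hyx
      obtain ⟨z, rfl⟩ := hyx
      exact Submodule.smul_mem_smul hx ((hPprime.mem_or_mem hy).resolve_left (hxP P hP))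
    subst hbot
    exact IsDomain.of_bot_isPrime A

/-- Minimal generators of the maximal ideal of a regular local ring form a regular sequence in
every order. -/
theorem isRegularFamily_of_hasRegularParameters {A : Type*} [CommRing A] [IsLocalRing A]
    [IsNoetherianRing A] [DecidableEq A] (s : Finset A)
    (hs : Ideal.span (s : Set A) = IsLocalRing.maximalIdeal A)
    (hdim : (s.card : WithBot ℕ∞) ≤ ringKrullDim A) :
    IsRegularFamily (Subtype.val : s → A) A ⊥ Finset.univ := by
  refine isRegularFamily_bot_of_forall fun B _ j _ hjB u hu => ?_
  rw [ideal_smul_top_self] at hu ⊢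
  have hB : powIdeal (Subtype.val : s → A) B (fun _ => 1) =
      Ideal.span ((B.map (Function.Embedding.subtype _) : Finset A) : Set A) := by
    simp [powIdeal]
  set t : Finset A := B.map (Function.Embedding.subtype _) with ht
  have hts : t ⊆ s := fun y hy => by
    obtain ⟨b, -, rfl⟩ := Finset.mem_map.1 hy
    exact b.2
  have hjt : (j : A) ∉ t := fun h => by
    obtain ⟨b, hb, hbj⟩ := Finset.mem_map.1 h
    exact hjB (Subtype.ext hbj ▸ hb)
  have htm : Ideal.span (t : Set A) ≤ IsLocalRing.maximalIdeal A := by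
    rw [← hs]
    exact Ideal.span_mono (by exact_mod_cast hts)
  have := isLocalRing_quotient_of_ne_top (I := Ideal.span (t : Set A))
    (ne_top_of_le_ne_top (IsLocalRing.maximalIdeal.isMaximal A).ne_top htm)
  have hreg : HasRegularParameters (A ⧸ Ideal.span (t : Set A)) (s \ t).card :=
    HasRegularParameters.quotient_span (s := s \ t)
      (by rwa [Finset.card_sdiff_add_card_eq_card hts]) le_rfl
      (by rw [Finset.sdiff_union_of_subset hts, hs])
  have hprime := (Ideal.Quotient.isDomain_iff_prime _).1 (HasRegularParameters.isDomain _ hreg)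
  rw [hB] at hu ⊢
  refine (hprime.mem_or_mem hu).resolve_left fun hj => ?_
  have hspan : Ideal.span ((s.erase j : Finset A) : Set A) = IsLocalRing.maximalIdeal A := by
    rw [← hs]
    refine le_antisymm (Ideal.span_mono (by simp)) (Ideal.span_le.2 fun y hy => ?_)
    by_cases hyj : y = j
    · rw [hyj]
      refine Ideal.span_mono ?_ hj
      intro z hz
      have hz' : z ≠ j := fun h => hjt (h ▸ hz)
      simp [hz', hts hz]
    · exact Ideal.subset_span (by simp [hyj, Finset.mem_coe.1 hy])
  have h1 := natCast_le_card_of_span_eq hdim _ hspan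
  rw [Finset.card_erase_of_mem j.2] at h1
  have := Finset.card_pos.2 ⟨_, j.2⟩
  omega

/-- The equational criterion of flatness of `T` over `R`, locally at `Q`. -/
def FlatAt (R T : Type*) [CommRing R] [AddCommGroup T] [Module R T] (Q : Ideal R) : Prop :=
  ∀ (κ : Type) [Fintype κ] (a : κ → R) (t : κ → T),
    ∑ i, a i • t i = 0 → ∃ c ∉ Q, c • t ∈ relSpan (relKer a ⊥) T

theorem FlatAt.flat {R T : Type*} [CommRing R] [IsLocalRing R] [AddCommGroup T] [Module R T]
    (h : FlatAt R T (IsLocalRing.maximalIdeal R)) : Module.Flat R T := by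
  refine FlatUpTo.flat fun κ _ a t hat => ?_
  obtain ⟨c, hc, hct⟩ := h κ a t (by simpa using hat)
  obtain ⟨u, rfl⟩ := IsLocalRing.notMem_maximalIdeal.1 hc
  refine ⟨0, ?_⟩
  have := Submodule.smul_mem _ (↑u⁻¹ : R) hct
  rwa [smul_smul, Units.inv_mul, one_smul, ← one_smul R t, ← pow_zero (1 : R)] at this

section Localization

theorem IsLocalization.exists_smul_eq_algebraMap {R A : Type*} [CommRing R] [CommRing A]
    [Algebra R A] (M : Submonoid R) [IsLocalization M A] {κ : Type*} [Finite κ] (f : κ → A) :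
    ∃ c ∈ M, ∃ g : κ → R, ∀ i, c • f i = algebraMap R A (g i) := by
  obtain ⟨c, hc⟩ := IsLocalization.exist_integer_multiples_of_finite M f
  choose g hg using hc
  exact ⟨c, c.2, g, fun i => (hg i).symm⟩

variable {R T A U : Type*} [CommRing R] [CommRing T] [CommRing A] [CommRing U] [Algebra R T]
  [Algebra R A] [Algebra A U] [Algebra R U] [Algebra T U] [IsScalarTower R A U]
  [IsScalarTower R T U] (M : Submonoid R)

theorem IsLocalization.exists_smul_eq_algebraMap_of_algebraMapSubmonoid
    [IsLocalization (Algebra.algebraMapSubmonoid T M) U] {κ : Type*} [Finite κ] (f : κ → U) :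
    ∃ c ∈ M, ∃ g : κ → T, ∀ i, c • f i = algebraMap T U (g i) := by
  obtain ⟨_, ⟨c, hc, rfl⟩, g, hg⟩ :=
    IsLocalization.exists_smul_eq_algebraMap (Algebra.algebraMapSubmonoid T M) f
  exact ⟨c, hc, g, fun i => by rw [← hg i, algebraMap_smul]⟩

theorem HasMonicRoots.of_isLocalization [IsDomain U] (hT : HasMonicRoots T) (N : Submonoid T)
    [IsLocalization N U] : HasMonicRoots U := by
  intro f hf hdeg
  have hmem : f.leadingCoeff ∈ (algebraMap T U).range := by rw [hf.leadingCoeff]; exact one_mem _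
  have hlift := IsLocalization.scaleRoots_commonDenom_mem_lifts N f hmem
  obtain ⟨g, hg, hgdeg, hgm⟩ := Polynomial.lifts_and_natDegree_eq_and_monic hlift
    ((Polynomial.monic_scaleRoots_iff _).2 hf)
  obtain ⟨z, hz⟩ := hT g hgm (by rw [hgdeg, Polynomial.natDegree_scaleRoots]; exact hdeg)
  refine ⟨IsLocalization.mk' U z (IsLocalization.commonDenom N f.support f.coeff), ?_⟩
  have hscale := Polynomial.scaleRoots_eval₂_mul (RingHom.id U) (p := f)
    (IsLocalization.mk' U z (IsLocalization.commonDenom N f.support f.coeff))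
    (algebraMap T U (IsLocalization.commonDenom N f.support f.coeff))
  simp only [RingHom.id_apply, IsLocalization.mk'_spec'] at hscale
  rw [Polynomial.eval₂_id, ← hg, Polynomial.eval_map_algebraMap, Polynomial.aeval_algebraMap_apply,
    Polynomial.coe_aeval_eq_eval, hz, map_zero] at hscale
  have hunit := (IsLocalization.map_units U
    (IsLocalization.commonDenom N f.support f.coeff)).pow f.natDegree
  rw [Polynomial.eval₂_id] at hscale
  exact (hunit.mul_right_eq_zero.1 hscale.symm)

variable [IsDomain T] [FaithfulSMul R T]

theorem algebraMapSubmonoid_le_nonZeroDivisors (hM : (0 : R) ∉ M) :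
    Algebra.algebraMapSubmonoid T M ≤ nonZeroDivisors T := by
  rintro _ ⟨c, hc, rfl⟩
  refine mem_nonZeroDivisors_of_ne_zero fun h => hM ?_
  rwa [← (FaithfulSMul.algebraMap_eq_zero_iff R T).1 h]

theorem flatUpTo_bot_of_flatAt_lt [IsDomain R] (P : Ideal R) [P.IsPrime]
    [IsLocalization.AtPrime A P] [IsLocalRing A]
    [IsLocalization (Algebra.algebraMapSubmonoid T P.primeCompl) U]
    (h : ∀ Q < P, Q.IsPrime → FlatAt R T Q) {y : A} (hy : y ∈ IsLocalRing.maximalIdeal A) :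
    FlatUpTo U y ⊥ := by
  intro κ _ a t hat
  rw [Submodule.bot_smul, Submodule.mem_bot] at hat
  let D : Ideal A := (relSpan (relKer a ⊥) U).comap (LinearMap.toSpanSingleton A (κ → U) t)
  have hD : ∀ c, c ∈ D ↔ c • t ∈ relSpan (relKer a ⊥) U := fun c => Iff.rfl
  by_contra! hcon
  have hdisj : Disjoint (D : Set A) (Submonoid.powers y) := by
    rw [Set.disjoint_right]
    rintro _ ⟨N, rfl⟩ hN
    exact hcon N hN
  obtain ⟨q, hq, hDq, hqy⟩ := Ideal.exists_le_prime_disjoint D _ hdisj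
  have hyq : y ∉ q := fun h => Set.disjoint_right.1 hqy ⟨1, pow_one y⟩ h
  have hunit : ∀ c ∉ P, algebraMap R A c ∉ q := fun c hc hcq =>
    hq.ne_top (Ideal.eq_top_of_isUnit_mem _ hcq (IsLocalization.map_units A (⟨c, hc⟩ : P.primeCompl)))
  have hlt : q.comap (algebraMap R A) < P := by
    refine lt_of_le_of_ne (fun c hc => ?_) fun hPq => ?_
    · by_contra hcP
      exact hunit c hcP hc
    · obtain ⟨r, s, rfl⟩ := IsLocalization.exists_mk'_eq P.primeCompl y
      have hr : r ∈ P := (IsLocalization.AtPrime.mk'_mem_maximal_iff A P r s).1 hy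
      rw [← hPq, Ideal.mem_comap] at hr
      refine hyq ?_
      rw [IsLocalization.mk'_eq_mul_mk'_one]
      exact Ideal.mul_mem_right _ _ hr
  obtain ⟨c₁, hc₁, a', ha'⟩ := IsLocalization.exists_smul_eq_algebraMap P.primeCompl a
  obtain ⟨c₂, hc₂, t', ht'⟩ :=
    IsLocalization.exists_smul_eq_algebraMap_of_algebraMapSubmonoid (T := T) P.primeCompl t
  have hinj : Function.Injective (algebraMap T U) := IsLocalization.injective U
    (algebraMapSubmonoid_le_nonZeroDivisors P.primeCompl fun h => h P.zero_mem)
  have hinjA : Function.Injective (algebraMap R A) := IsLocalization.injective A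
    P.primeCompl_le_nonZeroDivisors
  have hat' : ∑ i, a' i • t' i = 0 := by
    apply hinj
    rw [map_sum, map_zero]
    have : ∀ i, algebraMap T U (a' i • t' i) = (c₁ * c₂) • (a i • t i) := fun i => by
      rw [Algebra.smul_def, map_mul, ← IsScalarTower.algebraMap_apply R T U,
        IsScalarTower.algebraMap_apply R A U, ← ha', ← ht']
      simp only [Algebra.smul_def, map_mul, ← IsScalarTower.algebraMap_apply R A U]
      ring
    simp only [this, ← Finset.smul_sum, hat, smul_zero]
  obtain ⟨c, hcq, hc⟩ := h _ hlt inferInstance κ a' t' hat'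
  obtain ⟨m, z, v, hz, hzv⟩ := mem_relSpan_iff.1 hc
  have hmem : algebraMap R A (c * c₂) ∈ D := by
    rw [hD]
    refine mem_relSpan_iff.2 ⟨m, fun j i => algebraMap R A (z j i), fun j => algebraMap T U (v j),
      fun j => ?_, ?_⟩
    · have hzj := hz j
      rw [mem_relKer, Ideal.mem_bot] at hzj ⊢
      have : algebraMap R A c₁ * ∑ i, a i * algebraMap R A (z j i) = 0 := by
        rw [← map_zero (algebraMap R A), ← hzj, map_sum, Finset.mul_sum]
        refine Finset.sum_congr rfl fun i _ => ?_
        rw [map_mul, ← ha', Algebra.smul_def, mul_assoc]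
      exact (IsLocalization.map_units A (⟨c₁, hc₁⟩ : P.primeCompl)).mul_right_eq_zero.1 this
    · ext i
      have hi := congrArg (algebraMap T U) (congrFun hzv i)
      simp only [Pi.smul_apply, algebraMap_smul] at hi ⊢
      have hsmul : ∀ (r : R) (w : T), algebraMap T U (r • w) = r • algebraMap T U w :=
        fun r w => map_smul (IsScalarTower.toAlgHom R T U) r w
      rw [mul_smul, ht', ← hsmul, hi, map_sum]
      exact Finset.sum_congr rfl fun j _ => hsmul _ _
  rw [map_mul] at hmem
  exact (hq.mem_or_mem (hDq hmem)).elim hcq (hunit c₂ hc₂)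

theorem flatAt_of_flat [IsDomain R] (P : Ideal R) [P.IsPrime]
    [IsLocalization.AtPrime A P]
    [IsLocalization (Algebra.algebraMapSubmonoid T P.primeCompl) U]
    (h : Module.Flat A U) : FlatAt R T P := by
  intro κ _ a t hat
  have hinj : Function.Injective (algebraMap T U) := IsLocalization.injective U
    (algebraMapSubmonoid_le_nonZeroDivisors P.primeCompl fun h => h P.zero_mem)
  have hinjA : Function.Injective (algebraMap R A) := IsLocalization.injective A
    P.primeCompl_le_nonZeroDivisors
  have hat' : ∑ i, algebraMap R A (a i) • algebraMap T U (t i) = 0 := by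
    rw [← map_zero (algebraMap T U), ← hat, map_sum]
    refine Finset.sum_congr rfl fun i _ => ?_
    rw [algebraMap_smul, Algebra.smul_def, Algebra.smul_def, map_mul,
      ← IsScalarTower.algebraMap_apply R T U]
  obtain ⟨m, z, v, hzv, hz⟩ := Module.Flat.isTrivialRelation_of_sum_smul_eq_zero
    (R := A) (M := U) (f := fun i => algebraMap R A (a i)) (x := fun i => algebraMap T U (t i)) hat'
  obtain ⟨c, hc, z', hz'⟩ := IsLocalization.exists_smul_eq_algebraMap P.primeCompl
    (fun ij : κ × Fin m => z ij.1 ij.2)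
  obtain ⟨d, hd, v', hv'⟩ :=
    IsLocalization.exists_smul_eq_algebraMap_of_algebraMapSubmonoid (T := T) P.primeCompl v
  refine ⟨c * d, P.primeCompl.mul_mem hc hd, mem_relSpan_iff.2
    ⟨m, fun j i => z' (i, j), v', fun j => ?_, ?_⟩⟩
  · rw [mem_relKer, Ideal.mem_bot]
    apply hinjA
    have : ∑ i, algebraMap R A (a i * z' (i, j)) = c • ∑ i, algebraMap R A (a i) * z i j := by
      rw [Finset.smul_sum]
      refine Finset.sum_congr rfl fun i _ => ?_
      rw [map_mul, ← hz', mul_smul_comm]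
    rw [map_sum, map_zero, this, hz j, smul_zero]
  · ext i
    apply hinj
    have hi := hzv i
    have : ∀ j, algebraMap T U (z' (i, j) • v' j) = (c * d) • (z i j • v j) := fun j => by
      rw [Algebra.smul_def, map_mul, ← IsScalarTower.algebraMap_apply R T U,
        IsScalarTower.algebraMap_apply R A U, ← hz', ← hv']
      simp only [Algebra.smul_def, map_mul, ← IsScalarTower.algebraMap_apply R A U]
      ring
    rw [map_sum]
    simp only [this, ← Finset.smul_sum, ← hi]
    rw [Pi.smul_apply, Algebra.smul_def, Algebra.smul_def, map_mul,
      ← IsScalarTower.algebraMap_apply R T U]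

end Localization

section Regular

theorem IsRegularLocalRingP.of_ringEquiv {A B : Type} [CommRing A] [CommRing B] (e : A ≃+* B)
    (h : IsRegularLocalRingP A) : IsRegularLocalRingP B := by
  classical
  obtain ⟨hA, hloc, s, hs, hcard⟩ := h
  have hB : IsLocalRing B := e.isLocalRing
  refine ⟨isNoetherianRing_of_ringEquiv A e, hB, s.map e.toEquiv.toEmbedding, ?_, ?_⟩
  · have : Ideal.span (s.map e.toEquiv.toEmbedding : Set B) =
        (Ideal.span (s : Set A)).map (e : A →+* B) := by
      rw [Ideal.map_span]
      congr 1
      ext b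
      simp
    rw [this, hs]
    exact IsLocalRing.eq_maximalIdeal (Ideal.map_isMaximal_of_equiv e)
  · rw [Finset.card_map, hcard, ringKrullDim_eq_of_ringEquiv e]

theorem isRegularLocalRingP_localization_of_isJ2 {R : Type} [CommRing R] [IsLocalRing R]
    (hJ : IsJ2 R) (hR : IsRegularLocalRingP R) (P : Ideal R) [P.IsPrime] :
    IsRegularLocalRingP (Localization.AtPrime P) := by
  let e : (MvPolynomial (Fin 0) R ⧸ (⊥ : Ideal (MvPolynomial (Fin 0) R))) ≃+* R :=
    (RingEquiv.quotientBot _).trans (MvPolynomial.isEmptyAlgEquiv R (Fin 0)).toRingEquiv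
  have : IsLocalRing (MvPolynomial (Fin 0) R ⧸ (⊥ : Ideal (MvPolynomial (Fin 0) R))) :=
    e.symm.isLocalRing
  let x : PrimeSpectrum (MvPolynomial (Fin 0) R ⧸ (⊥ : Ideal (MvPolynomial (Fin 0) R))) :=
    ⟨P.comap e, inferInstance⟩
  have hclosed : IsRegularLocalRingP (Localization.AtPrime (IsLocalRing.closedPoint
      (MvPolynomial (Fin 0) R ⧸ (⊥ : Ideal (MvPolynomial (Fin 0) R)))).asIdeal) := by
    refine hR.of_ringEquiv (e.symm.trans (IsLocalization.atUnits _
      (IsLocalRing.closedPoint _).asIdeal.primeCompl fun c hc => ?_).toRingEquiv)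
    exact IsLocalRing.notMem_maximalIdeal.1 hc
  have hx : IsRegularLocalRingP (Localization.AtPrime x.asIdeal) :=
    (IsLocalRing.specializes_closedPoint x).mem_open (hJ 0 ⊥) hclosed
  refine hx.of_ringEquiv (IsLocalization.ringEquivOfRingEquiv
    (M := x.asIdeal.primeCompl) (T := P.primeCompl) _ _ e ?_)
  ext r
  constructor
  · rintro ⟨c, hc, rfl⟩
    exact hc
  · intro hr
    exact ⟨e.symm r, fun h => hr (by simpa [x] using h), e.apply_symm_apply r⟩

theorem flat_of_isRegularLocalRingP {A U : Type} [CommRing A] [IsLocalRing A] [CommRing U]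
    [IsDomain U] [Algebra A U] [FaithfulSMul A U] [Algebra.IsIntegral A U] (p : ℕ)
    [Fact p.Prime] [CharP U p] (hU : HasMonicRoots U) (hA : IsRegularLocalRingP A)
    (hflat : ∀ y ∈ IsLocalRing.maximalIdeal A, FlatUpTo U y ⊥) : Module.Flat A U := by
  classical
  obtain ⟨hN, hloc, s, hs, hcard⟩ := hA
  have hreg := isRegularFamily_of_hasRegularParameters s hs hcard.le
  have hmem : ∀ b : s, (b : A) ∈ IsLocalRing.maximalIdeal A := fun b =>
    hs ▸ Ideal.subset_span b.2
  refine flat_of_isRegularFamily (Subtype.val : s → A) Finset.univ ?_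
    (fun b _ => hflat b (hmem b)) hreg
    (IsRegularFamily.of_isIntegral p hU _ (fun b hb => ?_) _ (fun b _ => hflat b (hmem b)) hreg)
  · rw [← hs, powIdeal]
    congr 1
    ext a
    simp
  · have hb0 : (b : A) = 0 := (FaithfulSMul.algebraMap_eq_zero_iff A U).1 hb
    have := hreg ∅ (Finset.empty_subset _) b (Finset.mem_univ b) (Finset.notMem_empty b)
      (fun _ => 1) 1
    simp [powIdeal, hb0] at this

theorem flat_of_forall_isRegularLocalRingP {R T : Type} [CommRing R] [IsDomain R] [IsLocalRing R]
    [IsNoetherianRing R] [CommRing T] [IsDomain T] [Algebra R T] [FaithfulSMul R T] [Algebra.IsIntegral R T] (p : ℕ)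
    [Fact p.Prime] [CharP T p] (hT : HasMonicRoots T)
    (hreg : ∀ (P : Ideal R) [P.IsPrime], IsRegularLocalRingP (Localization.AtPrime P)) :
    Module.Flat R T := by
  suffices h : ∀ (n : ℕ∞) (P : Ideal R), P.height = n → P.IsPrime → FlatAt R T P from
    (h _ _ rfl (IsLocalRing.maximalIdeal.isMaximal R).isPrime).flat
  intro n
  induction n using WellFoundedLT.induction with
  | ind n ih =>
    rintro P rfl hP
    let A := Localization.AtPrime P
    let U := Localization (Algebra.algebraMapSubmonoid T P.primeCompl)
    have hle : Algebra.algebraMapSubmonoid T P.primeCompl ≤ nonZeroDivisors T :=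
      algebraMapSubmonoid_le_nonZeroDivisors P.primeCompl fun h => h P.zero_mem
    have : IsDomain U := IsLocalization.isDomain_localization hle
    have hinj : Function.Injective (algebraMap A U) :=
      localizationAlgebra_injective A U (FaithfulSMul.algebraMap_injective R T)
    have : FaithfulSMul A U := (faithfulSMul_iff_algebraMap_injective A U).2 hinj
    have : Algebra.IsIntegral A U := ⟨isIntegral_localization (R := R) (S := T)⟩
    have : CharP U p := charP_of_injective_algebraMap (IsLocalization.injective U hle) p
    refine flatAt_of_flat (A := A) (U := U) P (flat_of_isRegularLocalRingP p
      (hT.of_isLocalization (Algebra.algebraMapSubmonoid T P.primeCompl)) (hreg P) fun y hy => ?_)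
    exact flatUpTo_bot_of_flatAt_lt P (fun Q hQ hQp =>
      ih _ (Ideal.height_strict_mono_of_isPrime hQ) Q rfl hQp) hy

end Regular

/-- Independence in the sense of Lech: the coefficients of every linear relation between the
elements `f i` belong to the ideal that these elements generate. -/
def LechIndependent {R ι : Type*} [CommRing R] [Fintype ι] (f : ι → R) : Prop :=
  ∀ a : ι → R, ∑ i, a i * f i = 0 → ∀ i, a i ∈ Ideal.span (Set.range f)

section Lech

variable {R ι : Type*} [CommRing R]

theorem length_quotient_le_of_le {I J : Ideal R} (h : I ≤ J) :
    Module.length R (R ⧸ J) ≤ Module.length R (R ⧸ I) :=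
  Module.length_le_of_surjective (Submodule.factor h) (Submodule.factor_surjective h)

theorem exists_linearMap_length_quotient_span_mul_sup (K : Ideal R) (g h : R) :
    ∃ φ : (R ⧸ Ideal.span {h} ⊔ K) →ₗ[R] (R ⧸ Ideal.span {g * h} ⊔ K),
      (∀ a : R, φ (Submodule.Quotient.mk a) = Submodule.Quotient.mk (a * g)) ∧
      Module.length R (R ⧸ Ideal.span {g * h} ⊔ K) =
        Module.length R (LinearMap.range φ) + Module.length R (R ⧸ Ideal.span {g} ⊔ K) := by
  have hle : Ideal.span {h} ⊔ K ≤
      Submodule.comap (LinearMap.toSpanSingleton R R g) (Ideal.span {g * h} ⊔ K) := by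
    refine sup_le ?_ fun k hk => ?_
    · rw [Ideal.span_singleton_le_iff_mem]
      refine Ideal.mem_sup_left ?_
      rw [mul_comm]
      exact Ideal.mem_span_singleton_self _
    · exact Ideal.mem_sup_right (K.mul_mem_right _ hk)
  have hle' : Ideal.span {g * h} ⊔ K ≤ Ideal.span {g} ⊔ K :=
    sup_le_sup_right (Ideal.span_singleton_le_span_singleton.2 (dvd_mul_right g h)) K
  let φ := Submodule.mapQ _ _ _ hle
  refine ⟨φ, fun a => rfl, Module.length_eq_add_of_exact (LinearMap.range φ).subtype
    (Submodule.factor hle') (Submodule.subtype_injective _) (Submodule.factor_surjective _) ?_⟩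
  intro b
  obtain ⟨b, rfl⟩ := Submodule.Quotient.mk_surjective _ b
  rw [Submodule.coe_subtype, Subtype.range_coe,
    show Submodule.factor hle' (Submodule.Quotient.mk b) = Submodule.Quotient.mk b from rfl,
    Submodule.Quotient.mk_eq_zero]
  constructor
  · intro hb
    obtain ⟨u, hu, k, hk, rfl⟩ := Submodule.mem_sup.1 hb
    obtain ⟨c, rfl⟩ := Ideal.mem_span_singleton'.1 hu
    refine ⟨Submodule.Quotient.mk c, ?_⟩
    refine (Submodule.Quotient.eq _).2 ?_
    refine Ideal.mem_sup_right ?_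
    simpa using hk
  · rintro ⟨c, hc⟩
    obtain ⟨c, rfl⟩ := Submodule.Quotient.mk_surjective _ c
    have := hle' ((Submodule.Quotient.eq _).1 hc)
    refine (Submodule.sub_mem_iff_right _ ?_).1 this
    exact Ideal.mem_sup_left (Ideal.mul_mem_left _ _ (Ideal.mem_span_singleton_self g))

theorem length_quotient_span_mul_sup_le (K : Ideal R) (g h : R) :
    Module.length R (R ⧸ Ideal.span {g * h} ⊔ K) ≤
      Module.length R (R ⧸ Ideal.span {g} ⊔ K) + Module.length R (R ⧸ Ideal.span {h} ⊔ K) := by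
  obtain ⟨φ, -, hφ⟩ := exists_linearMap_length_quotient_span_mul_sup K g h
  rw [hφ, add_comm]
  gcongr
  exact Module.length_le_of_surjective φ.rangeRestrict φ.surjective_rangeRestrict

theorem le_length_quotient_span_mul_sup (K : Ideal R) (g h : R)
    (hgh : ∀ a, a * g ∈ Ideal.span {g * h} ⊔ K → a ∈ Ideal.span {h} ⊔ K) :
    Module.length R (R ⧸ Ideal.span {g} ⊔ K) + Module.length R (R ⧸ Ideal.span {h} ⊔ K) ≤
      Module.length R (R ⧸ Ideal.span {g * h} ⊔ K) := by
  obtain ⟨φ, hmk, hφ⟩ := exists_linearMap_length_quotient_span_mul_sup K g h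
  rw [hφ, add_comm]
  gcongr
  refine Module.length_le_of_injective φ.rangeRestrict ?_
  rw [← LinearMap.ker_eq_bot, LinearMap.ker_rangeRestrict, LinearMap.ker_eq_bot']
  intro a ha
  obtain ⟨a, rfl⟩ := Submodule.Quotient.mk_surjective _ a
  rw [hmk, Submodule.Quotient.mk_eq_zero] at ha
  exact (Submodule.Quotient.mk_eq_zero _).2 (hgh a ha)

variable [DecidableEq ι]

theorem span_range_update (f : ι → R) (j : ι) (g : R) :
    Ideal.span (Set.range (Function.update f j g)) =
      Ideal.span {g} ⊔ Ideal.span (f '' {j}ᶜ) := by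
  rw [← Ideal.span_union]
  congr 1
  ext r
  simp only [Set.mem_range, Set.mem_union, Set.mem_singleton_iff, Set.mem_image,
    Set.mem_compl_iff]
  constructor
  · rintro ⟨i, rfl⟩
    by_cases hi : i = j
    · simp [hi]
    · exact Or.inr ⟨i, hi, by simp [hi]⟩
  · rintro (rfl | ⟨i, hi, rfl⟩)
    · exact ⟨j, by simp⟩
    · exact ⟨i, by simp [hi]⟩

theorem span_range_update_mul_le (f : ι → R) (j : ι) (g h : R) :
    Ideal.span (Set.range (Function.update f j (g * h))) ≤
      Ideal.span (Set.range (Function.update f j g)) := by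
  rw [span_range_update, span_range_update]
  exact sup_le_sup_right (Ideal.span_singleton_le_span_singleton.2 (dvd_mul_right g h)) _

theorem pow_update (x : ι → R) (e : ι → ℕ) (j : ι) (k : ℕ) :
    (fun i => x i ^ Function.update e j k i) =
      Function.update (fun i => x i ^ e i) j (x j ^ k) := by
  ext i
  by_cases hi : i = j
  · subst hi; simp
  · simp [hi]

variable [Fintype ι]

theorem sum_mul_update (a f : ι → R) (j : ι) (g : R) :
    ∑ i, a i * Function.update f j g i = a j * g + ∑ i ∈ Finset.univ.erase j, a i * f i := by
  rw [← Finset.add_sum_erase _ _ (Finset.mem_univ j), Function.update_self]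
  congr 1
  exact Finset.sum_congr rfl fun i hi => by
    rw [Function.update_of_ne (Finset.ne_of_mem_erase hi)]

theorem exists_eq_sum_of_mem_span_range_update {f : ι → R} {j : ι} {g r : R}
    (h : r ∈ Ideal.span (Set.range (Function.update f j g))) :
    ∃ c : ι → R, r = c j * g + ∑ i ∈ Finset.univ.erase j, c i * f i := by
  obtain ⟨c, hc⟩ := (Submodule.mem_span_range_iff_exists_fun R).1 h
  refine ⟨c, ?_⟩
  rw [← sum_mul_update, ← hc]
  rfl

/-- The relation obtained from a relation with prescribed coefficient at `j`. -/
theorem LechIndependent.mem_of_add_eq_zero {f : ι → R} {j : ι} {g : R}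
    (h : LechIndependent (Function.update f j g)) (r : R) (a : ι → R)
    (ha : r * g + ∑ i ∈ Finset.univ.erase j, a i * f i = 0) :
    r ∈ Ideal.span (Set.range (Function.update f j g)) ∧
      ∀ i ≠ j, a i ∈ Ideal.span (Set.range (Function.update f j g)) := by
  have key := h (Function.update a j r) (by
    rw [sum_mul_update, Function.update_self, ← ha]
    congr 1
    exact Finset.sum_congr rfl fun i hi => by
      rw [Function.update_of_ne (Finset.ne_of_mem_erase hi)])
  refine ⟨by simpa using key j, fun i hi => by simpa [hi] using key i⟩

theorem LechIndependent.of_update_mul {f : ι → R} {j : ι} {g h : R}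
    (hgh : LechIndependent (Function.update f j (g * h))) :
    LechIndependent (Function.update f j g) := by
  intro a ha
  rw [sum_mul_update] at ha
  have hj := (hgh.mem_of_add_eq_zero (a j) (fun i => h * a i) (by
    rw [← mul_zero h, ← ha, mul_add, Finset.mul_sum]
    congr 1
    · ring
    · exact Finset.sum_congr rfl fun i _ => by ring)).1
  obtain ⟨c, hc⟩ := exists_eq_sum_of_mem_span_range_update hj
  intro i
  by_cases hi : i = j
  · rw [hi]
    exact span_range_update_mul_le f j g h hj
  have hmem := (hgh.mem_of_add_eq_zero (c j * g) (fun i => a i + c i * g) (by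
    rw [hc] at ha
    rw [← ha, add_mul, Finset.sum_mul, add_assoc, ← Finset.sum_add_distrib]
    congr 1
    · ring
    · exact Finset.sum_congr rfl fun i _ => by ring)).2 i hi
  refine (Submodule.add_mem_iff_left _ ?_).1 (span_range_update_mul_le f j g h hmem)
  exact Ideal.mul_mem_left _ _ (Ideal.subset_span ⟨j, by simp⟩)

theorem LechIndependent.mem_of_mul_mem {f : ι → R} {j : ι} {g h : R}
    (hgh : LechIndependent (Function.update f j (g * h))) {a : R}
    (ha : a * g ∈ Ideal.span (Set.range (Function.update f j (g * h)))) :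
    a ∈ Ideal.span (Set.range (Function.update f j h)) := by
  obtain ⟨c, hc⟩ := exists_eq_sum_of_mem_span_range_update ha
  have hmem := (hgh.mem_of_add_eq_zero (a - c j * h) (fun i => -(h * c i)) (by
    have : (a - c j * h) * (g * h) = h * ∑ i ∈ Finset.univ.erase j, c i * f i := by
      linear_combination h * hc
    rw [this, Finset.mul_sum, ← Finset.sum_add_distrib]
    exact Finset.sum_eq_zero fun i _ => by ring)).1
  rw [mul_comm] at hmem
  refine (Submodule.sub_mem_iff_left _ ?_).1 (span_range_update_mul_le f j h g hmem)
  exact Ideal.mul_mem_left _ _ (Ideal.subset_span ⟨j, by simp⟩)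

/-- Induction on families of positive exponents. -/
theorem induction_positive_exponents {P : (ι → ℕ) → Prop} (one : P fun _ => 1)
    (step : ∀ (e : ι → ℕ) (j : ι) (k : ℕ), 1 ≤ k → P (Function.update e j k) →
      P (Function.update e j 1) → P (Function.update e j (k + 1))) :
    ∀ e : ι → ℕ, (∀ i, 1 ≤ e i) → P e := by
  intro e
  induction hn : ∑ i, e i using Nat.strong_induction_on generalizing e with
  | _ n ih =>
    intro he
    by_cases hall : ∀ i, e i = 1
    · rwa [funext hall]
    · push Not at hall
      obtain ⟨j, hj⟩ := hall
      have hj2 : 2 ≤ e j := by have := he j; omega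
      have hlt : ∀ k, 1 ≤ k → k < e j → P (Function.update e j k) := by
        intro k hk hke
        refine ih _ ?_ _ rfl fun i => ?_
        · rw [← hn]
          refine Finset.sum_lt_sum (fun i _ => ?_) ⟨j, Finset.mem_univ j, by simpa using hke⟩
          by_cases hi : i = j
          · subst hi; simpa using hke.le
          · simp [hi]
        · by_cases hi : i = j
          · subst hi; simpa using hk
          · simpa [hi] using he i
      have := step e j (e j - 1) (by omega) (hlt _ (by omega) (by omega)) (hlt 1 le_rfl (by omega))
      rwa [Nat.sub_add_cancel (by omega), Function.update_eq_self] at this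

theorem prod_update (e : ι → ℕ) (j : ι) (k : ℕ) :
    ((∏ i, Function.update e j k i : ℕ) : ℕ∞) = k * (∏ i ∈ Finset.univ.erase j, e i : ℕ) := by
  rw [← Nat.cast_mul]
  congr 1
  rw [← Finset.mul_prod_erase _ _ (Finset.mem_univ j), Function.update_self]
  congr 1
  exact Finset.prod_congr rfl fun i hi => by
    rw [Function.update_of_ne (Finset.ne_of_mem_erase hi)]

theorem length_quotient_span_pow_le (x : ι → R) (e : ι → ℕ) (he : ∀ i, 1 ≤ e i) :
    Module.length R (R ⧸ Ideal.span (Set.range fun i => x i ^ e i)) ≤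
      (∏ i, e i : ℕ) * Module.length R (R ⧸ Ideal.span (Set.range x)) := by
  refine induction_positive_exponents (P := fun e =>
    Module.length R (R ⧸ Ideal.span (Set.range fun i => x i ^ e i)) ≤
      (∏ i, e i : ℕ) * Module.length R (R ⧸ Ideal.span (Set.range x))) ?_ ?_ e he
  · rw [show (fun i => x i ^ 1) = x from funext fun i => pow_one (x i)]
    simp
  · intro e j k hk ih ih1
    rw [pow_update, prod_update, span_range_update] at ih ih1 ⊢
    rw [pow_succ]
    rw [pow_one] at ih1
    refine (length_quotient_span_mul_sup_le _ _ _).trans ((add_le_add ih ih1).trans_eq ?_)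
    push_cast
    ring

theorem LechIndependent.prod_le_length {x : ι → R}
    (hx : Ideal.span (Set.range x) ≠ ⊤) (e : ι → ℕ) (he : ∀ i, 1 ≤ e i)
    (h : LechIndependent fun i => x i ^ e i) :
    ((∏ i, e i : ℕ) : ℕ∞) ≤
      Module.length R (R ⧸ Ideal.span (Set.range fun i => x i ^ e i)) := by
  revert h
  refine induction_positive_exponents (P := fun e => (LechIndependent fun i => x i ^ e i) →
    ((∏ i, e i : ℕ) : ℕ∞) ≤
      Module.length R (R ⧸ Ideal.span (Set.range fun i => x i ^ e i))) ?_ ?_ e he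
  · intro _
    have : Nontrivial (R ⧸ Ideal.span (Set.range x)) := Ideal.Quotient.nontrivial_iff.2 hx
    have := Module.length_pos (R := R) (M := R ⧸ Ideal.span (Set.range x))
    rw [show (fun i => x i ^ 1) = x from funext fun i => pow_one (x i)]
    simpa [Order.one_le_iff_pos] using this
  · intro e j k hk ih ih1 h
    rw [pow_update, prod_update] at ih ih1 ⊢
    rw [pow_update, pow_succ] at h
    rw [pow_succ]
    have ih := ih h.of_update_mul
    have ih1 := ih1 (by rw [pow_one]; rw [mul_comm] at h; exact h.of_update_mul)
    have hcolon := le_length_quotient_span_mul_sup (Ideal.span ((fun i => x i ^ e i) '' {j}ᶜ))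
      (x j ^ k) (x j) (fun a ha => by
        rw [← span_range_update] at ha ⊢
        exact h.mem_of_mul_mem ha)
    rw [span_range_update] at ih ih1 ⊢
    rw [pow_one] at ih1
    refine le_trans (le_of_eq ?_) ((add_le_add ih ih1).trans hcolon)
    push_cast
    ring

end Lech

section Kunz

open IsLocalRing

variable {R T : Type*} [CommRing R] [IsLocalRing R] [CommRing T] [Algebra R T]

theorem map_maximalIdeal_ne_top_of_isIntegral [IsDomain T] [FaithfulSMul R T] [Algebra.IsIntegral R T] :
    (maximalIdeal R).map (algebraMap R T) ≠ ⊤ := by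
  obtain ⟨Q, hQ, hQm⟩ := Ideal.exists_ideal_over_prime_of_isIntegral_of_isDomain (S := T)
    (maximalIdeal R) (by
      rw [(RingHom.injective_iff_ker_eq_bot _).1 (FaithfulSMul.algebraMap_injective R T)]
      exact bot_le)
  intro h
  exact hQ.ne_top (top_le_iff.1 (h ▸ Ideal.map_le_iff_le_comap.2 hQm.ge))

theorem faithfullyFlat_of_isIntegral [IsDomain T] [FaithfulSMul R T] [Algebra.IsIntegral R T]
    [Module.Flat R T] : Module.FaithfullyFlat R T := by
  refine ⟨fun m hm h => ?_⟩
  rw [IsLocalRing.eq_maximalIdeal hm, Ideal.smul_top_eq_map, Submodule.restrictScalars_eq_top_iff] at h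
  exact map_maximalIdeal_ne_top_of_isIntegral h

theorem pow_mem_span_range_pow_of_mem {R ι : Type*} [CommRing R] [Fintype ι] (p : ℕ) [Fact p.Prime]
    [CharP R p] {x : ι → R} {a : R} (ha : a ∈ Ideal.span (Set.range x)) (e : ℕ) :
    a ^ p ^ e ∈ Ideal.span (Set.range fun i => x i ^ p ^ e) := by
  obtain ⟨c, rfl⟩ := (Submodule.mem_span_range_iff_exists_fun R).1 ha
  rw [sum_pow_char_pow]
  refine sum_mem fun i _ => ?_
  rw [smul_eq_mul, mul_pow]
  exact Ideal.mul_mem_left _ _ (Ideal.subset_span ⟨i, rfl⟩)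

theorem lechIndependent_pow_of_flat [Module.FaithfullyFlat R T] [IsDomain T] (p : ℕ)
    [Fact p.Prime] [CharP T p] (hT : HasMonicRoots T) {ι : Type*} [Fintype ι]
    {x : ι → R} (hx : Ideal.span (Set.range x) = maximalIdeal R)
    (hmin : ∀ a : ι → R, ∑ i, a i * x i = 0 → ∀ i, a i ∈ maximalIdeal R) (e : ℕ) :
    LechIndependent fun i => x i ^ p ^ e := by
  intro a ha
  have hroot : ∀ i, ∃ α : T, α ^ p ^ e = algebraMap R T (a i) := fun i => by
    have hpos : p ^ e ≠ 0 := pow_ne_zero e (Fact.out : p.Prime).ne_zero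
    obtain ⟨z, hz⟩ := hT (Polynomial.X ^ p ^ e - Polynomial.C (algebraMap R T (a i)))
      (Polynomial.monic_X_pow_sub_C _ hpos) (by rwa [Polynomial.natDegree_X_pow_sub_C])
    exact ⟨z, by simpa [sub_eq_zero] using hz⟩
  choose α hα using hroot
  have hrel : ∑ i, x i • α i = 0 := by
    have : (∑ i, x i • α i) ^ p ^ e = 0 := by
      rw [sum_pow_char_pow, ← map_zero (algebraMap R T), ← ha, map_sum]
      refine Finset.sum_congr rfl fun i _ => ?_
      rw [Algebra.smul_def, mul_pow, hα, ← map_pow, ← map_mul, mul_comm]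
    exact eq_zero_of_pow_eq_zero this
  obtain ⟨m, z, v, hzv, hz⟩ := Module.Flat.isTrivialRelation_of_sum_smul_eq_zero
    (R := R) (M := T) (f := x) (x := α) hrel
  intro i
  have hmem : α i ∈ Ideal.span (Set.range fun k => algebraMap R T (x k)) := by
    have : Ideal.span (Set.range fun k => algebraMap R T (x k)) =
        (maximalIdeal R).map (algebraMap R T) := by
      rw [← hx, Ideal.map_span, ← Set.range_comp]
      rfl
    rw [this, hzv i]
    refine sum_mem fun j _ => ?_
    rw [Algebra.smul_def]
    refine Ideal.mul_mem_right _ _ (Ideal.mem_map_of_mem _ (hmin (fun k => z k j) ?_ i))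
    simpa [mul_comm] using hz j
  have hpow := pow_mem_span_range_pow_of_mem p hmem e
  rw [hα] at hpow
  rw [← Ideal.comap_map_eq_self_of_faithfullyFlat (B := T)
    (Ideal.span (Set.range fun i => x i ^ p ^ e)), Ideal.mem_comap, Ideal.map_span,
    ← Set.range_comp]
  simpa [Function.comp_def] using hpow

theorem le_of_forall_pow_mul_le {p n d : ℕ} (hp : 1 < p) {L : ℕ}
    (h : ∀ e, (p ^ e) ^ n ≤ (p ^ e) ^ d * L) : n ≤ d := by
  by_contra! hlt
  have h1 : (p ^ L) ^ d * p ^ L ≤ (p ^ L) ^ d * L := by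
    rw [← pow_succ]
    exact (Nat.pow_le_pow_right (by positivity) hlt).trans (h L)
  exact (Nat.lt_pow_self hp).not_ge (le_of_mul_le_mul_left h1 (by positivity))

theorem exists_minimal_generators (R : Type*) [CommRing R] [IsLocalRing R] [IsNoetherianRing R] :
    ∃ s : Finset R, Ideal.span (s : Set R) = maximalIdeal R ∧
      ∀ a : s → R, ∑ i, a i * (i : R) = 0 → ∀ i, a i ∈ maximalIdeal R := by
  classical
  have hex : ∃ n, ∃ s : Finset R, s.card = n ∧ Ideal.span (s : Set R) = maximalIdeal R := by
    obtain ⟨s, hs⟩ := IsNoetherian.noetherian (maximalIdeal R)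
    exact ⟨_, s, rfl, hs⟩
  obtain ⟨s, hcard, hs⟩ := Nat.find_spec hex
  refine ⟨s, hs, fun a ha i => ?_⟩
  by_contra hi
  obtain ⟨u, hu⟩ := notMem_maximalIdeal.1 hi
  refine Nat.find_min hex (m := (s.erase i).card)
    (hcard ▸ Finset.card_erase_lt_of_mem i.2) ⟨_, rfl, ?_⟩
  have hmem : (i : R) ∈ Ideal.span ((s.erase (i : R) : Finset R) : Set R) := by
    rw [← Finset.add_sum_erase _ _ (Finset.mem_univ i), ← hu] at ha
    have hi' : (i : R) = -(↑u⁻¹ * ∑ j ∈ Finset.univ.erase i, a j * (j : R)) := by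
      rw [eq_neg_of_add_eq_zero_right ha, mul_neg, neg_neg, Units.inv_mul_cancel_left]
    have hsum : ∑ j ∈ Finset.univ.erase i, a j * (j : R) ∈
        Ideal.span ((s.erase (i : R) : Finset R) : Set R) :=
      sum_mem fun j hj => Ideal.mul_mem_left _ _ (Ideal.subset_span (Finset.mem_coe.2
        (Finset.mem_erase.2 ⟨fun h => Finset.ne_of_mem_erase hj (Subtype.ext h), j.2⟩)))
    have := neg_mem (Ideal.mul_mem_left _ (↑u⁻¹ : R) hsum)
    rwa [← hi'] at this
  rw [← hs]
  refine le_antisymm (Ideal.span_mono (Finset.coe_subset.2 (Finset.erase_subset _ _))) ?_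
  rw [Ideal.span_le]
  intro b hb
  by_cases hbi : b = i
  · rwa [hbi]
  · exact Ideal.subset_span (by simpa [hbi] using hb)

theorem card_le_ringKrullDim_of_lechIndependent [IsNoetherianRing R] (p : ℕ) [Fact p.Prime]
    [CharP R p] {ι : Type*} [Fintype ι] {x : ι → R}
    (hx : Ideal.span (Set.range x) = maximalIdeal R)
    (hind : ∀ e, LechIndependent fun i => x i ^ p ^ e) :
    (Fintype.card ι : WithBot ℕ∞) ≤ ringKrullDim R := by
  classical
  have hp : p.Prime := Fact.out
  obtain ⟨t, ht, hcard⟩ :=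
    (maximalIdeal R).exists_finset_card_eq_height_of_isNoetherianRing
  have htspan : Ideal.span (Set.range (Subtype.val : t → R)) = Ideal.span (t : Set R) := by simp
  have : IsArtinianRing (R ⧸ Ideal.span (t : Set R)) :=
    quotient_artinian_of_mem_minimalPrimes_of_isLocalRing _ ht
  have : IsArtinian R (R ⧸ Ideal.span (t : Set R)) :=
    isArtinian_of_surjective_algebraMap (R := R ⧸ Ideal.span (t : Set R))
      Ideal.Quotient.mk_surjective
  have hL : Module.length R (R ⧸ Ideal.span (t : Set R)) ≠ ⊤ := Module.length_ne_top
  obtain ⟨L, hL⟩ := ENat.ne_top_iff_exists.1 hL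
  have hle : Fintype.card ι ≤ t.card := by
    refine le_of_forall_pow_mul_le hp.one_lt (L := L) fun e => ?_
    have hpe : 1 ≤ p ^ e := Nat.one_le_pow _ _ hp.pos
    have h1 := LechIndependent.prod_le_length (x := x)
      (hx ▸ (maximalIdeal.isMaximal R).ne_top) (fun _ => p ^ e) (fun _ => hpe) (hind e)
    have h2 : Ideal.span (Set.range fun i : t => (i : R) ^ p ^ e) ≤
        Ideal.span (Set.range fun i => x i ^ p ^ e) := by
      rw [Ideal.span_le]
      rintro _ ⟨i, rfl⟩
      refine pow_mem_span_range_pow_of_mem p ?_ e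
      rw [hx]
      exact ht.1.2 (Ideal.subset_span i.2)
    have h3 := length_quotient_span_pow_le (Subtype.val : t → R) (fun _ => p ^ e) fun _ => hpe
    rw [htspan, ← hL] at h3
    have := (h1.trans (length_quotient_le_of_le h2)).trans h3
    simp only [Finset.prod_const, Finset.card_univ, Fintype.card_coe] at this
    exact_mod_cast this
  rw [← maximalIdeal_height_eq_ringKrullDim, ← hcard]
  exact_mod_cast hle

theorem isRegularLocalRingP_of_flat {R T : Type} [CommRing R] [IsLocalRing R] [IsNoetherianRing R]
    [CommRing T] [IsDomain T] [Algebra R T] [FaithfulSMul R T] [Algebra.IsIntegral R T] (p : ℕ)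
    [Fact p.Prime] [CharP R p] [CharP T p] (hT : HasMonicRoots T) (h : Module.Flat R T) :
    IsRegularLocalRingP R := by
  have := faithfullyFlat_of_isIntegral (R := R) (T := T)
  obtain ⟨s, hs, hmin⟩ := exists_minimal_generators R
  have hrange : Ideal.span (Set.range (Subtype.val : s → R)) = maximalIdeal R := by simpa using hs
  refine ⟨‹_›, ‹_›, s, hs, le_antisymm ?_ ?_⟩
  · simpa using card_le_ringKrullDim_of_lechIndependent p hrange
      (lechIndependent_pow_of_flat p hT hrange hmin)
  · refine (ringKrullDim_le_spanFinrank_maximalIdeal (R := R)).trans ?_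
    rw [← hs]
    have := Submodule.spanFinrank_span_le_ncard_of_finite (R := R) s.finite_toSet
    rw [Set.ncard_coe_finset] at this
    exact_mod_cast this

end Kunz

section AbsIntClo

theorem hasMonicRoots_integralClosure (R K : Type*) [CommRing R] [Field K] [IsAlgClosed K]
    [Algebra R K] : HasMonicRoots (integralClosure R K) := by
  intro f hf hdeg
  obtain ⟨z, hz⟩ := IsAlgClosed.exists_root (f.map (algebraMap (integralClosure R K) K)) (by
    rw [hf.degree_map]
    intro h
    exact hdeg (Polynomial.natDegree_eq_of_degree_eq_some h))
  have hzint : IsIntegral (integralClosure R K) z :=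
    ⟨f, hf, by rwa [Polynomial.IsRoot, Polynomial.eval_map] at hz⟩
  refine ⟨⟨z, isIntegral_trans z hzint⟩, Subtype.val_injective ?_⟩
  rw [Polynomial.IsRoot, Polynomial.eval_map] at hz
  have := Polynomial.hom_eval₂ f (RingHom.id _) (algebraMap (integralClosure R K) K)
    (⟨z, isIntegral_trans z hzint⟩ : integralClosure R K)
  rw [RingHom.comp_id, Polynomial.eval₂_id] at this
  exact this.trans hz

end AbsIntClo

/-- An excellent local domain `R` of prime characteristic `p` is regular if and only if
`R → R⁺` is flat. -/
theorem regular_iff_absIntClo_flat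
    (R : Type) [CommRing R] [IsDomain R] [IsNoetherianRing R] [IsLocalRing R]
    (hExc : IsExcellentRing R)
    (p : ℕ) (hp : p.Prime) [CharP R p] :
    IsRegularLocalRingP R ↔ Module.Flat R (AbsIntClo R) := by
  have : Fact p.Prime := ⟨hp⟩
  have hinj : Function.Injective (algebraMap R (AlgebraicClosure (FractionRing R))) := by
    rw [IsScalarTower.algebraMap_eq R (FractionRing R)]
    exact (algebraMap (FractionRing R) _).injective.comp (IsFractionRing.injective R _)
  have : FaithfulSMul R (AbsIntClo R) := (faithfulSMul_iff_algebraMap_injective _ _).2 fun a b h =>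
    hinj (congrArg Subtype.val h)
  have : CharP (AbsIntClo R) p :=
    charP_of_injective_algebraMap (FaithfulSMul.algebraMap_injective R (AbsIntClo R)) p
  have hT : HasMonicRoots (AbsIntClo R) := hasMonicRoots_integralClosure _ _
  exact ⟨fun h => flat_of_forall_isRegularLocalRingP p hT fun P _ =>
    isRegularLocalRingP_localization_of_isJ2 hExc.2.2.2 h P,
    fun h => isRegularLocalRingP_of_flat p hT h⟩
end
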